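/- arXiv:1910.02278 — 4 statements merged into one kernel-verified Lean document; each statement's English description precedes it below -/
import Mathlib

section
/- Let q = p^s be an odd prime power, F a finite field with q^6 elements, and h ∈ F with h^(q^3+1) = −1 and h^(q^2) = h. Then 𝓛_h is PΓL-equivalent to L^4_δ for some δ ∈ F with δ^2 + δ = 1 if and only if h^q = h (i.e., h ∈ F_q) and p = 5. -/
/-- The linear set `L_f` in `ℙ(F × F)` of a map `f : F → F`: the set of projective
points (F-spans) `[(x, f x)]` for `x ∈ F`, `x ≠ 0`. -/
def linearSet {F : Type} [Field F] (f : F → F) : Set (Projectivization F (F × F)) :=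
  {P | ∃ (x : F) (hx : x ≠ 0),
    P = Projectivization.mk F (x, f x) (fun h0 => hx (congrArg Prod.fst h0))}

/-- Two subsets of `ℙ(F × F)` are PΓL-equivalent if there exist a field automorphism
`ρ` of `F` and a bijective `ρ`-semilinear map `g : F × F → F × F` whose induced map on
`ℙ(F × F)` maps `L` onto `L'`. (A bijective additive `ρ`-semilinear map sends nonzero
vectors to nonzero vectors, so the induced map on projective points is total; requiring
the membership equivalence for all nonzero `v` says exactly that the induced bijection
maps `L` onto `L'`.) -/
def IsPGammaLEquiv {F : Type} [Field F] (L L' : Set (Projectivization F (F × F))) : Prop :=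
  ∃ (ρ : F ≃+* F) (g : (F × F) ≃ (F × F)),
    (∀ u v : F × F, g (u + v) = g u + g v) ∧
    (∀ (c : F) (v : F × F), g (c • v) = ρ c • g v) ∧
    (∀ (v : F × F) (hv : v ≠ 0) (hgv : g v ≠ 0),
      (Projectivization.mk F v hv ∈ L ↔ Projectivization.mk F (g v) hgv ∈ L'))

/-- The `q`-polynomial `f_h(x) = h^(q−1)·x^q − h^(q^2−1)·x^(q^2) + x^(q^4) + x^(q^5)`. -/
def fpol (q : ℕ) {F : Type} [Field F] (h : F) : F → F :=
  fun x => h ^ (q - 1) * x ^ q - h ^ (q ^ 2 - 1) * x ^ (q ^ 2) + x ^ (q ^ 4) + x ^ (q ^ 5)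

section general

open MvPolynomial in
theorem kron_zero {F : Type} [Field F] [Fintype F] {q : ℕ} (hq : 1 < q)
    (hF : Fintype.card F = q ^ 6) (P : MvPolynomial (Fin 6) F)
    (hdeg : ∀ i, P.degreeOf i ≤ q - 1)
    (hev : ∀ m : F, MvPolynomial.eval (fun i : Fin 6 => m ^ (q ^ (i : ℕ))) P = 0) : P = 0 := by
  classical
  let K : Polynomial F := ∑ d ∈ P.support, Polynomial.monomial (∑ i : Fin 6, d i * q ^ (i : ℕ)) (P.coeff d)
  have hlt : ∀ d ∈ P.support, ∀ i, d i < q := fun d hd i => by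
    have := (MvPolynomial.monomial_le_degreeOf i hd).trans (hdeg i)
    omega
  have hval : ∀ (d : Fin 6 →₀ ℕ) (hd : d ∈ P.support),
      (∑ i : Fin 6, d i * q ^ (i : ℕ)) =
        (finFunctionFinEquiv (fun i : Fin 6 => (⟨d i, hlt d hd i⟩ : Fin q)) : ℕ) := fun d hd => by
    rw [finFunctionFinEquiv_apply]
  have hK : K = 0 := by
    apply Polynomial.eq_zero_of_natDegree_lt_card_of_eval_eq_zero' K Finset.univ
    · intro m _
      rw [← hev m, MvPolynomial.eval_eq']
      simp only [K, Polynomial.eval_finsetSum, Polynomial.eval_monomial]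
      refine Finset.sum_congr rfl fun d _ => ?_
      congr 1
      rw [← Finset.prod_pow_eq_pow_sum]
      refine Finset.prod_congr rfl fun i _ => ?_
      rw [← pow_mul, mul_comm]
    · rw [Finset.card_univ, hF]
      refine lt_of_le_of_lt (Polynomial.natDegree_sum_le_of_forall_le (n := q ^ 6 - 1) _ _ ?_) ?_
      · intro d hd
        refine (Polynomial.natDegree_monomial_le _).trans ?_
        rw [hval d hd]
        have := (finFunctionFinEquiv (fun i : Fin 6 => (⟨d i, hlt d hd i⟩ : Fin q))).2
        omega
      · have : 0 < q ^ 6 := by positivity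
        omega
  ext d
  rw [MvPolynomial.coeff_zero]
  by_contra hne
  have hd : d ∈ P.support := MvPolynomial.mem_support_iff.2 hne
  have h1 : K.coeff (∑ i : Fin 6, d i * q ^ (i : ℕ)) = P.coeff d := by
    simp only [K, Polynomial.finsetSum_coeff, Polynomial.coeff_monomial]
    rw [Finset.sum_eq_single d]
    · simp
    · intro e he hed
      rw [if_neg]
      intro heq
      apply hed
      rw [hval e he, hval d hd] at heq
      have h2 := finFunctionFinEquiv.injective (Fin.ext heq)
      ext i
      have := congrFun h2 i
      simpa using this
    · intro h; exact absurd hd h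
  rw [hK] at h1
  exact hne (by simpa using h1.symm)

/-- the multilinear form attached to a matrix -/
def HM {F : Type} [Field F] (D : Matrix (Fin 6) (Fin 6) F) (v : Fin 6 → F × F) : F :=
  Matrix.det (Matrix.of fun i j => (v i).1 * D i j - (v i).2 * (if i = j then 1 else 0))

open MvPolynomial in
noncomputable def PM {F : Type} [Field F] (D : Matrix (Fin 6) (Fin 6) F) (a b c d : Fin 6 → F) :
    MvPolynomial (Fin 6) F :=
  Matrix.det (Matrix.of fun i j => (C (a i) + C (b i) * X i) * C (D i j)
    - (C (c i) + C (d i) * X i) * (if i = j then 1 else 0))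

theorem eval_PM {F : Type} [Field F] (D : Matrix (Fin 6) (Fin 6) F) (a b c d y : Fin 6 → F) :
    MvPolynomial.eval y (PM D a b c d) =
      HM D (fun i => (a i + b i * y i, c i + d i * y i)) := by
  unfold PM HM
  rw [RingHom.map_det]
  congr 1
  ext i j
  simp only [RingHom.mapMatrix_apply, Matrix.map_apply, Matrix.of_apply]
  split_ifs <;> simp

open MvPolynomial in
theorem degreeOf_PM {F : Type} [Field F] (D : Matrix (Fin 6) (Fin 6) F) (a b c d : Fin 6 → F)
    (k : Fin 6) : (PM D a b c d).degreeOf k ≤ 1 := by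
  unfold PM
  rw [← Matrix.det_transpose, Matrix.det_apply]
  refine (degreeOf_sum_le _ _ _).trans (Finset.sup_le fun σ _ => ?_)
  have hlin : ∀ (i : Fin 6) (u v : F), degreeOf k (C u + C v * X i : MvPolynomial (Fin 6) F) ≤ if i = k then 1 else 0 := by
    intro i u v
    refine (degreeOf_add_le _ _ _).trans (max_le (by simp) ?_)
    refine (degreeOf_C_mul_le _ _ _).trans ?_
    rw [degreeOf_X]
    split_ifs <;> simp_all
  have hrow : ∀ i j : Fin 6, degreeOf k ((C (a i) + C (b i) * X i) * C (D i j)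
    - (C (c i) + C (d i) * X i) * (if i = j then 1 else 0) : MvPolynomial (Fin 6) F) ≤ if i = k then 1 else 0 := by
    intro i j
    refine (degreeOf_sub_le _ _ _).trans (max_le ?_ ?_)
    · rw [mul_comm]
      exact (degreeOf_C_mul_le _ _ _).trans (hlin _ _ _)
    · by_cases hij : i = j
      · rw [if_pos hij, mul_one]; exact hlin _ _ _
      · rw [if_neg hij, mul_zero]; simp
  have hs : ∀ P : MvPolynomial (Fin 6) F, degreeOf k (Equiv.Perm.sign σ • P) ≤ degreeOf k P := by
    intro P
    rcases Int.units_eq_one_or (Equiv.Perm.sign σ) with h | h <;> rw [h] <;> simp [degreeOf_neg]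
  refine (hs _).trans ((degreeOf_prod_le _ _ _).trans ?_)
  refine (Finset.sum_le_sum (g := fun i => if i = k then 1 else 0) fun i _ => ?_).trans ?_
  · simp only [Matrix.transpose_apply, Matrix.of_apply]
    exact hrow _ _
  · simp

theorem associated_of_pow {F : Type} [Field F] (P Q : MvPolynomial (Fin 6) F) {n : ℕ} (hn : n ≠ 0)
    (h : P ^ n = Q ^ n) : ∃ z : F, z ≠ 0 ∧ Q = MvPolynomial.C z * P := by
  have h1 : P ∣ Q := (IsIntegrallyClosed.pow_dvd_pow_iff hn).1 (h ▸ dvd_rfl)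
  have h2 : Q ∣ P := (IsIntegrallyClosed.pow_dvd_pow_iff hn).1 (h ▸ dvd_rfl)
  obtain ⟨u, hu⟩ := associated_of_dvd_dvd h1 h2
  obtain ⟨r, hr, hr'⟩ := MvPolynomial.isUnit_iff_eq_C_of_isReduced.1 u.isUnit
  exact ⟨r, hr.ne_zero, by rw [← hu, hr', mul_comm]⟩

theorem prop_of_zeros {F : Type} [Field F] [Fintype F] {q : ℕ} (hq : 1 < q)
    (hF : Fintype.card F = q ^ 6) (D D' : Matrix (Fin 6) (Fin 6) F) (a b c d a' b' c' d' : Fin 6 → F)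
    (hz : ∀ m : F,
      HM D (fun i => (a i + b i * m ^ (q ^ (i : ℕ)), c i + d i * m ^ (q ^ (i : ℕ)))) = 0 ↔
      HM D' (fun i => (a' i + b' i * m ^ (q ^ (i : ℕ)), c' i + d' i * m ^ (q ^ (i : ℕ)))) = 0)
    (h1 : ∀ m : F,
      (HM D (fun i => (a i + b i * m ^ (q ^ (i : ℕ)), c i + d i * m ^ (q ^ (i : ℕ))))) ^ q =
      HM D (fun i => (a i + b i * m ^ (q ^ (i : ℕ)), c i + d i * m ^ (q ^ (i : ℕ)))))
    (h2 : ∀ m : F,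
      (HM D' (fun i => (a' i + b' i * m ^ (q ^ (i : ℕ)), c' i + d' i * m ^ (q ^ (i : ℕ))))) ^ q =
      HM D' (fun i => (a' i + b' i * m ^ (q ^ (i : ℕ)), c' i + d' i * m ^ (q ^ (i : ℕ))))) :
    ∃ z : F, z ≠ 0 ∧ ∀ y : Fin 6 → F,
      HM D' (fun i => (a' i + b' i * y i, c' i + d' i * y i)) =
      z * HM D (fun i => (a i + b i * y i, c i + d i * y i)) := by
  have key : PM D a b c d ^ (q - 1) = PM D' a' b' c' d' ^ (q - 1) := by
    rw [← sub_eq_zero]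
    apply kron_zero hq hF
    · intro i
      refine (MvPolynomial.degreeOf_sub_le _ _ _).trans (max_le ?_ ?_) <;>
      · refine (MvPolynomial.degreeOf_pow_le _ _ _).trans ?_
        refine (Nat.mul_le_mul_left _ (degreeOf_PM _ _ _ _ _ _)).trans ?_
        omega
    · intro m
      rw [map_sub, map_pow, map_pow, eval_PM, eval_PM, sub_eq_zero]
      have aux : ∀ x : F, x ^ q = x → x ≠ 0 → x ^ (q - 1) = 1 := by
        intro x hx hx0
        have : x ^ (q - 1) * x = 1 * x := by
          rw [← pow_succ, Nat.sub_add_cancel hq.le, hx, one_mul]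
        exact mul_right_cancel₀ hx0 this
      by_cases h0 : HM D (fun i => (a i + b i * m ^ (q ^ (i : ℕ)), c i + d i * m ^ (q ^ (i : ℕ)))) = 0
      · rw [h0, (hz m).1 h0]
      · rw [aux _ (h1 m) h0, aux _ (h2 m) (fun h => h0 ((hz m).2 h))]
  obtain ⟨z, hz0, hzz⟩ := associated_of_pow _ _ (by omega) key
  refine ⟨z, hz0, fun y => ?_⟩
  rw [← eval_PM, ← eval_PM, hzz]
  simp

/-- multilinear version -/
noncomputable def HMm {F : Type} [Field F] (D : Matrix (Fin 6) (Fin 6) F) (a b c d : Fin 6 → F) :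
    MultilinearMap F (fun _ : Fin 6 => F × F) F :=
  (Matrix.detRowAlternating (n := Fin 6) (R := F)).toMultilinearMap.compLinearMap
    (fun i => LinearMap.pi fun j =>
      (D i j) • (a i • LinearMap.fst F F F + b i • LinearMap.snd F F F)
        - (if i = j then (1 : F) else 0) • (c i • LinearMap.fst F F F + d i • LinearMap.snd F F F))

theorem HMm_apply {F : Type} [Field F] (D : Matrix (Fin 6) (Fin 6) F) (a b c d : Fin 6 → F)
    (v : Fin 6 → F × F) : HMm D a b c d v =
      HM D (fun i => (a i * (v i).1 + b i * (v i).2, c i * (v i).1 + d i * (v i).2)) := by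
  unfold HMm HM
  simp only [MultilinearMap.compLinearMap_apply]
  change Matrix.det _ = _
  congr 1
  ext i j
  by_cases hij : i = j
  · simp [hij]; ring
  · simp [hij]; ring

theorem HM_hom {F : Type} [Field F] (D D' : Matrix (Fin 6) (Fin 6) F) (a b c d : Fin 6 → F) (z : F)
    (hy : ∀ y : Fin 6 → F, HM D' (fun i => (a i + b i * y i, c i + d i * y i)) =
      z * HM D (fun i => (1, y i))) (v : Fin 6 → F × F) :
    HM D' (fun i => (a i * (v i).1 + b i * (v i).2, c i * (v i).1 + d i * (v i).2)) =
      z * HM D v := by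
  have : HMm D' a b c d = z • HMm D 1 0 0 1 := by
    let B0 : Fin 2 → F × F := ![(1, 0), (1, 1)]
    have hli : LinearIndependent F B0 := by
      rw [LinearIndependent.pair_iff]
      intro s t h
      simp at h
      refine ⟨?_, h.2⟩
      simpa [h.2] using h.1
    let B := basisOfLinearIndependentOfCardEqFinrank hli (by simp)
    have hB : ∀ k, B k = B0 k := fun k => by simp [B]
    have hB1 : ∀ k, (B0 k).1 = 1 := fun k => by fin_cases k <;> simp [B0]
    apply Module.Basis.ext_multilinear (fun _ => B)
    intro w
    rw [_root_.smul_apply, HMm_apply, HMm_apply]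
    simp only [hB, hB1, mul_one, smul_eq_mul]
    have := hy (fun i => (B0 (w i)).2)
    simpa using this
  have h2 := congrArg (fun f => f v) this
  simp only [_root_.smul_apply, HMm_apply, smul_eq_mul] at h2
  simpa using h2

/-- Dickson matrix. -/
def Dick {F : Type} [Field F] (q : ℕ) (a : Fin 6 → F) : Matrix (Fin 6) (Fin 6) F :=
  Matrix.of fun i j => (a (j - i)) ^ (q ^ (i : ℕ))

theorem Dick_mulVec {F : Type} [Field F] [Fintype F] {q : ℕ}
    (hF : Fintype.card F = q ^ 6) (hadd : ∀ (k : ℕ) (x y : F), (x + y) ^ (q ^ k) = x ^ (q ^ k) + y ^ (q ^ k))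
    (a : Fin 6 → F) (x : F) (i : Fin 6) :
    (∑ k : Fin 6, a k * x ^ (q ^ (k : ℕ))) ^ (q ^ (i : ℕ)) =
      ∑ j : Fin 6, Dick q a i j * x ^ (q ^ (j : ℕ)) := by
  have h6 : ∀ (y : F) (k : ℕ), y ^ (q ^ (k + 6)) = y ^ (q ^ k) := by
    intro y k
    rw [add_comm, pow_add, pow_mul, ← hF, FiniteField.pow_card]
  have e6 := h6 x 0
  have e7 := h6 x 1
  have e8 := h6 x 2
  have e9 := h6 x 3
  have e10 := h6 x 4
  simp only [Fin.sum_univ_six, hadd, mul_pow, ← pow_mul, ← pow_add, Dick, Matrix.of_apply]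
  norm_num at e6 e7 e8 e9 e10
  have n1 : (-1 : Fin 6) = 5 := rfl
  have n2 : (-2 : Fin 6) = 4 := rfl
  have n3 : (-3 : Fin 6) = 3 := rfl
  have n4 : (-4 : Fin 6) = 2 := rfl
  have n5 : (-5 : Fin 6) = 1 := rfl
  fin_cases i <;> simp [Fin.sub_def, n1, n2, n3, n4, n5, e6, e7, e8, e9, e10] <;> ring

theorem Dick_det_iff {F : Type} [Field F] [Fintype F] {q : ℕ} (hq : 1 < q)
    (hF : Fintype.card F = q ^ 6) (hadd : ∀ (k : ℕ) (x y : F), (x + y) ^ (q ^ k) = x ^ (q ^ k) + y ^ (q ^ k))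
    (a : Fin 6 → F) :
    (∃ x : F, x ≠ 0 ∧ ∑ k : Fin 6, a k * x ^ (q ^ (k : ℕ)) = 0) ↔ (Dick q a).det = 0 := by
  have hq0 : ∀ k : ℕ, q ^ k ≠ 0 := fun k => by positivity
  constructor
  · rintro ⟨x, hx, h⟩
    rw [← Matrix.exists_mulVec_eq_zero_iff]
    refine ⟨fun j => x ^ (q ^ (j : ℕ)), fun h0 => hx ?_, ?_⟩
    · simpa using congrFun h0 0
    · ext i
      simp only [Matrix.mulVec, dotProduct]
      rw [← Dick_mulVec hF hadd, h, zero_pow (hq0 _)]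
      rfl
  · intro h
    obtain ⟨u, hu0, hu⟩ := Matrix.exists_vecMul_eq_zero_iff.2 h
    by_contra hno
    push Not at hno
    let φ : F →+ F :=
      { toFun := fun x => ∑ k : Fin 6, a k * x ^ (q ^ (k : ℕ))
        map_zero' := by simp [zero_pow (hq0 _)]
        map_add' := fun x y => by simp only [hadd, mul_add, Finset.sum_add_distrib] }
    have hinj : Function.Injective φ := by
      rw [injective_iff_map_eq_zero]
      intro x hx
      by_contra hx0
      exact hno x hx0 hx
    have hsurj := Finite.surjective_of_injective hinj
    let K : Polynomial F := ∑ i : Fin 6, Polynomial.monomial (q ^ (i : ℕ)) (u i)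
    have hK : K = 0 := by
      apply Polynomial.eq_zero_of_natDegree_lt_card_of_eval_eq_zero' K Finset.univ
      · intro m _
        obtain ⟨x, rfl⟩ := hsurj m
        simp only [K, Polynomial.eval_finsetSum, Polynomial.eval_monomial]
        have : ∀ i : Fin 6, φ x ^ (q ^ (i : ℕ)) = ∑ j : Fin 6, Dick q a i j * x ^ (q ^ (j : ℕ)) :=
          fun i => Dick_mulVec hF hadd a x i
        simp only [this, Finset.mul_sum]
        rw [Finset.sum_comm]
        refine Finset.sum_eq_zero fun j _ => ?_
        have hj := congrFun hu j
        simp only [Matrix.vecMul, dotProduct, Pi.zero_apply] at hj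
        simp only [← mul_assoc, ← Finset.sum_mul, hj, zero_mul]
      · rw [Finset.card_univ, hF]
        refine lt_of_le_of_lt (Polynomial.natDegree_sum_le_of_forall_le (n := q ^ 5) _ _ ?_) ?_
        · intro i _
          refine (Polynomial.natDegree_monomial_le _).trans ?_
          exact Nat.pow_le_pow_right (by omega) (by omega)
        · exact Nat.pow_lt_pow_right hq (by norm_num)
    apply hu0
    ext i
    have h1 : K.coeff (q ^ (i : ℕ)) = u i := by
      simp only [K, Polynomial.finsetSum_coeff, Polynomial.coeff_monomial]
      rw [Finset.sum_eq_single i]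
      · simp
      · intro j _ hji
        rw [if_neg]
        intro heq
        exact hji (Fin.ext (Nat.pow_right_injective hq heq))
      · simp
    rw [← h1, hK]; simp

theorem Dick_det_pow {F : Type} [Field F] [Fintype F] {q : ℕ} (σ : F →+* F) (hσ : ∀ x, σ x = x ^ q)
    (hF : Fintype.card F = q ^ 6) (a : Fin 6 → F) : (Dick q a).det ^ q = (Dick q a).det := by
  rw [← hσ, RingHom.map_det]
  have : σ.mapMatrix (Dick q a) = (Dick q a).submatrix (Equiv.addRight (1 : Fin 6)) (Equiv.addRight (1 : Fin 6)) := by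
    ext i j
    simp only [RingHom.mapMatrix_apply, Matrix.map_apply, Matrix.submatrix_apply, Dick, Matrix.of_apply,
      Equiv.coe_addRight, add_sub_add_right_eq_sub, hσ, ← pow_mul, ← pow_succ]
    by_cases hi : i = 5
    · subst hi
      have : ((5 : Fin 6) : ℕ) + 1 = 6 := rfl
      rw [this, ← hF, FiniteField.pow_card]
      simp
    · congr 2
      rw [Fin.val_add_one_of_lt]
      exact lt_of_le_of_ne (Fin.le_last i) hi
  rw [this, Matrix.det_submatrix_equiv_self]

theorem HM_eq_Dick {F : Type} [Field F] {q : ℕ} (σ : F →+* F) (hσ : ∀ x, σ x = x ^ q)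
    (f : Fin 6 → F) (s X : F) :
    HM (Dick q f) (fun i => (s ^ (q ^ (i : ℕ)), X ^ (q ^ (i : ℕ)))) =
      (Dick q (fun k => s * f k - X * (if k = 0 then 1 else 0))).det := by
  have hs : ∀ (k : ℕ) (x : F), x ^ (q ^ k) = (σ ^ k) x := by
    intro k x
    induction k with
    | zero => simp
    | succ n ih => rw [pow_succ, pow_mul, ih, pow_succ', RingHom.mul_def]; simp [hσ]
  unfold HM
  congr 1
  ext i j
  simp only [Dick, Matrix.of_apply, hs, map_sub, map_mul]
  congr 2
  by_cases hij : i = j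
  · simp [hij]
  · rw [if_neg hij, if_neg (sub_ne_zero.2 (Ne.symm hij)), map_zero]

end general
theorem d6 {F : Type} [Field F] (M : Matrix (Fin 6) (Fin 6) F) : M.det = 
  M 0 0 * (M.submatrix ![1,2,3,4,5] ![1,2,3,4,5]).det - M 0 1 * (M.submatrix ![1,2,3,4,5] ![0,2,3,4,5]).det
  + M 0 2 * (M.submatrix ![1,2,3,4,5] ![0,1,3,4,5]).det - M 0 3 * (M.submatrix ![1,2,3,4,5] ![0,1,2,4,5]).det
  + M 0 4 * (M.submatrix ![1,2,3,4,5] ![0,1,2,3,5]).det - M 0 5 * (M.submatrix ![1,2,3,4,5] ![0,1,2,3,4]).det := by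
  rw [Matrix.det_succ_row_zero, Fin.sum_univ_six]
  have e : ∀ i : Fin 6, M.submatrix Fin.succ i.succAbove = M.submatrix ![1,2,3,4,5] (![![1,2,3,4,5],![0,2,3,4,5],![0,1,3,4,5],![0,1,2,4,5],![0,1,2,3,5],![0,1,2,3,4]] i) := by
    intro i
    congr 1
    · ext j; fin_cases j <;> rfl
    · ext j; fin_cases i <;> fin_cases j <;> rfl
  simp only [e]
  norm_num
  simp
  ring
theorem d5 {F : Type} [Field F] (M : Matrix (Fin 5) (Fin 5) F) : M.det = 
  M 0 0 * (M.submatrix ![1,2,3,4] ![1,2,3,4]).det - M 0 1 * (M.submatrix ![1,2,3,4] ![0,2,3,4]).det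
  + M 0 2 * (M.submatrix ![1,2,3,4] ![0,1,3,4]).det - M 0 3 * (M.submatrix ![1,2,3,4] ![0,1,2,4]).det
  + M 0 4 * (M.submatrix ![1,2,3,4] ![0,1,2,3]).det := by
  rw [Matrix.det_succ_row_zero, Fin.sum_univ_five]
  have e : ∀ i : Fin 5, M.submatrix Fin.succ i.succAbove = M.submatrix ![1,2,3,4] (![![1,2,3,4],![0,2,3,4],![0,1,3,4],![0,1,2,4],![0,1,2,3]] i) := by
    intro i
    congr 1
    · ext j; fin_cases j <;> rfl
    · ext j; fin_cases i <;> fin_cases j <;> rfl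
  simp only [e]
  norm_num
  simp
  ring
theorem d4 {F : Type} [Field F] (M : Matrix (Fin 4) (Fin 4) F) : M.det = 
  M 0 0 * (M.submatrix ![1,2,3] ![1,2,3]).det - M 0 1 * (M.submatrix ![1,2,3] ![0,2,3]).det
  + M 0 2 * (M.submatrix ![1,2,3] ![0,1,3]).det - M 0 3 * (M.submatrix ![1,2,3] ![0,1,2]).det := by
  rw [Matrix.det_succ_row_zero, Fin.sum_univ_four]
  have e : ∀ i : Fin 4, M.submatrix Fin.succ i.succAbove = M.submatrix ![1,2,3] (![![1,2,3],![0,2,3],![0,1,3],![0,1,2]] i) := by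
    intro i
    congr 1
    · ext j; fin_cases j <;> rfl
    · ext j; fin_cases i <;> fin_cases j <;> rfl
  simp only [e]
  norm_num
  simp
  ring

section explicit

def DhM {F : Type} [Field F] (c k : F) : Matrix (Fin 6) (Fin 6) F :=
  !![0, c, -1, 0, 1, 1; 1, 0, k, -1, 0, 1; 1, 1, 0, c, -1, 0;
     0, 1, 1, 0, k, -1; -1, 0, 1, 1, 0, c; k, -1, 0, 1, 1, 0]

def D4M {F : Type} [Field F] (t u : F) : Matrix (Fin 6) (Fin 6) F :=
  !![0, 1, 0, 1, 0, t; u, 0, 1, 0, 1, 0; 0, t, 0, 1, 0, 1;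
     1, 0, u, 0, 1, 0; 0, 1, 0, t, 0, 1; 1, 0, 1, 0, u, 0]

def Hp {F : Type} [Field F] (c k s0 s1 s2 s3 s4 s5 X0 X1 X2 X3 X4 X5 : F) : F :=
    -c ^ 3 * s0 * s1 * s2 * s3 * s4 * s5 - 6 * c ^ 2 * s0 * s1 * s2 * s3 * s4 * s5 + c ^ 2 * s0
    * s1 * s2 * s3 * X4 * X5 + c ^ 2 * s0 * s1 * s4 * s5 * X2 * X3 + c ^ 2 * s2 * s3 * s4 * s5 *
    X0 * X1 - 15 * c * s0 * s1 * s2 * s3 * s4 * s5 + 2 * c * s0 * s1 * s2 * s3 * X4 * X5 - c *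
    s0 * s1 * s2 * s4 * X3 * X5 - c * s0 * s1 * s3 * s5 * X2 * X4 + 2 * c * s0 * s1 * s4 * s5 *
    X2 * X3 - c * s0 * s1 * X2 * X3 * X4 * X5 - c * s0 * s2 * s3 * s4 * X1 * X5 - c * s0 * s2 *
    s4 * s5 * X1 * X3 - c * s1 * s2 * s3 * s5 * X0 * X4 - c * s1 * s3 * s4 * s5 * X0 * X2 + 2 *
    c * s2 * s3 * s4 * s5 * X0 * X1 - c * s2 * s3 * X0 * X1 * X4 * X5 - c * s4 * s5 * X0 * X1 *
    X2 * X3 - k ^ 3 * s0 * s1 * s2 * s3 * s4 * s5 - 6 * k ^ 2 * s0 * s1 * s2 * s3 * s4 * s5 + k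
    ^ 2 * s0 * s1 * s2 * s5 * X3 * X4 + k ^ 2 * s0 * s3 * s4 * s5 * X1 * X2 + k ^ 2 * s1 * s2 *
    s3 * s4 * X0 * X5 - 15 * k * s0 * s1 * s2 * s3 * s4 * s5 - k * s0 * s1 * s2 * s4 * X3 * X5 +
    2 * k * s0 * s1 * s2 * s5 * X3 * X4 - k * s0 * s1 * s3 * s5 * X2 * X4 - k * s0 * s2 * s3 *
    s4 * X1 * X5 - k * s0 * s2 * s4 * s5 * X1 * X3 + 2 * k * s0 * s3 * s4 * s5 * X1 * X2 - k *
    s0 * s5 * X1 * X2 * X3 * X4 + 2 * k * s1 * s2 * s3 * s4 * X0 * X5 - k * s1 * s2 * s3 * s5 *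
    X0 * X4 - k * s1 * s2 * X0 * X3 * X4 * X5 - k * s1 * s3 * s4 * s5 * X0 * X2 - k * s3 * s4 *
    X0 * X1 * X2 * X5 - 20 * s0 * s1 * s2 * s3 * s4 * s5 + s0 * s1 * s2 * s3 * X4 * X5 - 2 * s0
    * s1 * s2 * s4 * X3 * X5 + s0 * s1 * s2 * s5 * X3 * X4 - 2 * s0 * s1 * s3 * s5 * X2 * X4 +
    s0 * s1 * s4 * s5 * X2 * X3 - 2 * s0 * s2 * s3 * s4 * X1 * X5 - 2 * s0 * s2 * s4 * s5 * X1 *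
    X3 + s0 * s2 * X1 * X3 * X4 * X5 + s0 * s3 * s4 * s5 * X1 * X2 + s0 * s4 * X1 * X2 * X3 * X5
    + s1 * s2 * s3 * s4 * X0 * X5 - 2 * s1 * s2 * s3 * s5 * X0 * X4 - 2 * s1 * s3 * s4 * s5 * X0
    * X2 + s1 * s3 * X0 * X2 * X4 * X5 + s1 * s5 * X0 * X2 * X3 * X4 + s2 * s3 * s4 * s5 * X0 *
    X1 + s2 * s4 * X0 * X1 * X3 * X5 + s3 * s5 * X0 * X1 * X2 * X4 + X0 * X1 * X2 * X3 * X4 * X5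

def Gp {F : Type} [Field F] (t u s0 s1 s2 s3 s4 s5 X0 X1 X2 X3 X4 X5 : F) : F :=
    -t ^ 3 * u ^ 3 * s0 * s1 * s2 * s3 * s4 * s5 + 3 * t ^ 3 * u * s0 * s1 * s2 * s3 * s4 * s5 -
    2 * t ^ 3 * s0 * s1 * s2 * s3 * s4 * s5 - t ^ 2 * u * s0 * s1 * s2 * s5 * X3 * X4 - t ^ 2 *
    u * s0 * s3 * s4 * s5 * X1 * X2 - t ^ 2 * u * s1 * s2 * s3 * s4 * X0 * X5 + t ^ 2 * s0 * s1
    * s2 * s5 * X3 * X4 + t ^ 2 * s0 * s3 * s4 * s5 * X1 * X2 + t ^ 2 * s1 * s2 * s3 * s4 * X0 *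
    X5 + 3 * t * u ^ 3 * s0 * s1 * s2 * s3 * s4 * s5 - t * u ^ 2 * s0 * s1 * s2 * s3 * X4 * X5 -
    t * u ^ 2 * s0 * s1 * s4 * s5 * X2 * X3 - t * u ^ 2 * s2 * s3 * s4 * s5 * X0 * X1 - 9 * t *
    u * s0 * s1 * s2 * s3 * s4 * s5 + t * u * s0 * s1 * s3 * s4 * X2 * X5 + t * u * s0 * s2 * s3
    * s5 * X1 * X4 + t * u * s1 * s2 * s4 * s5 * X0 * X3 + 6 * t * s0 * s1 * s2 * s3 * s4 * s5 +
    t * s0 * s1 * s2 * s3 * X4 * X5 - t * s0 * s1 * s3 * s4 * X2 * X5 + t * s0 * s1 * s4 * s5 *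
    X2 * X3 - t * s0 * s2 * s3 * s5 * X1 * X4 - t * s0 * s5 * X1 * X2 * X3 * X4 - t * s1 * s2 *
    s4 * s5 * X0 * X3 - t * s1 * s2 * X0 * X3 * X4 * X5 + t * s2 * s3 * s4 * s5 * X0 * X1 - t *
    s3 * s4 * X0 * X1 * X2 * X5 - 2 * u ^ 3 * s0 * s1 * s2 * s3 * s4 * s5 + u ^ 2 * s0 * s1 * s2
    * s3 * X4 * X5 + u ^ 2 * s0 * s1 * s4 * s5 * X2 * X3 + u ^ 2 * s2 * s3 * s4 * s5 * X0 * X1 +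
    6 * u * s0 * s1 * s2 * s3 * s4 * s5 + u * s0 * s1 * s2 * s5 * X3 * X4 - u * s0 * s1 * s3 *
    s4 * X2 * X5 - u * s0 * s1 * X2 * X3 * X4 * X5 - u * s0 * s2 * s3 * s5 * X1 * X4 + u * s0 *
    s3 * s4 * s5 * X1 * X2 + u * s1 * s2 * s3 * s4 * X0 * X5 - u * s1 * s2 * s4 * s5 * X0 * X3 -
    u * s2 * s3 * X0 * X1 * X4 * X5 - u * s4 * s5 * X0 * X1 * X2 * X3 - 4 * s0 * s1 * s2 * s3 *
    s4 * s5 - s0 * s1 * s2 * s3 * X4 * X5 - s0 * s1 * s2 * s5 * X3 * X4 + s0 * s1 * s3 * s4 * X2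
    * X5 - s0 * s1 * s4 * s5 * X2 * X3 + s0 * s2 * s3 * s5 * X1 * X4 - s0 * s3 * s4 * s5 * X1 *
    X2 - s0 * s3 * X1 * X2 * X4 * X5 - s1 * s2 * s3 * s4 * X0 * X5 + s1 * s2 * s4 * s5 * X0 * X3
    - s1 * s4 * X0 * X2 * X3 * X5 - s2 * s3 * s4 * s5 * X0 * X1 - s2 * s5 * X0 * X1 * X3 * X4 +
    X0 * X1 * X2 * X3 * X4 * X5

set_option maxHeartbeats 4000000 in
theorem HM_DhM {F : Type} [Field F] (c k : F) (hck : c * k = 1) (v : Fin 6 → F × F) :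
    HM (DhM c k) v = Hp c k (v 0).1 (v 1).1 (v 2).1 (v 3).1 (v 4).1 (v 5).1 (v 0).2 (v 1).2 (v 2).2 (v 3).2 (v 4).2 (v 5).2 := by
  unfold HM DhM Hp
  rw [d6]
  simp only [d5, d4, Matrix.det_fin_three, Matrix.submatrix_apply, Matrix.of_apply]
  simp
  generalize (v 0).1 = s0
  generalize (v 1).1 = s1
  generalize (v 2).1 = s2
  generalize (v 3).1 = s3
  generalize (v 4).1 = s4
  generalize (v 5).1 = s5
  generalize (v 0).2 = X0
  generalize (v 1).2 = X1
  generalize (v 2).2 = X2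
  generalize (v 3).2 = X3
  generalize (v 4).2 = X4
  generalize (v 5).2 = X5
  linear_combination (
    -c ^ 2 * k ^ 2 * s0 * s1 * s2 * s3 * s4 * s5 + 2 * c * k * s0 * s1 * s2 * s3 * s4 * s5 + c *
    k * s0 * s1 * s2 * s3 * s4 * X5 + c * k * s0 * s1 * s2 * s3 * s5 * X4 + c * k * s0 * s1 * s2
    * s4 * s5 * X3 + c * k * s0 * s1 * s3 * s4 * s5 * X2 + c * k * s0 * s2 * s3 * s4 * s5 * X1 +
    c * k * s1 * s2 * s3 * s4 * s5 * X0 - 3 * c * s0 * s1 * s2 * s3 * s4 * s5 + c * s0 * s1 * s2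
    * s3 * s4 * X5 + c * s0 * s1 * s2 * s3 * s5 * X4 + c * s0 * s1 * s2 * s4 * s5 * X3 + c * s0
    * s1 * s3 * s4 * s5 * X2 + c * s0 * s2 * s3 * s4 * s5 * X1 + c * s1 * s2 * s3 * s4 * s5 * X0
    - 3 * k * s0 * s1 * s2 * s3 * s4 * s5 + k * s0 * s1 * s2 * s3 * s4 * X5 + k * s0 * s1 * s2 *
    s3 * s5 * X4 + k * s0 * s1 * s2 * s4 * s5 * X3 + k * s0 * s1 * s3 * s4 * s5 * X2 + k * s0 *
    s2 * s3 * s4 * s5 * X1 + k * s1 * s2 * s3 * s4 * s5 * X0 - 13 * s0 * s1 * s2 * s3 * s4 * s5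
    + s0 * s1 * s2 * s3 * s4 * X5 + s0 * s1 * s2 * s3 * s5 * X4 + s0 * s1 * s2 * s4 * s5 * X3 -
    s0 * s1 * s2 * s4 * X3 * X5 - s0 * s1 * s2 * X3 * X4 * X5 + s0 * s1 * s3 * s4 * s5 * X2 - s0
    * s1 * s3 * s5 * X2 * X4 - s0 * s1 * s5 * X2 * X3 * X4 + s0 * s2 * s3 * s4 * s5 * X1 - s0 *
    s2 * s3 * s4 * X1 * X5 - s0 * s2 * s4 * s5 * X1 * X3 - s0 * s4 * s5 * X1 * X2 * X3 + s1 * s2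
    * s3 * s4 * s5 * X0 - s1 * s2 * s3 * s5 * X0 * X4 - s1 * s2 * s3 * X0 * X4 * X5 - s1 * s3 *
    s4 * s5 * X0 * X2 - s2 * s3 * s4 * X0 * X1 * X5 - s3 * s4 * s5 * X0 * X1 * X2) * hck

set_option maxHeartbeats 4000000 in
theorem HM_D4M {F : Type} [Field F] (t u : F) (v : Fin 6 → F × F) :
    HM (D4M t u) v = Gp t u (v 0).1 (v 1).1 (v 2).1 (v 3).1 (v 4).1 (v 5).1 (v 0).2 (v 1).2 (v 2).2 (v 3).2 (v 4).2 (v 5).2 := by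
  unfold HM D4M Gp
  rw [d6]
  simp only [d5, d4, Matrix.det_fin_three, Matrix.submatrix_apply, Matrix.of_apply]
  simp
  ring

end explicit
section lie

set_option maxHeartbeats 4000000 in
theorem HM_flip {F : Type} [Field F] (t u : F) (v : Fin 6 → F × F) :
    ∑ i : Fin 6, (-1) ^ (i : ℕ) * HM (D4M t u) (Function.update v i ((v i).1, -(v i).2)) = 0 := by
  simp only [HM_D4M, Fin.sum_univ_six]
  simp [Function.update, Gp]
  ring

theorem HM_lie {F : Type} [Field F] (t u : F) (D : Matrix (Fin 6) (Fin 6) F) (a b c d U V W : Fin 6 → F)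
    (z : F) (hz : z ≠ 0)
    (h : ∀ v : Fin 6 → F × F,
      HM (D4M t u) (fun i => (a i * (v i).1 + b i * (v i).2, c i * (v i).1 + d i * (v i).2)) =
      z * HM D v)
    (h1 : ∀ i, V i * a i - W i * b i = a i) (h2 : ∀ i, V i * c i - W i * d i = - c i)
    (h3 : ∀ i, U i * a i - V i * b i = b i) (h4 : ∀ i, U i * c i - V i * d i = - d i)
    (v : Fin 6 → F × F) :
    ∑ i : Fin 6, (-1) ^ (i : ℕ) * HM D (Function.update v i
      (V i * (v i).1 + U i * (v i).2, - W i * (v i).1 - V i * (v i).2)) = 0 := by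
  apply mul_left_cancel₀ hz
  rw [mul_zero, ← HM_flip t u (fun i => (a i * (v i).1 + b i * (v i).2, c i * (v i).1 + d i * (v i).2)),
    Finset.mul_sum]
  refine Finset.sum_congr rfl fun i _ => ?_
  rw [mul_left_comm, ← h]
  congr 2
  ext j
  · by_cases hj : j = i
    · subst hj
      simp only [Function.update_self]
      linear_combination (v j).1 * h1 j + (v j).2 * h3 j
    · simp [Function.update_of_ne hj]
  · by_cases hj : j = i
    · subst hj
      simp only [Function.update_self]
      linear_combination (v j).1 * h2 j + (v j).2 * h4 j
    · simp [Function.update_of_ne hj]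

theorem lie_solve_aux {F : Type} [Field F] (h2 : (2 : F) ≠ 0) (c k : F) (hck : c * k = 1) (hc : c + 1 ≠ 0)
    (U W : Fin 6 → F)
    (b0 : W 0 = c * U 1 + U 2 + U 4 + k * U 5)
    (b1 : W 1 = c * U 0 + k * U 2 + U 3 + U 5)
    (b2 : W 2 = U 0 + k * U 1 + c * U 3 + U 4)
    (b3 : W 3 = U 1 + c * U 2 + k * U 4 + U 5)
    (b4 : W 4 = U 0 + U 2 + k * U 3 + c * U 5)
    (b5 : W 5 = k * U 0 + U 1 + U 3 + c * U 4)
    (r1 : c * W 0 + W 3 - (1 + 2 * c + c ^ 2) * U 1 - (c + k + 2) * U 4 = 0)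
    (r2 : -(k * W 1) - W 4 + (1 + 2 * k + k ^ 2) * U 2 + (c + k + 2) * U 5 = 0)
    (r3 : c * W 2 + W 5 - (c + k + 2) * U 0 - (1 + 2 * c + c ^ 2) * U 3 = 0)
    (e1 : W 1 + W 3 + W 5 - (c + k + 2) * (U 0 + U 2 + U 4) = 0)
    (f0 : (k ^ 2 + 2 * k + 1) * U 0 + (2 + c + k) * U 1 + (c ^ 2 + 2 * c + 1) * U 2
      - c * W 3 - W 4 - k * W 5 = 0)
    (f1 : c * W 0 - (c ^ 2 + 2 * c + 1) * U 1 - (c + k + 2) * U 2 - (k ^ 2 + 2 * k + 1) * U 3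
      + k * W 4 + W 5 = 0)
    (f2 : - W 0 - k * W 1 + (k ^ 2 + 2 * k + 1) * U 2 + (c + k + 2) * U 3 + (c ^ 2 + 2 * c + 1) * U 4
      - c * W 5 = 0) :
    (∀ i, W i = W 0) ∧ (∀ i, U i = U 0) ∧ W 0 = (c + k + 2) * U 0 := by
  have m : ∀ x : F, 2 * x = 0 → x = 0 := fun x hx => (mul_eq_zero.1 hx).resolve_left h2
  have hc0 : c ≠ 0 := left_ne_zero_of_mul_eq_one hck
  have R1 : c * (U 2 - U 1) + (U 5 - U 4) = 0 := by
    apply m; rw [b0, b3] at r1; grind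
  have R2 : U 3 - U 2 + c * (U 0 - U 5) = 0 := by
    apply m; rw [b1, b4] at r2; grind
  have R3 : c * (U 4 - U 3) + (U 1 - U 0) = 0 := by
    apply m; rw [b2, b5] at r3; grind
  have E : U 0 + U 2 + U 4 = U 1 + U 3 + U 5 := by
    rw [← sub_eq_zero]; apply m; rw [b1, b3, b5] at e1; grind
  have d0 : (U 3 - U 0) + c * (U 4 - U 1) + c ^ 2 * (U 5 - U 2) = 0 := by
    apply m; rw [b3, b4, b5] at f0
    linear_combination -c * f0 - (2*(U 3 - U 0) + 2*c*U 4) * hck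
  have d1 : - (U 3 - U 0) + c ^ 2 * (U 4 - U 1) + c * (U 5 - U 2) = 0 := by
    apply m; rw [b0, b4, b5] at f1
    linear_combination c * f1 - (2*U 0 - 2*U 3 + 2*c*U 5) * hck
  have d2 : - c * (U 3 - U 0) - c ^ 2 * (U 4 - U 1) + (U 5 - U 2) = 0 := by
    apply m; rw [b0, b1, b5] at f2
    linear_combination -c * f2 - (2*c*U 0 - 2*U 2 + 2*U 5) * hck
  have g1 : U 5 - U 2 = U 3 - U 0 := by
    apply mul_left_cancel₀ hc; linear_combination d1 + d2
  have g2 : U 4 - U 1 = - (U 3 - U 0) := by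
    have : (c + 1) * (c * ((U 4 - U 1) + (U 3 - U 0))) = 0 := by
      linear_combination d0 + d1 - (c ^ 2 + c) * g1
    have := (mul_eq_zero.1 ((mul_eq_zero.1 this).resolve_left hc)).resolve_left hc0
    linear_combination this
  have g3 : U 3 - U 0 = 0 := by
    have h3 : 3 * (U 3 - U 0) = 0 := by linear_combination - g1 + g2 - E
    have h4 : (c + 1) * ((c + 1) * (U 3 - U 0)) = 0 := by
      linear_combination c * h3 + d0 - c * g2 - c ^ 2 * g1
    exact (mul_eq_zero.1 ((mul_eq_zero.1 h4).resolve_left hc)).resolve_left hc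
  rw [g3] at g1 g2
  have k1 : U 2 - U 1 = 0 := by
    refine (mul_eq_zero.1 (?_ : (c + 1) * (U 2 - U 1) = 0)).resolve_left hc
    linear_combination R1 - g1 + g2
  have k2 : U 0 - U 2 = 0 := by
    refine (mul_eq_zero.1 (?_ : (c + 1) * (U 0 - U 2) = 0)).resolve_left hc
    linear_combination R2 - g3 + c * g1
  have u1 : U 1 = U 0 := by linear_combination -k1 - k2
  have u2 : U 2 = U 0 := by linear_combination - k2
  have u3 : U 3 = U 0 := by linear_combination g3
  have u4 : U 4 = U 0 := by linear_combination g2 + u1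
  have u5 : U 5 = U 0 := by linear_combination g1 + u2
  refine ⟨fun i => ?_, fun i => ?_, ?_⟩
  · rw [b0, u1, u2, u4, u5]
    fin_cases i <;> simp [*] <;> ring
  · fin_cases i <;> simp [*]
  · rw [b0, u1, u2, u4, u5]; ring

set_option maxHeartbeats 4000000 in
theorem lie_solve {F : Type} [Field F] (h2 : (2 : F) ≠ 0) (c k : F) (hck : c * k = 1) (hc : c + 1 ≠ 0)
    (U V W : Fin 6 → F)
    (h : ∀ v : Fin 6 → F × F, ∑ i : Fin 6, (-1) ^ (i : ℕ) * HM (DhM c k) (Function.update v i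
      (V i * (v i).1 + U i * (v i).2, - W i * (v i).1 - V i * (v i).2)) = 0) :
    V 0 = 0 ∧ (∀ i, W i = W 0) ∧ (∀ i, U i = U 0) ∧ W 0 = (c + k + 2) * U 0 := by
  have hc0 : c ≠ 0 := left_ne_zero_of_mul_eq_one hck
  simp only [HM_DhM c k hck, Fin.sum_univ_six] at h
  have a0 := h ![(0,1),(0,1),(0,1),(0,1),(0,1),(0,1)]
  have a01 := h ![(1,0),(1,0),(0,1),(0,1),(0,1),(0,1)]
  have a02 := h ![(1,0),(0,1),(1,0),(0,1),(0,1),(0,1)]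
  have a12 := h ![(0,1),(1,0),(1,0),(0,1),(0,1),(0,1)]
  have b0 := h ![(1,0),(0,1),(0,1),(0,1),(0,1),(0,1)]
  have b1 := h ![(0,1),(1,0),(0,1),(0,1),(0,1),(0,1)]
  have b2 := h ![(0,1),(0,1),(1,0),(0,1),(0,1),(0,1)]
  have b3 := h ![(0,1),(0,1),(0,1),(1,0),(0,1),(0,1)]
  have b4 := h ![(0,1),(0,1),(0,1),(0,1),(1,0),(0,1)]
  have b5 := h ![(0,1),(0,1),(0,1),(0,1),(0,1),(1,0)]
  have r1 := h ![(1,0),(0,1),(1,0),(1,0),(0,1),(0,1)]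
  have r2 := h ![(0,1),(1,0),(0,1),(1,0),(1,0),(0,1)]
  have r3 := h ![(0,1),(0,1),(1,0),(0,1),(1,0),(1,0)]
  have e1 := h ![(0,1),(1,0),(0,1),(1,0),(0,1),(1,0)]
  have f0 := h ![(0,1),(0,1),(0,1),(1,0),(1,0),(1,0)]
  have f1 := h ![(1,0),(0,1),(0,1),(0,1),(1,0),(1,0)]
  have f2 := h ![(1,0),(1,0),(0,1),(0,1),(0,1),(1,0)]
  clear h
  simp [Function.update, Hp] at a0 a01 a02 a12 b0 b1 b2 b3 b4 b5 r1 r2 r3 e1 f0 f1 f2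
  have m : ∀ x : F, 2 * x = 0 → x = 0 := fun x hx => (mul_eq_zero.1 hx).resolve_left h2
  have hV : V 0 = 0 := by
    apply m; apply m
    linear_combination - (a0 + k * a01) + (a02 - a0) + (a0 + c * a12)
      + (-V 0 + V 1 + V 2 - V 3 + V 4 - V 5) * hck
      - (V 0 + V 1 - V 2 - V 3 + V 4 - V 5) * hck
  exact ⟨hV, lie_solve_aux h2 c k hck hc U W (by linear_combination -b0) (by linear_combination b1)
    (by linear_combination -b2) (by linear_combination b3) (by linear_combination -b4) (by linear_combination b5)
    (by linear_combination r1) (by linear_combination r2) (by linear_combination r3)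
    (by linear_combination e1) (by linear_combination f0) (by linear_combination f1) (by linear_combination f2)⟩

end lie
section fin

set_option linter.unusedSimpArgs false

set_option maxHeartbeats 4000000 in
theorem final_eqs {F : Type} [Field F] (c k t u W z : F) (hck : c * k = 1)
    (ga gb gc gd : Fin 6 → F)
    (hW : W ^ 2 = - (c + k + 2))
    (hb : ∀ i, gb i * W = - ga i) (hd : ∀ i, gd i * W = gc i)
    (h : ∀ v : Fin 6 → F × F,
      HM (D4M t u) (fun i => (ga i * (v i).1 + gb i * (v i).2, gc i * (v i).1 + gd i * (v i).2)) =
      z * HM (DhM c k) v) :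
    z * (-8 * (c + k + 2)^2 * (c+k-1)) = ((2*gc 0) * (2*gc 1) * (2*gc 2) * (2*gc 3) * (2*gc 4) * (2*gc 5)) ∧
    z * (-8 * (c + k + 2)^2 * (c+1)) = -u*((2*ga 0) * (2*ga 1) * (2*gc 2) * (2*gc 3) * (2*gc 4) * (2*gc 5)) ∧
    z * (-8 * (c + k + 2)^2 * (c+1)) = -u*((2*gc 0) * (2*gc 1) * (2*ga 2) * (2*ga 3) * (2*gc 4) * (2*gc 5)) ∧
    z * (-8 * (c + k + 2)^2 * (c+1)) = -u*((2*gc 0) * (2*gc 1) * (2*gc 2) * (2*gc 3) * (2*ga 4) * (2*ga 5)) ∧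
    z * (-8 * (c + k + 2)^2 * (k+1)) = -t*((2*gc 0) * (2*ga 1) * (2*ga 2) * (2*gc 3) * (2*gc 4) * (2*gc 5)) ∧
    z * (-8 * (c + k + 2)^2 * (k+1)) = -t*((2*gc 0) * (2*gc 1) * (2*gc 2) * (2*ga 3) * (2*ga 4) * (2*gc 5)) ∧
    z * (-8 * (c + k + 2)^2 * (k+1)) = -t*((2*ga 0) * (2*gc 1) * (2*gc 2) * (2*gc 3) * (2*gc 4) * (2*ga 5)) ∧
    z * (-8 * (c + k + 2)^2 * 1) = -((2*ga 0) * (2*gc 1) * (2*gc 2) * (2*ga 3) * (2*gc 4) * (2*gc 5)) ∧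
    z * (-8 * (c + k + 2)^2 * 1) = -((2*gc 0) * (2*ga 1) * (2*gc 2) * (2*gc 3) * (2*ga 4) * (2*gc 5)) ∧
    z * (-8 * (c + k + 2)^2 * 1) = -((2*gc 0) * (2*gc 1) * (2*ga 2) * (2*gc 3) * (2*gc 4) * (2*ga 5)) ∧
    z * (-8 * (c + k + 2)^2 * (c+1)) = (1-t)*(u^2-1)*((2*ga 0) * (2*ga 1) * (2*ga 2) * (2*ga 3) * (2*gc 4) * (2*gc 5)) ∧
    z * (-8 * (c + k + 2)^2 * (k+1)) = (1-u)*(t^2-1)*((2*gc 0) * (2*ga 1) * (2*ga 2) * (2*ga 3) * (2*ga 4) * (2*gc 5)) := by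
  have W2 : W ^ 2 = - (c + k + 2) := hW
  have W4 : W ^ 4 = (c + k + 2) ^ 2 := by linear_combination (W ^ 2 - (c + k + 2)) * hW
  have W6 : W ^ 6 = - (c + k + 2) ^ 3 := by
    linear_combination (W ^ 4) * hW - (c + k + 2) * W4
  have p1 : ∀ i, ga i + gb i * W = 0 := fun i => by linear_combination hb i
  have p2 : ∀ i, ga i + gb i * -W = 2 * ga i := fun i => by linear_combination - hb i
  have p3 : ∀ i, gc i + gd i * W = 2 * gc i := fun i => by linear_combination hd i
  have p4 : ∀ i, gc i + gd i * -W = 0 := fun i => by linear_combination - hd i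
  have key : ∀ x0 x1 x2 x3 x4 x5 : F,
      Gp t u (ga 0 + gb 0 * x0) (ga 1 + gb 1 * x1) (ga 2 + gb 2 * x2) (ga 3 + gb 3 * x3)
        (ga 4 + gb 4 * x4) (ga 5 + gb 5 * x5) (gc 0 + gd 0 * x0) (gc 1 + gd 1 * x1) (gc 2 + gd 2 * x2)
        (gc 3 + gd 3 * x3) (gc 4 + gd 4 * x4) (gc 5 + gd 5 * x5) =
      z * Hp c k 1 1 1 1 1 1 x0 x1 x2 x3 x4 x5 := by
    intro x0 x1 x2 x3 x4 x5
    have := h ![(1, x0), (1, x1), (1, x2), (1, x3), (1, x4), (1, x5)]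
    rw [HM_D4M, HM_DhM c k hck] at this
    simpa using this
  have E : z * (-8 * (c + k + 2)^2 * (c+k-1)) = ((2*gc 0) * (2*gc 1) * (2*gc 2) * (2*gc 3) * (2*gc 4) * (2*gc 5)) := by
    have hH : Hp c k 1 1 1 1 1 1 W W W W W W = -8 * (c + k + 2)^2 * (c+k-1) := by
      unfold Hp
      linear_combination ((-6) + (3) * k^2 + (3) * c^2) * W2 + ((6) + (-3) * k^1 + (-3) * c^1) * W4 + ((1)) * W6 + ((24) + (9) * k^1 + (9) * c^1) * hck
    have hG : Gp t u 0 0 0 0 0 0 (2*gc 0) (2*gc 1) (2*gc 2) (2*gc 3) (2*gc 4) (2*gc 5) = ((2*gc 0) * (2*gc 1) * (2*gc 2) * (2*gc 3) * (2*gc 4) * (2*gc 5)) := by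
      unfold Gp; ring
    have kk := key W W W W W W
    simp only [p1, p2, p3, p4] at kk
    rw [hH, hG] at kk
    exact kk.symm
  have E01 : z * (-8 * (c + k + 2)^2 * (c+1)) = -u*((2*ga 0) * (2*ga 1) * (2*gc 2) * (2*gc 3) * (2*gc 4) * (2*gc 5)) := by
    have hH : Hp c k 1 1 1 1 1 1 (-W) (-W) W W W W = -8 * (c + k + 2)^2 * (c+1) := by
      unfold Hp
      linear_combination ((6) + (-1) * k^2 + (8) * c^1 + (3) * c^2) * W2 + ((-2) + (1) * k^1 + (-3) * c^1) * W4 + ((1)) * W6 + ((16) + (5) * k^1 + (5) * c^1) * hck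
    have hG : Gp t u (2*ga 0) (2*ga 1) 0 0 0 0 0 0 (2*gc 2) (2*gc 3) (2*gc 4) (2*gc 5) = -u*((2*ga 0) * (2*ga 1) * (2*gc 2) * (2*gc 3) * (2*gc 4) * (2*gc 5)) := by
      unfold Gp; ring
    have kk := key (-W) (-W) W W W W
    simp only [p1, p2, p3, p4] at kk
    rw [hH, hG] at kk
    exact kk.symm
  have E23 : z * (-8 * (c + k + 2)^2 * (c+1)) = -u*((2*gc 0) * (2*gc 1) * (2*ga 2) * (2*ga 3) * (2*gc 4) * (2*gc 5)) := by
    have hH : Hp c k 1 1 1 1 1 1 W W (-W) (-W) W W = -8 * (c + k + 2)^2 * (c+1) := by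
      unfold Hp
      linear_combination ((6) + (-1) * k^2 + (8) * c^1 + (3) * c^2) * W2 + ((-2) + (1) * k^1 + (-3) * c^1) * W4 + ((1)) * W6 + ((16) + (5) * k^1 + (5) * c^1) * hck
    have hG : Gp t u 0 0 (2*ga 2) (2*ga 3) 0 0 (2*gc 0) (2*gc 1) 0 0 (2*gc 4) (2*gc 5) = -u*((2*gc 0) * (2*gc 1) * (2*ga 2) * (2*ga 3) * (2*gc 4) * (2*gc 5)) := by
      unfold Gp; ring
    have kk := key W W (-W) (-W) W W
    simp only [p1, p2, p3, p4] at kk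
    rw [hH, hG] at kk
    exact kk.symm
  have E45 : z * (-8 * (c + k + 2)^2 * (c+1)) = -u*((2*gc 0) * (2*gc 1) * (2*gc 2) * (2*gc 3) * (2*ga 4) * (2*ga 5)) := by
    have hH : Hp c k 1 1 1 1 1 1 W W W W (-W) (-W) = -8 * (c + k + 2)^2 * (c+1) := by
      unfold Hp
      linear_combination ((6) + (-1) * k^2 + (8) * c^1 + (3) * c^2) * W2 + ((-2) + (1) * k^1 + (-3) * c^1) * W4 + ((1)) * W6 + ((16) + (5) * k^1 + (5) * c^1) * hck
    have hG : Gp t u 0 0 0 0 (2*ga 4) (2*ga 5) (2*gc 0) (2*gc 1) (2*gc 2) (2*gc 3) 0 0 = -u*((2*gc 0) * (2*gc 1) * (2*gc 2) * (2*gc 3) * (2*ga 4) * (2*ga 5)) := by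
      unfold Gp; ring
    have kk := key W W W W (-W) (-W)
    simp only [p1, p2, p3, p4] at kk
    rw [hH, hG] at kk
    exact kk.symm
  have E12 : z * (-8 * (c + k + 2)^2 * (k+1)) = -t*((2*gc 0) * (2*ga 1) * (2*ga 2) * (2*gc 3) * (2*gc 4) * (2*gc 5)) := by
    have hH : Hp c k 1 1 1 1 1 1 W (-W) (-W) W W W = -8 * (c + k + 2)^2 * (k+1) := by
      unfold Hp
      linear_combination ((6) + (8) * k^1 + (3) * k^2 + (-1) * c^2) * W2 + ((-2) + (-3) * k^1 + (1) * c^1) * W4 + ((1)) * W6 + ((16) + (5) * k^1 + (5) * c^1) * hck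
    have hG : Gp t u 0 (2*ga 1) (2*ga 2) 0 0 0 (2*gc 0) 0 0 (2*gc 3) (2*gc 4) (2*gc 5) = -t*((2*gc 0) * (2*ga 1) * (2*ga 2) * (2*gc 3) * (2*gc 4) * (2*gc 5)) := by
      unfold Gp; ring
    have kk := key W (-W) (-W) W W W
    simp only [p1, p2, p3, p4] at kk
    rw [hH, hG] at kk
    exact kk.symm
  have E34 : z * (-8 * (c + k + 2)^2 * (k+1)) = -t*((2*gc 0) * (2*gc 1) * (2*gc 2) * (2*ga 3) * (2*ga 4) * (2*gc 5)) := by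
    have hH : Hp c k 1 1 1 1 1 1 W W W (-W) (-W) W = -8 * (c + k + 2)^2 * (k+1) := by
      unfold Hp
      linear_combination ((6) + (8) * k^1 + (3) * k^2 + (-1) * c^2) * W2 + ((-2) + (-3) * k^1 + (1) * c^1) * W4 + ((1)) * W6 + ((16) + (5) * k^1 + (5) * c^1) * hck
    have hG : Gp t u 0 0 0 (2*ga 3) (2*ga 4) 0 (2*gc 0) (2*gc 1) (2*gc 2) 0 0 (2*gc 5) = -t*((2*gc 0) * (2*gc 1) * (2*gc 2) * (2*ga 3) * (2*ga 4) * (2*gc 5)) := by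
      unfold Gp; ring
    have kk := key W W W (-W) (-W) W
    simp only [p1, p2, p3, p4] at kk
    rw [hH, hG] at kk
    exact kk.symm
  have E05 : z * (-8 * (c + k + 2)^2 * (k+1)) = -t*((2*ga 0) * (2*gc 1) * (2*gc 2) * (2*gc 3) * (2*gc 4) * (2*ga 5)) := by
    have hH : Hp c k 1 1 1 1 1 1 (-W) W W W W (-W) = -8 * (c + k + 2)^2 * (k+1) := by
      unfold Hp
      linear_combination ((6) + (8) * k^1 + (3) * k^2 + (-1) * c^2) * W2 + ((-2) + (-3) * k^1 + (1) * c^1) * W4 + ((1)) * W6 + ((16) + (5) * k^1 + (5) * c^1) * hck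
    have hG : Gp t u (2*ga 0) 0 0 0 0 (2*ga 5) 0 (2*gc 1) (2*gc 2) (2*gc 3) (2*gc 4) 0 = -t*((2*ga 0) * (2*gc 1) * (2*gc 2) * (2*gc 3) * (2*gc 4) * (2*ga 5)) := by
      unfold Gp; ring
    have kk := key (-W) W W W W (-W)
    simp only [p1, p2, p3, p4] at kk
    rw [hH, hG] at kk
    exact kk.symm
  have E03 : z * (-8 * (c + k + 2)^2 * 1) = -((2*ga 0) * (2*gc 1) * (2*gc 2) * (2*ga 3) * (2*gc 4) * (2*gc 5)) := by
    have hH : Hp c k 1 1 1 1 1 1 (-W) W W (-W) W W = -8 * (c + k + 2)^2 * 1 := by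
      unfold Hp
      linear_combination ((2) + (-1) * k^2 + (-1) * c^2) * W2 + ((-2) + (1) * k^1 + (1) * c^1) * W4 + ((1)) * W6 + ((8) + (1) * k^1 + (1) * c^1) * hck
    have hG : Gp t u (2*ga 0) 0 0 (2*ga 3) 0 0 0 (2*gc 1) (2*gc 2) 0 (2*gc 4) (2*gc 5) = -((2*ga 0) * (2*gc 1) * (2*gc 2) * (2*ga 3) * (2*gc 4) * (2*gc 5)) := by
      unfold Gp; ring
    have kk := key (-W) W W (-W) W W
    simp only [p1, p2, p3, p4] at kk
    rw [hH, hG] at kk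
    exact kk.symm
  have E14 : z * (-8 * (c + k + 2)^2 * 1) = -((2*gc 0) * (2*ga 1) * (2*gc 2) * (2*gc 3) * (2*ga 4) * (2*gc 5)) := by
    have hH : Hp c k 1 1 1 1 1 1 W (-W) W W (-W) W = -8 * (c + k + 2)^2 * 1 := by
      unfold Hp
      linear_combination ((2) + (-1) * k^2 + (-1) * c^2) * W2 + ((-2) + (1) * k^1 + (1) * c^1) * W4 + ((1)) * W6 + ((8) + (1) * k^1 + (1) * c^1) * hck
    have hG : Gp t u 0 (2*ga 1) 0 0 (2*ga 4) 0 (2*gc 0) 0 (2*gc 2) (2*gc 3) 0 (2*gc 5) = -((2*gc 0) * (2*ga 1) * (2*gc 2) * (2*gc 3) * (2*ga 4) * (2*gc 5)) := by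
      unfold Gp; ring
    have kk := key W (-W) W W (-W) W
    simp only [p1, p2, p3, p4] at kk
    rw [hH, hG] at kk
    exact kk.symm
  have E25 : z * (-8 * (c + k + 2)^2 * 1) = -((2*gc 0) * (2*gc 1) * (2*ga 2) * (2*gc 3) * (2*gc 4) * (2*ga 5)) := by
    have hH : Hp c k 1 1 1 1 1 1 W W (-W) W W (-W) = -8 * (c + k + 2)^2 * 1 := by
      unfold Hp
      linear_combination ((2) + (-1) * k^2 + (-1) * c^2) * W2 + ((-2) + (1) * k^1 + (1) * c^1) * W4 + ((1)) * W6 + ((8) + (1) * k^1 + (1) * c^1) * hck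
    have hG : Gp t u 0 0 (2*ga 2) 0 0 (2*ga 5) (2*gc 0) (2*gc 1) 0 (2*gc 3) (2*gc 4) 0 = -((2*gc 0) * (2*gc 1) * (2*ga 2) * (2*gc 3) * (2*gc 4) * (2*ga 5)) := by
      unfold Gp; ring
    have kk := key W W (-W) W W (-W)
    simp only [p1, p2, p3, p4] at kk
    rw [hH, hG] at kk
    exact kk.symm
  have E0123 : z * (-8 * (c + k + 2)^2 * (c+1)) = (1-t)*(u^2-1)*((2*ga 0) * (2*ga 1) * (2*ga 2) * (2*ga 3) * (2*gc 4) * (2*gc 5)) := by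
    have hH : Hp c k 1 1 1 1 1 1 (-W) (-W) (-W) (-W) W W = -8 * (c + k + 2)^2 * (c+1) := by
      unfold Hp
      linear_combination ((6) + (-1) * k^2 + (8) * c^1 + (3) * c^2) * W2 + ((-2) + (1) * k^1 + (-3) * c^1) * W4 + ((1)) * W6 + ((16) + (5) * k^1 + (5) * c^1) * hck
    have hG : Gp t u (2*ga 0) (2*ga 1) (2*ga 2) (2*ga 3) 0 0 0 0 0 0 (2*gc 4) (2*gc 5) = (1-t)*(u^2-1)*((2*ga 0) * (2*ga 1) * (2*ga 2) * (2*ga 3) * (2*gc 4) * (2*gc 5)) := by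
      unfold Gp; ring
    have kk := key (-W) (-W) (-W) (-W) W W
    simp only [p1, p2, p3, p4] at kk
    rw [hH, hG] at kk
    exact kk.symm
  have E1234 : z * (-8 * (c + k + 2)^2 * (k+1)) = (1-u)*(t^2-1)*((2*gc 0) * (2*ga 1) * (2*ga 2) * (2*ga 3) * (2*ga 4) * (2*gc 5)) := by
    have hH : Hp c k 1 1 1 1 1 1 W (-W) (-W) (-W) (-W) W = -8 * (c + k + 2)^2 * (k+1) := by
      unfold Hp
      linear_combination ((6) + (8) * k^1 + (3) * k^2 + (-1) * c^2) * W2 + ((-2) + (-3) * k^1 + (1) * c^1) * W4 + ((1)) * W6 + ((16) + (5) * k^1 + (5) * c^1) * hck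
    have hG : Gp t u 0 (2*ga 1) (2*ga 2) (2*ga 3) (2*ga 4) 0 (2*gc 0) 0 0 0 0 (2*gc 5) = (1-u)*(t^2-1)*((2*gc 0) * (2*ga 1) * (2*ga 2) * (2*ga 3) * (2*ga 4) * (2*gc 5)) := by
      unfold Gp; ring
    have kk := key W (-W) (-W) (-W) (-W) W
    simp only [p1, p2, p3, p4] at kk
    rw [hH, hG] at kk
    exact kk.symm
  exact ⟨E, E01, E23, E45, E12, E34, E05, E03, E14, E25, E0123, E1234⟩

theorem final_alg {F : Type} [Field F] (h2 : (2 : F) ≠ 0) (c k t u W z : F) (hck : c * k = 1)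
    (hc : c + 1 ≠ 0) (ht : t ^ 2 + t = 1) (hu : u ^ 2 + u = 1) (hz : z ≠ 0)
    (ga gb gc gd : Fin 6 → F)
    (hW : W ^ 2 = - (c + k + 2))
    (hb : ∀ i, gb i * W = - ga i) (hd : ∀ i, gd i * W = gc i)
    (h : ∀ v : Fin 6 → F × F,
      HM (D4M t u) (fun i => (ga i * (v i).1 + gb i * (v i).2, gc i * (v i).1 + gd i * (v i).2)) =
      z * HM (DhM c k) v) : c = 1 ∧ (10 : F) = 0 := by
  obtain ⟨E, E01, E23, E45, E12, E34, E05, E03, E14, E25, E0123, E1234⟩ :=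
    final_eqs c k t u W z hck ga gb gc gd hW hb hd h
  clear h hb hd hW
  have hk : k + 1 ≠ 0 := fun hk => hc (by linear_combination c * hk - hck)
  have he : c + k + 2 ≠ 0 := fun he => by
    have : (c + 1) * (k + 1) = 0 := by linear_combination he + hck
    exact (mul_ne_zero hc hk) this
  have hc0 : c ≠ 0 := left_ne_zero_of_mul_eq_one hck
  have hK : z * -8 * (c + k + 2) ^ 2 ≠ 0 := by
    have : z * -8 * (c + k + 2) ^ 2 = z * - (2 ^ 3 * (c + k + 2) ^ 2) := by ring
    rw [this]
    exact mul_ne_zero hz (neg_ne_zero.2 (mul_ne_zero (pow_ne_zero _ h2) (pow_ne_zero _ he)))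
  have ht0 : t ≠ 0 := by rintro rfl; simp at ht
  have hu0 : u ≠ 0 := by rintro rfl; simp at hu
  simp only [mul_one, ← mul_assoc z] at E E01 E23 E45 E12 E34 E05 E03 E14 E25 E0123 E1234
  generalize z * -8 * (c + k + 2) ^ 2 = K at *
  generalize (2 * ga 0) = a0 at *
  generalize (2 * ga 1) = a1 at *
  generalize (2 * ga 2) = a2 at *
  generalize (2 * ga 3) = a3 at *
  generalize (2 * ga 4) = a4 at *
  generalize (2 * ga 5) = a5 at *
  generalize (2 * gc 0) = b0 at *
  generalize (2 * gc 1) = b1 at *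
  generalize (2 * gc 2) = b2 at *
  generalize (2 * gc 3) = b3 at *
  generalize (2 * gc 4) = b4 at *
  generalize (2 * gc 5) = b5 at *
  have cr : ∀ A B P Q M : F, A = P * M → B = Q * M → A * Q = B * P := by
    rintro A B P Q M rfl rfl; ring
  have cancel : ∀ x y w : F, w ≠ 0 → w * x = w * y → x = y := fun x y w hw => mul_left_cancel₀ hw
  have F1 : -(c + 1) * t ^ 2 = u * (c + k - 1) := by
    have e1 : (K * (c + 1)) * (K * (c + 1)) = u ^ 2 * (a0 * a1 * a2 * a3 * b0 * b1 * b2 * b3 * (b4 * b5) ^ 2) := by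
      nth_rewrite 1 [E01]; rw [E23]; ring
    have e2 : (K * (c + 1)) * (K * (c + k - 1)) = ((1 - t) * (u ^ 2 - 1)) * (a0 * a1 * a2 * a3 * b0 * b1 * b2 * b3 * (b4 * b5) ^ 2) := by
      rw [E0123, E]; ring
    have := cr _ _ _ _ _ e1 e2
    have h1 : 1 - t = t ^ 2 := by linear_combination -ht
    have h2 : u ^ 2 - 1 = - u := by linear_combination hu
    rw [h1, h2] at this
    refine cancel _ _ (K * K * (c + 1) * u) (mul_ne_zero (mul_ne_zero (mul_ne_zero hK hK) hc) hu0) ?_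
    linear_combination this
  have F2 : -(k + 1) * u ^ 2 = t * (c + k - 1) := by
    have e1 : (K * (k + 1)) * (K * (k + 1)) = t ^ 2 * (a1 * a2 * a3 * a4 * b1 * b2 * b3 * b4 * (b0 * b5) ^ 2) := by
      nth_rewrite 1 [E12]; rw [E34]; ring
    have e2 : (K * (k + 1)) * (K * (c + k - 1)) = ((1 - u) * (t ^ 2 - 1)) * (a1 * a2 * a3 * a4 * b1 * b2 * b3 * b4 * (b0 * b5) ^ 2) := by
      rw [E1234, E]; ring
    have := cr _ _ _ _ _ e1 e2
    have h1 : 1 - u = u ^ 2 := by linear_combination -hu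
    have h2 : t ^ 2 - 1 = - t := by linear_combination ht
    rw [h1, h2] at this
    refine cancel _ _ (K * K * (k + 1) * t) (mul_ne_zero (mul_ne_zero (mul_ne_zero hK hK) hk) ht0) ?_
    linear_combination this
  have e0 : K * K * K = - (a0 * a1 * a2 * a3 * a4 * a5 * (b0 * b1 * b2 * b3 * b4 * b5) ^ 2) := by
    nth_rewrite 1 [E03]; nth_rewrite 1 [E14]; rw [E25]; ring
  have G1 : (c + 1) ^ 3 = u ^ 3 := by
    have e1 : (K * (c + 1)) * (K * (c + 1)) * (K * (c + 1)) =
        - u ^ 3 * (a0 * a1 * a2 * a3 * a4 * a5 * (b0 * b1 * b2 * b3 * b4 * b5) ^ 2) := by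
      nth_rewrite 1 [E01]; nth_rewrite 1 [E23]; rw [E45]; ring
    refine cancel _ _ (K * K * K) (mul_ne_zero (mul_ne_zero hK hK) hK) ?_
    linear_combination e1 - u ^ 3 * e0
  have G2 : (k + 1) ^ 3 = t ^ 3 := by
    have e1 : (K * (k + 1)) * (K * (k + 1)) * (K * (k + 1)) =
        - t ^ 3 * (a0 * a1 * a2 * a3 * a4 * a5 * (b0 * b1 * b2 * b3 * b4 * b5) ^ 2) := by
      nth_rewrite 1 [E12]; nth_rewrite 1 [E34]; rw [E05]; ring
    refine cancel _ _ (K * K * K) (mul_ne_zero (mul_ne_zero hK hK) hK) ?_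
    linear_combination e1 - t ^ 3 * e0
  clear E E01 E23 E45 E12 E34 E05 E03 E14 E25 E0123 E1234 e0
  have hck1 : c * (k + 1) = c + 1 := by linear_combination hck
  have i1 : c ^ 3 * t ^ 3 = u ^ 3 := by
    rw [← G1, ← G2, ← hck1]; ring
  have i2 : c * t ^ 3 = u ^ 3 := by
    refine cancel _ _ _ hc ?_
    linear_combination - c * t * F1 + c * u * F2 + u ^ 3 * hck1
  have i3 : c = 1 := by
    have : (c + 1) * (c - 1) = 0 := by
      refine cancel _ _ (c * t ^ 3) (mul_ne_zero hc0 (pow_ne_zero _ ht0)) ?_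
      linear_combination i1 - i2
    linear_combination (mul_eq_zero.1 this).resolve_left hc
  subst i3
  have k1 : k = 1 := by linear_combination hck
  subst k1
  refine ⟨rfl, ?_⟩
  have t9 : 2 * t = 9 := by linear_combination -G2 - (t - 1) * ht
  have u9 : 2 * u = 9 := by linear_combination -G1 - (u - 1) * hu
  have tu : u = t := by
    refine cancel _ _ _ h2 ?_
    rw [t9, u9]
  subst tu
  have : 2 * u = -1 := by
    refine cancel _ _ _ hu0 ?_
    linear_combination - F1
  linear_combination this - u9

end fin
section core

theorem core {F : Type} [Field F] [Fintype F] {q : ℕ} (hq : 1 < q) (hodd : Odd q)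
    (hF : Fintype.card F = q ^ 6) (σ : F →+* F) (hσ : ∀ x, σ x = x ^ q) (h2 : (2 : F) ≠ 0)
    (h : F) (hh : h ^ (q ^ 3 + 1) = -1) (hq2 : h ^ (q ^ 2) = h) (δ : F) (hδ : δ ^ 2 + δ = 1)
    (a b c d : F) (hΔ : a * d - b * c ≠ 0)
    (H : ∀ n : F, (∃ x : F, x ≠ 0 ∧ fpol q h x = n * x) ↔
      (∃ x : F, x ≠ 0 ∧ (a + b * n) * (x ^ q + x ^ (q ^ 3) + δ * x ^ (q ^ 5)) = (c + d * n) * x)) :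
    h ^ q = h ∧ (10 : F) = 0 := by
  have hs : ∀ (k : ℕ) (x : F), x ^ (q ^ k) = (σ ^ k) x := by
    intro k x
    induction k with
    | zero => simp
    | succ n ih => rw [pow_succ, pow_mul, ih, pow_succ', RingHom.mul_def]; simp [hσ]
  have hadd : ∀ (k : ℕ) (x y : F), (x + y) ^ (q ^ k) = x ^ (q ^ k) + y ^ (q ^ k) := by
    intro k x y; simp only [hs, map_add]
  have hneg : ∀ (k : ℕ) (x : F), (- x) ^ (q ^ k) = - x ^ (q ^ k) := by
    intro k x; simp only [hs, map_neg]
  have hz : ∀ (k : ℕ), (0 : F) ^ (q ^ k) = 0 := by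
    intro k; simp only [hs, map_zero]
  have hh0 : h ≠ 0 := by
    rintro rfl
    rw [zero_pow (by omega)] at hh
    simp at hh
  obtain ⟨cc, hcc⟩ : ∃ cc, cc = h ^ (q - 1) := ⟨_, rfl⟩
  have hch : cc * h = h ^ q := by
    rw [hcc, ← pow_succ]; congr 1; omega
  have hq21 : h ^ (q ^ 2 - 1) = 1 := by
    apply mul_right_cancel₀ hh0
    rw [← pow_succ, one_mul]
    have : 0 < q ^ 2 := by positivity
    rw [show q ^ 2 - 1 + 1 = q ^ 2 by omega, hq2]
  have hqq : (h ^ q) ^ q = h := by rw [← pow_mul, ← sq, hq2]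
  have hck : cc * cc ^ q = 1 := by
    apply mul_right_cancel₀ (mul_ne_zero hh0 (pow_ne_zero q hh0))
    calc cc * cc ^ q * (h * h ^ q) = (cc * h) * (cc * h) ^ q := by rw [mul_pow]; ring
      _ = 1 * (h * h ^ q) := by rw [hch, hqq]; ring
  have hcc2 : (cc ^ q) ^ q = cc := by
    rw [hcc, ← pow_mul, ← pow_mul, mul_comm, ← sq, pow_mul, hq2]
  have hh1 : h ^ q * h = -1 := by
    rw [← hh, pow_succ, pow_succ q 2, pow_mul, hq2]
  have hc1 : cc + 1 ≠ 0 := by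
    intro h0
    have e1 : h ^ q = - h := by rw [← hch]; linear_combination h * h0
    have e2 : h ^ 2 = 1 := by rw [e1] at hh1; linear_combination - hh1
    obtain ⟨m, hm⟩ := hodd
    have e3 : h ^ q = h := by rw [hm, pow_succ, pow_mul, e2]; simp
    have : 2 * h = 0 := by linear_combination e1 - e3
    exact (mul_ne_zero h2 hh0) this
  have hu : (δ ^ q) ^ 2 + δ ^ q = 1 := by
    rw [← hσ, ← map_pow, ← map_add, hδ, map_one]
  have hδ2 : (δ ^ q) ^ q = δ := by
    have : (δ ^ q - δ) * (δ ^ q + 1 + δ) = 0 := by linear_combination hu - hδ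
    rcases mul_eq_zero.1 this with h' | h'
    · have e : δ ^ q = δ := by linear_combination h'
      rw [e, e]
    · have e : δ ^ q = - 1 - δ := by linear_combination h'
      have e' : σ (δ ^ q) = -1 - σ δ := by rw [e]; simp
      rw [hσ, hσ] at e'
      linear_combination e' - e
  have per : ∀ x : F, (x ^ q) ^ q = x → x ^ (q ^ 2) = x ∧ x ^ (q ^ 3) = x ^ q ∧ x ^ (q ^ 4) = x ∧
      x ^ (q ^ 5) = x ^ q := by
    intro x hx
    have e2 : x ^ (q ^ 2) = x := by rw [sq, pow_mul, hx]
    have e3 : x ^ (q ^ 3) = x ^ q := by rw [pow_succ, pow_mul, e2]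
    have e4 : x ^ (q ^ 4) = x := by rw [pow_succ, pow_mul, e3, hx]
    exact ⟨e2, e3, e4, by rw [pow_succ, pow_mul, e4]⟩
  obtain ⟨c2, c3, c4, c5⟩ := per cc hcc2
  obtain ⟨t2, t3, t4, t5⟩ := per δ hδ2
  have hz1 : (0 : F) ^ q = 0 := by simpa using hz 1
  have hn1 : (-1 : F) ^ q = -1 := by simpa using hneg 1 1
  have hnk : ∀ k, (-1 : F) ^ (q ^ k) = -1 := fun k => by simpa using hneg k 1
  have D1 : Dick q ![0, cc, -1, 0, 1, 1] = DhM cc (cc ^ q) := by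
    ext i j
    fin_cases i <;> fin_cases j <;>
      simp [Dick, DhM, hz, hz1, hn1, hnk, c2, c3, c4, c5, -zero_pow_eq_zero, -pow_eq_zero_iff] <;> rfl
  have D2 : Dick q ![0, 1, 0, 1, 0, δ] = D4M δ (δ ^ q) := by
    ext i j
    fin_cases i <;> fin_cases j <;>
      simp [Dick, D4M, hz, hz1, hn1, hnk, t2, t3, t4, t5, -zero_pow_eq_zero, -pow_eq_zero_iff] <;> rfl
  have L1 : ∀ n : F, (∃ x : F, x ≠ 0 ∧ fpol q h x = n * x) ↔
      HM (DhM cc (cc ^ q)) (fun i => (1 ^ (q ^ (i : ℕ)), n ^ (q ^ (i : ℕ)))) = 0 := by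
    intro n
    rw [← D1, HM_eq_Dick σ hσ, ← Dick_det_iff hq hF hadd]
    refine exists_congr fun x => and_congr_right fun _ => ?_
    rw [Fin.sum_univ_six, fpol, hq21, ← hcc, ← sub_eq_zero]
    simp
    ring_nf
  have L2 : ∀ s X : F,
      (∃ x : F, x ≠ 0 ∧ s * (x ^ q + x ^ (q ^ 3) + δ * x ^ (q ^ 5)) = X * x) ↔
      HM (D4M δ (δ ^ q)) (fun i => (s ^ (q ^ (i : ℕ)), X ^ (q ^ (i : ℕ)))) = 0 := by
    intro s X
    rw [← D2, HM_eq_Dick σ hσ, ← Dick_det_iff hq hF hadd]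
    refine exists_congr fun x => and_congr_right fun _ => ?_
    rw [Fin.sum_univ_six, ← sub_eq_zero]
    simp
    ring_nf
  obtain ⟨z, hz0, hy⟩ := prop_of_zeros hq hF (DhM cc (cc ^ q)) (D4M δ (δ ^ q)) (fun _ => 1) (fun _ => 0)
    (fun _ => 0) (fun _ => 1) (fun i => a ^ (q ^ (i : ℕ))) (fun i => b ^ (q ^ (i : ℕ)))
    (fun i => c ^ (q ^ (i : ℕ))) (fun i => d ^ (q ^ (i : ℕ)))
    (by
      intro m
      have e1 := L1 m
      have e2 := L2 (a + b * m) (c + d * m)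
      rw [H m] at e1
      simp only [hadd, mul_pow, one_pow] at e1 e2
      simp only [zero_mul, add_zero, one_mul, zero_add]
      exact e1.symm.trans e2)
    (by
      intro m
      have := HM_eq_Dick σ hσ ![0, cc, -1, 0, 1, 1] 1 m
      rw [D1] at this
      simp only [zero_mul, add_zero, one_mul, zero_add]
      simp only [one_pow] at this
      rw [this]
      exact Dick_det_pow σ hσ hF _)
    (by
      intro m
      have := HM_eq_Dick σ hσ ![0, 1, 0, 1, 0, δ] (a + b * m) (c + d * m)
      rw [D2] at this
      simp only [hadd, mul_pow] at this
      rw [this]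
      exact Dick_det_pow σ hσ hF _)
  have hv := HM_hom (DhM cc (cc ^ q)) (D4M δ (δ ^ q)) (fun i => a ^ (q ^ (i : ℕ))) (fun i => b ^ (q ^ (i : ℕ)))
    (fun i => c ^ (q ^ (i : ℕ))) (fun i => d ^ (q ^ (i : ℕ))) z (by
      intro y
      have := hy y
      simp only [zero_mul, add_zero, one_mul, zero_add] at this
      exact this)
  have hD : ∀ i : ℕ, a ^ (q ^ i) * d ^ (q ^ i) - b ^ (q ^ i) * c ^ (q ^ i) ≠ 0 := by
    intro i
    have : a ^ (q ^ i) * d ^ (q ^ i) - b ^ (q ^ i) * c ^ (q ^ i) = (a * d - b * c) ^ (q ^ i) := by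
      simp only [hs, map_sub, map_mul]
    rw [this]
    exact pow_ne_zero _ hΔ
  obtain ⟨U, hU⟩ : ∃ U : Fin 6 → F, U = fun i : Fin 6 => 2 * b ^ (q ^ (i : ℕ)) * d ^ (q ^ (i : ℕ)) /
    (a ^ (q ^ (i : ℕ)) * d ^ (q ^ (i : ℕ)) - b ^ (q ^ (i : ℕ)) * c ^ (q ^ (i : ℕ))) := ⟨_, rfl⟩
  obtain ⟨V, hV⟩ : ∃ V : Fin 6 → F, V = fun i : Fin 6 =>
    (a ^ (q ^ (i : ℕ)) * d ^ (q ^ (i : ℕ)) + b ^ (q ^ (i : ℕ)) * c ^ (q ^ (i : ℕ))) /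
    (a ^ (q ^ (i : ℕ)) * d ^ (q ^ (i : ℕ)) - b ^ (q ^ (i : ℕ)) * c ^ (q ^ (i : ℕ))) := ⟨_, rfl⟩
  obtain ⟨W, hW⟩ : ∃ W : Fin 6 → F, W = fun i : Fin 6 => 2 * a ^ (q ^ (i : ℕ)) * c ^ (q ^ (i : ℕ)) /
    (a ^ (q ^ (i : ℕ)) * d ^ (q ^ (i : ℕ)) - b ^ (q ^ (i : ℕ)) * c ^ (q ^ (i : ℕ))) := ⟨_, rfl⟩
  have r1 : ∀ i : Fin 6, V i * a ^ (q ^ (i : ℕ)) - W i * b ^ (q ^ (i : ℕ)) = a ^ (q ^ (i : ℕ)) := by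
    intro i; rw [hV, hW]; simp only; rw [div_mul_eq_mul_div, div_mul_eq_mul_div, ← sub_div, div_eq_iff (hD i)]; ring
  have r2 : ∀ i : Fin 6, V i * c ^ (q ^ (i : ℕ)) - W i * d ^ (q ^ (i : ℕ)) = - c ^ (q ^ (i : ℕ)) := by
    intro i; rw [hV, hW]; simp only; rw [div_mul_eq_mul_div, div_mul_eq_mul_div, ← sub_div, div_eq_iff (hD i)]; ring
  have r3 : ∀ i : Fin 6, U i * a ^ (q ^ (i : ℕ)) - V i * b ^ (q ^ (i : ℕ)) = b ^ (q ^ (i : ℕ)) := by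
    intro i; rw [hV, hU]; simp only; rw [div_mul_eq_mul_div, div_mul_eq_mul_div, ← sub_div, div_eq_iff (hD i)]; ring
  have r4 : ∀ i : Fin 6, U i * c ^ (q ^ (i : ℕ)) - V i * d ^ (q ^ (i : ℕ)) = - d ^ (q ^ (i : ℕ)) := by
    intro i; rw [hV, hU]; simp only; rw [div_mul_eq_mul_div, div_mul_eq_mul_div, ← sub_div, div_eq_iff (hD i)]; ring
  obtain ⟨V0, Wc, Uc, hWU⟩ := lie_solve h2 cc (cc ^ q) hck hc1 U V W
    (HM_lie δ (δ ^ q) _ _ _ _ _ U V W z hz0 hv r1 r2 r3 r4)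
  have had : a * d + b * c = 0 := by
    have h0 := hD 0
    rw [hV] at V0
    simpa using (div_eq_zero_iff.1 V0).resolve_right h0
  have hVi : ∀ i, V i = 0 := by
    intro i
    rw [hV]
    have : a ^ (q ^ (i : ℕ)) * d ^ (q ^ (i : ℕ)) + b ^ (q ^ (i : ℕ)) * c ^ (q ^ (i : ℕ)) =
        (a * d + b * c) ^ (q ^ (i : ℕ)) := by simp only [hadd, mul_pow]
    simp only [this, had, hz, zero_div]
  have s1 := r1 0
  have s3 := r3 0
  simp only [hVi, Fin.val_zero, pow_zero, pow_one] at s1 s3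
  have ha : a ≠ 0 := by
    rintro rfl
    apply hΔ
    have : b = 0 := by linear_combination -s3
    rw [this]; ring
  have hUW : U 0 * W 0 = -1 := by
    apply mul_left_cancel₀ ha
    linear_combination W 0 * s3 - s1
  obtain ⟨f1, f2⟩ := final_alg h2 cc (cc ^ q) δ (δ ^ q) (W 0) z hck hc1 hδ hu hz0 _ _ _ _
    (by linear_combination W 0 * hWU + (cc + cc ^ q + 2) * hUW)
    (fun i => by have := r1 i; rw [hVi, Wc] at this; linear_combination - this)
    (fun i => by have := r2 i; rw [hVi, Wc] at this; linear_combination - this)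
    hv
  exact ⟨by rw [← hch, f1, one_mul], f2⟩

end core
section finish

theorem mem_linearSet_iff {F : Type} [Field F] (f : F → F) (v : F × F) (hv : v ≠ 0) :
    Projectivization.mk F v hv ∈ linearSet f ↔ ∃ x : F, x ≠ 0 ∧ v.1 * f x = v.2 * x := by
  unfold linearSet
  simp only [Set.mem_setOf_eq]
  constructor
  · rintro ⟨x, hx, h⟩
    rw [Projectivization.mk_eq_mk_iff'] at h
    obtain ⟨r, rfl⟩ := h
    exact ⟨x, hx, by simp; ring⟩
  · rintro ⟨x, hx, h⟩
    refine ⟨x, hx, ?_⟩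
    rw [Projectivization.mk_eq_mk_iff']
    refine ⟨v.1 / x, ?_⟩
    ext
    · simp [hx]
    · simp only [Prod.smul_snd, smul_eq_mul]
      rw [div_mul_eq_mul_div, h]
      field_simp

theorem forward {F : Type} [Field F] [Fintype F] {q : ℕ} (hq : 1 < q) (hodd : Odd q)
    (hF : Fintype.card F = q ^ 6) (σ : F →+* F) (hσ : ∀ x, σ x = x ^ q) (h2 : (2 : F) ≠ 0)
    (h : F) (hh : h ^ (q ^ 3 + 1) = -1) (hq2 : h ^ (q ^ 2) = h) (δ : F) (hδ : δ ^ 2 + δ = 1)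
    (H : IsPGammaLEquiv (linearSet (fpol q h))
          (linearSet (fun x : F => x ^ q + x ^ (q ^ 3) + δ * x ^ (q ^ 5)))) :
    h ^ q = h ∧ (10 : F) = 0 := by
  obtain ⟨ρ, g, gadd, gsmul, hg⟩ := H
  have g0 : g 0 = 0 := by simpa using gsmul 0 0
  have gne : ∀ v, v ≠ 0 → g v ≠ 0 := fun v hv h0 => hv (g.injective (h0.trans g0.symm))
  obtain ⟨a, ha⟩ : ∃ a, a = (g (1, 0)).1 := ⟨_, rfl⟩
  obtain ⟨c, hc⟩ : ∃ c, c = (g (1, 0)).2 := ⟨_, rfl⟩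
  obtain ⟨b, hb⟩ : ∃ b, b = (g (0, 1)).1 := ⟨_, rfl⟩
  obtain ⟨d, hd⟩ : ∃ d, d = (g (0, 1)).2 := ⟨_, rfl⟩
  have gform : ∀ x y : F, g (x, y) = (ρ x * a + ρ y * b, ρ x * c + ρ y * d) := by
    intro x y
    have : ((x, y) : F × F) = x • (1, 0) + y • (0, 1) := by simp
    rw [this, gadd, gsmul, gsmul, ha, hb, hc, hd]
    ext <;> simp
  have hΔ : a * d - b * c ≠ 0 := by
    intro h0
    have key : ∀ x y : F, ρ x * a + ρ y * b = 0 → ρ x * c + ρ y * d = 0 → x = 0 ∧ y = 0 := by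
      intro x y h1 h3
      have : g (x, y) = g 0 := by rw [gform, h1, h3, g0]; rfl
      have := g.injective this
      simpa using this
    have k1 := key (ρ.symm d) (ρ.symm (-c)) (by simp; linear_combination h0) (by simp; ring)
    have k2 := key (ρ.symm b) (ρ.symm (-a)) (by simp; ring) (by simp; linear_combination -h0)
    simp at k1 k2
    have := key 1 1 (by simp [k2]) (by simp [k1])
    simp at this
  have res := core hq hodd hF σ hσ h2 (ρ h) (by rw [← map_pow, hh]; simp) (by rw [← map_pow, hq2])
    δ hδ a b c d hΔ (by
      intro n
      obtain ⟨m, rfl⟩ := ρ.surjective n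
      have hv : ((1, m) : F × F) ≠ 0 := by simp
      have := hg (1, m) hv (gne _ hv)
      rw [mem_linearSet_iff, mem_linearSet_iff, gform] at this
      simp only [one_mul, map_one] at this
      rw [mul_comm b, mul_comm d, ← this]
      constructor
      · rintro ⟨x, hx, e⟩
        obtain ⟨y, rfl⟩ := ρ.surjective x
        refine ⟨y, by simpa using hx, ρ.injective ?_⟩
        simpa [fpol] using e
      · rintro ⟨x, hx, e⟩
        refine ⟨ρ x, by simpa using hx, ?_⟩
        have := congrArg ρ e
        simpa [fpol] using this)
  refine ⟨ρ.injective ?_, res.2⟩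
  rw [map_pow, res.1]

theorem backward {F : Type} [Field F] [Fintype F] {q : ℕ} (hq : 1 < q)
    (hF : Fintype.card F = q ^ 6) (σ : F →+* F) (hσ : ∀ x, σ x = x ^ q) (h5 : (5 : F) = 0)
    (h : F) (hh0 : h ≠ 0) (hq2 : h ^ (q ^ 2) = h) (hq1 : h ^ q = h) :
    IsPGammaLEquiv (linearSet (fpol q h))
          (linearSet (fun x : F => x ^ q + x ^ (q ^ 3) + 2 * x ^ (q ^ 5))) := by
  have hs : ∀ (k : ℕ) (x : F), x ^ (q ^ k) = (σ ^ k) x := by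
    intro k x
    induction k with
    | zero => simp
    | succ n ih => rw [pow_succ, pow_mul, ih, pow_succ', RingHom.mul_def]; simp [hσ]
  have e1 : h ^ (q - 1) = 1 := by
    apply mul_right_cancel₀ hh0
    rw [← pow_succ, one_mul, show q - 1 + 1 = q by omega, hq1]
  have e2 : h ^ (q ^ 2 - 1) = 1 := by
    apply mul_right_cancel₀ hh0
    rw [← pow_succ, one_mul]
    have : 0 < q ^ 2 := by positivity
    rw [show q ^ 2 - 1 + 1 = q ^ 2 by omega, hq2]
  have hf : ∀ x, fpol q h x = x ^ q - x ^ (q ^ 2) + x ^ (q ^ 4) + x ^ (q ^ 5) := by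
    intro x; simp only [fpol, e1, e2, one_mul]
  have hσ2 : ∀ (k : ℕ) (x : F), x ^ (q ^ k) = σ^[k] x := by
    intro k x
    induction k with
    | zero => simp
    | succ n ih => rw [pow_succ, pow_mul, ih, Function.iterate_succ_apply', hσ]
  have h6 : ∀ x : F, σ (σ (σ (σ (σ (σ x))))) = x := by
    intro x
    have := hσ2 6 x
    rw [← hF, FiniteField.pow_card] at this
    exact this.symm
  have hq' : ∀ x : F, x ^ q = σ x := fun x => (hσ x).symm
  have hfs : ∀ x, fpol q h x = σ x - σ (σ x) + σ (σ (σ (σ x))) + σ (σ (σ (σ (σ x)))) := by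
    intro x; rw [hf]; simp only [hσ2, hq']; rfl
  have hf4 : ∀ x : F, x ^ q + x ^ (q ^ 3) + 2 * x ^ (q ^ 5) =
      σ x + σ (σ (σ x)) + 2 * σ (σ (σ (σ (σ x)))) := by
    intro x; simp only [hσ2, hq']; rfl
  have key : ∀ x : F, (x - fpol q h x) ^ q + (x - fpol q h x) ^ (q ^ 3) + 2 * (x - fpol q h x) ^ (q ^ 5) =
      2 * (x + fpol q h x) := by
    intro x
    rw [hf4, hfs]
    simp only [map_sub, map_add, h6]
    linear_combination (-x - σ (σ (σ (σ x)))) * h5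
  have n4 : ∀ x : F, 4 * x = 0 → x = 0 := fun x hx => by linear_combination x * h5 - hx
  have hne : ∀ x : F, x - fpol q h x = 0 → x = 0 := by
    intro x hx
    have k := key x
    rw [hf4, hx] at k
    simp at k
    apply n4
    rcases k with k | k
    · linear_combination 2 * x * k
    · linear_combination 2 * k + 2 * hx
  have inj : Function.Injective (fun x : F => x - fpol q h x) := by
    intro x y hxy
    rw [← sub_eq_zero]
    apply hne
    simp only [hfs, map_sub] at hxy ⊢
    linear_combination hxy
  have surj := Finite.injective_iff_surjective.1 inj
  let g : (F × F) ≃ (F × F) :=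
    { toFun := fun v => (v.1 - v.2, 2 * (v.1 + v.2))
      invFun := fun v => (3 * v.1 + 9 * v.2, 9 * v.2 - 3 * v.1)
      left_inv := fun v => by
        ext
        · simp only; linear_combination (4 * v.1 + 3 * v.2) * h5
        · simp only; linear_combination (3 * v.1 + 4 * v.2) * h5
      right_inv := fun v => by
        ext
        · simp only; linear_combination (v.1) * h5
        · simp only; linear_combination (7 * v.2) * h5 }
  refine ⟨RingEquiv.refl F, g, ?_, ?_, ?_⟩
  · intro u v
    ext
    · simp [g]; ring
    · simp [g]; ring
  · intro c v
    ext
    · simp [g]; ring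
    · simp [g]; ring
  · intro v hv hgv
    rw [mem_linearSet_iff, mem_linearSet_iff]
    constructor
    · rintro ⟨x, hx, e⟩
      refine ⟨x - fpol q h x, fun h0 => hx (hne x h0), ?_⟩
      rw [key]
      simp only [g, Equiv.coe_fn_mk]
      linear_combination 4 * e
    · rintro ⟨z, hz, e⟩
      obtain ⟨x, rfl⟩ := surj z
      refine ⟨x, ?_, ?_⟩
      · rintro rfl
        apply hz
        simp [hfs]
      · simp only [key] at e
        simp only [g, Equiv.coe_fn_mk] at e
        rw [← sub_eq_zero]
        apply n4
        linear_combination e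

end finish

/-- Let `q = p^s` be an odd prime power, `F` a finite field with `q^6`
elements, and `h ∈ F` with `h^(q^3+1) = −1` and `h^(q^2) = h`. Then `𝓛_h` is
PΓL-equivalent to `L^4_δ` for some `δ` with `δ^2 + δ = 1` iff `h^q = h` and `p = 5`. -/
theorem stmt15 (p s q : ℕ) (hp : p.Prime) (hs : 0 < s) (hqps : q = p ^ s) (hodd : Odd q)
    (F : Type) [Field F] [Fintype F] (hF : Fintype.card F = q ^ 6)
    (h : F) (hh : h ^ (q ^ 3 + 1) = -1) (hq2 : h ^ (q ^ 2) = h) :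
    (∃ δ : F, δ ^ 2 + δ = 1 ∧
        IsPGammaLEquiv (linearSet (fpol q h))
          (linearSet (fun x : F => x ^ q + x ^ (q ^ 3) + δ * x ^ (q ^ 5)))) ↔
      (h ^ q = h ∧ p = 5) := by
  haveI : Fact p.Prime := ⟨hp⟩
  have hcard : Fintype.card F = p ^ (s * 6) := by rw [hF, hqps, ← pow_mul]
  haveI : CharP F p := charP_of_card_eq_prime_pow hcard
  have hq : 1 < q := by rw [hqps]; exact Nat.one_lt_pow hs.ne' hp.one_lt
  have hpodd : Odd p := by
    rw [hqps] at hodd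
    exact Nat.Odd.of_mul_left (n := p ^ (s - 1)) (by rwa [← pow_succ', Nat.sub_add_cancel hs])
  have h2 : (2 : F) ≠ 0 := by
    intro h0
    have : ((2 : ℕ) : F) = 0 := by exact_mod_cast h0
    rw [CharP.cast_eq_zero_iff F p, Nat.dvd_prime Nat.prime_two] at this
    rcases this with h1 | h1
    · exact hp.one_lt.ne' h1
    · rw [h1] at hpodd
      exact absurd hpodd (by decide)
  have hσ : ∀ x : F, iterateFrobenius F p s x = x ^ q := by
    intro x; rw [iterateFrobenius_def, hqps]
  constructor
  · rintro ⟨δ, hδ, H⟩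
    obtain ⟨r1, r2⟩ := forward hq hodd hF _ hσ h2 h hh hq2 δ hδ H
    refine ⟨r1, ?_⟩
    have : ((5 : ℕ) : F) = 0 := by
      have : 2 * (5 : F) = 0 := by linear_combination r2
      exact_mod_cast (mul_eq_zero.1 this).resolve_left h2
    rw [CharP.cast_eq_zero_iff F p, Nat.dvd_prime Nat.prime_five] at this
    exact this.resolve_left hp.one_lt.ne'
  · rintro ⟨hq1, rfl⟩
    have h5 : (5 : F) = 0 := by exact_mod_cast CharP.cast_eq_zero F 5
    have hh0 : h ≠ 0 := by
      rintro rfl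
      rw [zero_pow (by omega)] at hh
      simp at hh
    exact ⟨2, by linear_combination h5, backward hq hF _ hσ h5 h hh0 hq2 hq1⟩
end

section
/- Let q = p^s be an odd prime power, F a finite field with q^6 elements, and h ∈ F with h^(q^3+1) = −1, and assume it is not the case that both h^q = h and p = 5. Then 𝓛_h is not PΓL-equivalent to any previously known maximum scattered linear set of PG(1, q^6): it is not PΓL-equivalent to L^1, nor to L^2_δ for any δ ∈ F with δ^((q^6−1)/(q−1)) ∉ {0, 1}, nor to L^3_δ for any δ ∈ F with δ^(q^3+1) ∉ {0, 1}, nor to L^4_δ for any δ ∈ F with δ^2 + δ = 1. -/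
open Polynomial in
/-- Vanishing of a linearized polynomial of `q`-degree `< 6` on the whole field forces its
coefficients to vanish. -/
theorem lin_zero {F : Type} [Field F] [Fintype F] {q : ℕ} (hq : 2 ≤ q)
    (hF : Fintype.card F = q ^ 6) (v : Fin 6 → F)
    (hv : ∀ z : F, ∑ i : Fin 6, v i * z ^ (q ^ (i : ℕ)) = 0) : v = 0 := by
  classical
  set P : F[X] := ∑ i : Fin 6, monomial (q ^ (i : ℕ)) (v i) with hP
  have hdeg : P.natDegree < Fintype.card F := by
    rw [hF]
    have : P.natDegree ≤ q ^ 5 := by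
      apply natDegree_sum_le_of_forall_le
      intro i _
      refine (natDegree_monomial_le _).trans ?_
      exact Nat.pow_le_pow_right (by omega) (by omega)
    exact this.trans_lt (Nat.pow_lt_pow_right (by omega) (by norm_num))
  have h0 : P = 0 := by
    apply eq_zero_of_natDegree_lt_card_of_eval_eq_zero P (f := (id : F → F)) Function.injective_id
      _ hdeg
    intro z
    simp only [hP, eval_finsetSum, eval_monomial, id]
    exact hv z
  funext i
  have : P.coeff (q ^ (i : ℕ)) = v i := by
    simp only [hP, finsetSum_coeff, coeff_monomial]
    rw [Finset.sum_eq_single i]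
    · simp
    · intro j _ hj
      rw [if_neg]
      intro h
      exact hj (Fin.ext (Nat.pow_right_injective hq h))
    · simp
  rw [← this, h0]; simp

/-- Dickson matrix. -/
def dick {F : Type} [Field F] (φ : F →+* F) (a : Fin 6 → F) : Matrix (Fin 6) (Fin 6) F :=
  fun i j => (φ ^ (i : ℕ)) (a (j - i))

theorem phi_fin {F : Type} [Field F] {φ : F →+* F} (h6 : φ ^ 6 = 1) (i j : Fin 6) (x : F) :
    (φ ^ ((i + j : Fin 6) : ℕ)) x = (φ ^ (i : ℕ)) ((φ ^ (j : ℕ)) x) := by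
  have : (φ ^ ((i + j : Fin 6) : ℕ)) = φ ^ (i : ℕ) * φ ^ (j : ℕ) := by
    rw [← pow_add]
    rw [Fin.val_add]
    conv_rhs => rw [← Nat.mod_add_div ((i : ℕ) + j) 6, pow_add, pow_mul, h6, one_pow, mul_one]
  rw [this]; rfl

theorem phi_succ {F : Type} [Field F] {φ : F →+* F} (h6 : φ ^ 6 = 1) (i : Fin 6) (x : F) :
    φ ((φ ^ (i : ℕ)) x) = (φ ^ ((i + 1 : Fin 6) : ℕ)) x := by
  rw [add_comm, phi_fin h6]
  simp

theorem dick_frob {F : Type} [Field F] {φ : F →+* F} (h6 : φ ^ 6 = 1) (a : Fin 6 → F) :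
    φ (dick φ a).det = (dick φ a).det := by
  rw [RingHom.map_det, ← Matrix.det_submatrix_equiv_self (Equiv.addRight (1 : Fin 6)) (dick φ a)]
  congr 1
  ext i j
  simp only [RingHom.mapMatrix_apply, Matrix.map_apply, dick, Matrix.submatrix_apply,
    Equiv.coe_addRight, phi_succ h6]
  congr 2
  abel

theorem dick_det_zero {F : Type} [Field F] [Fintype F] {q : ℕ} (hq : 2 ≤ q)
    (hF : Fintype.card F = q ^ 6) {φ : F →+* F} (hφ : ∀ (i : ℕ) (x : F), (φ ^ i) x = x ^ (q ^ i))
    (h6 : φ ^ 6 = 1) (a : Fin 6 → F) :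
    (dick φ a).det = 0 ↔ ∃ x : F, x ≠ 0 ∧ ∑ j : Fin 6, a j * x ^ (q ^ (j : ℕ)) = 0 := by
  have key : ∀ (x : F) (i : Fin 6), ∑ j, dick φ a i j * (φ ^ (j : ℕ)) x
      = (φ ^ (i : ℕ)) (∑ j : Fin 6, a j * x ^ (q ^ (j : ℕ))) := by
    intro x i
    rw [map_sum]
    rw [← Equiv.sum_comp (Equiv.addLeft i) (fun j => dick φ a i j * (φ ^ (j : ℕ)) x)]
    apply Finset.sum_congr rfl
    intro j _
    rw [map_mul, ← hφ, Equiv.coe_addLeft, phi_fin h6, dick]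
    simp
  constructor
  · intro hdet
    by_contra hcon
    push Not at hcon
    obtain ⟨v, hv0, hv⟩ := Matrix.exists_vecMul_eq_zero_iff.mpr hdet
    apply hv0
    set ψ : F →+ F := AddMonoidHom.mk' (fun x => ∑ j : Fin 6, a j * x ^ (q ^ (j : ℕ))) (by
      intro x y
      simp only [← hφ, map_add, mul_add, Finset.sum_add_distrib]) with hψ
    have hinj : Function.Injective ψ := by
      rw [injective_iff_map_eq_zero]
      intro x hx
      by_contra hx0
      exact hcon x hx0 hx
    have hsurj := Finite.surjective_of_injective hinj
    apply lin_zero hq hF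
    intro z
    obtain ⟨x, rfl⟩ := hsurj z
    have h1 : ∀ i : Fin 6, (ψ x) ^ (q ^ (i : ℕ)) = ∑ j, dick φ a i j * (φ ^ (j : ℕ)) x := by
      intro i
      rw [key, hφ]; rfl
    simp only [h1, Finset.mul_sum]
    rw [Finset.sum_comm]
    apply Finset.sum_eq_zero
    intro j _
    have := congrFun hv j
    simp only [Matrix.vecMul, dotProduct, Pi.zero_apply] at this
    simp only [← mul_assoc]
    rw [← Finset.sum_mul, this, zero_mul]
  · rintro ⟨x, hx, hs⟩
    apply Matrix.exists_mulVec_eq_zero_iff.mp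
    refine ⟨fun j => (φ ^ (j : ℕ)) x, ?_, ?_⟩
    · intro h
      have := congrFun h 0
      simp at this
      exact hx this
    · funext i
      simp only [Matrix.mulVec, dotProduct, key, hs, map_zero, Pi.zero_apply]

/-- The multilinear form `det (diag U - diag Z * A)`. -/
noncomputable def DD {F : Type} [Field F] (A : Matrix (Fin 6) (Fin 6) F) :
    MultilinearMap F (fun _ : Fin 6 => F × F) F :=
  (Matrix.detRowAlternating (n := Fin 6) (R := F)).toMultilinearMap.compLinearMap
    (fun i => (LinearMap.fst F F F).smulRight ((1 : Matrix (Fin 6) (Fin 6) F) i)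
      - (LinearMap.snd F F F).smulRight (A i))

theorem DD_apply {F : Type} [Field F] (A : Matrix (Fin 6) (Fin 6) F) (w : Fin 6 → F × F) :
    DD A w = (Matrix.of fun i j => (w i).1 * (1 : Matrix (Fin 6) (Fin 6) F) i j
      - (w i).2 * A i j).det := by
  simp only [DD, MultilinearMap.compLinearMap_apply]
  exact congrArg Matrix.det (by ext i j; simp)

theorem DD_dick {F : Type} [Field F] (φ : F →+* F) (a : Fin 6 → F) (u z : F) :
    DD (dick φ a) (fun i => ((φ ^ (i : ℕ)) u, (φ ^ (i : ℕ)) z))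
      = (dick φ (fun j => (if j = 0 then u else 0) - z * a j)).det := by
  rw [DD_apply]
  congr 1
  ext i j
  simp only [Matrix.of_apply, dick, map_sub, map_mul, Matrix.one_apply, sub_eq_zero, eq_comm]
  split_ifs <;> simp

open Polynomial in
/-- The univariate polynomial attached to a multilinear form. -/
noncomputable def PP {F : Type} [Field F] (q : ℕ)
    (M : MultilinearMap F (fun _ : Fin 6 => F × F) F) : F[X] :=
  ∑ s : Finset (Fin 6), monomial (∑ i ∈ s, q ^ (i : ℕ))
    (M (s.piecewise (fun _ => (1, 0)) (fun _ => (0, 1))))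

open Polynomial in
theorem PP_eval {F : Type} [Field F] (q : ℕ)
    (M : MultilinearMap F (fun _ : Fin 6 => F × F) F) (y : F) :
    (PP q M).eval y = M (fun i => (y ^ (q ^ (i : ℕ)), 1)) := by
  have h : (fun i : Fin 6 => ((y ^ (q ^ (i : ℕ)), 1) : F × F))
      = (fun i : Fin 6 => (y ^ (q ^ (i : ℕ))) • ((1, 0) : F × F)) + (fun _ => (0, 1)) := by
    funext i; simp
  rw [h, MultilinearMap.map_add_univ]
  simp only [PP, eval_finsetSum, eval_monomial]
  apply Finset.sum_congr rfl
  intro s _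
  have := M.map_piecewise_smul (fun i : Fin 6 => y ^ (q ^ (i : ℕ)))
    (s.piecewise (fun _ => ((1, 0) : F × F)) (fun _ => (0, 1))) s
  rw [← Finset.prod_pow_eq_pow_sum, mul_comm, ← smul_eq_mul, ← this]
  congr 1
  funext i
  by_cases hi : i ∈ s <;> simp [hi]

theorem sum_fin_eq (q : ℕ) (s : Finset (Fin 6)) :
    ∑ i ∈ s, q ^ (i : ℕ) = ∑ i ∈ s.map Fin.valEmbedding, q ^ i := by
  rw [Finset.sum_map]; rfl

open Polynomial in
theorem PP_natDegree {F : Type} [Field F] {q : ℕ} (hq : 2 ≤ q)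
    (M : MultilinearMap F (fun _ : Fin 6 => F × F) F) :
    (PP q M).natDegree * (q - 1) < q ^ 6 := by
  have h1 : (PP q M).natDegree ≤ ∑ i : Fin 6, q ^ (i : ℕ) := by
    apply natDegree_sum_le_of_forall_le
    intro s _
    refine (natDegree_monomial_le _).trans ?_
    exact Finset.sum_le_sum_of_subset (Finset.subset_univ s)
  have h2 : (∑ i : Fin 6, q ^ (i : ℕ)) * (q - 1) + 1 = q ^ 6 := by
    obtain ⟨n, rfl⟩ : ∃ n, q = n + 1 := ⟨q - 1, by omega⟩
    simp only [Fin.sum_univ_succ]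
    simp
    ring
  have := Nat.mul_le_mul_right (q - 1) h1
  omega

open Polynomial in
theorem PP_inj {F : Type} [Field F] {q : ℕ} (hq : 2 ≤ q)
    (M M' : MultilinearMap F (fun _ : Fin 6 => F × F) F) (h : PP q M = PP q M') : M = M' := by
  have hc : ∀ (N : MultilinearMap F (fun _ : Fin 6 => F × F) F) (s : Finset (Fin 6)),
      (PP q N).coeff (∑ i ∈ s, q ^ (i : ℕ))
        = N (s.piecewise (fun _ => (1, 0)) (fun _ => (0, 1))) := by
    intro N s
    simp only [PP, finsetSum_coeff, coeff_monomial]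
    rw [Finset.sum_eq_single s]
    · simp
    · intro t _ ht
      rw [if_neg]
      intro he
      rw [sum_fin_eq, sum_fin_eq] at he
      exact ht (Finset.map_injective _ (Finset.geomSum_injective hq he))
    · simp
  ext w
  have hw : w = (fun i => (w i).1 • ((1, 0) : F × F)) + (fun i => (w i).2 • ((0, 1) : F × F)) := by
    funext i; ext <;> simp
  rw [hw, MultilinearMap.map_add_univ, MultilinearMap.map_add_univ]
  apply Finset.sum_congr rfl
  intro s _
  have hs : s.piecewise (fun i => (w i).1 • ((1, 0) : F × F)) (fun i => (w i).2 • ((0, 1) : F × F))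
      = fun i => (if i ∈ s then (w i).1 else (w i).2) •
          (s.piecewise (fun _ => (1, 0)) (fun _ => (0, 1)) : Fin 6 → F × F) i := by
    funext i
    by_cases hi : i ∈ s <;> simp [hi]
  rw [hs, MultilinearMap.map_smul_univ, MultilinearMap.map_smul_univ, ← hc, ← hc, h]

theorem ML_ext {F : Type} [Field F] [Fintype F] {q : ℕ} (hq : 2 ≤ q)
    (hF : Fintype.card F = q ^ 6)
    (M M' : MultilinearMap F (fun _ : Fin 6 => F × F) F)
    (h : ∀ y : F, M (fun i => (y ^ (q ^ (i : ℕ)), 1)) = M' (fun i => (y ^ (q ^ (i : ℕ)), 1))) :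
    M = M' := by
  apply PP_inj hq
  rw [← sub_eq_zero]
  apply Polynomial.eq_zero_of_natDegree_lt_card_of_eval_eq_zero _ (f := (id : F → F))
    Function.injective_id
  · intro y
    simp only [id, Polynomial.eval_sub, PP_eval, h, sub_self]
  · rw [hF]
    refine (Polynomial.natDegree_sub_le _ _).trans_lt ?_
    have h1 := PP_natDegree hq M
    have h2 := PP_natDegree hq M'
    have h3 : 1 ≤ q - 1 := by omega
    have h4 := Nat.mul_le_mul_left (PP q M).natDegree h3
    have h5 := Nat.mul_le_mul_left (PP q M').natDegree h3
    rw [max_lt_iff]; constructor <;> omega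

theorem ML_prop {F : Type} [Field F] [Fintype F] {q : ℕ} (hq : 2 ≤ q)
    (hF : Fintype.card F = q ^ 6)
    (M M' : MultilinearMap F (fun _ : Fin 6 => F × F) F)
    (h : ∀ y : F, M (fun i => (y ^ (q ^ (i : ℕ)), 1)) ^ (q - 1)
      = M' (fun i => (y ^ (q ^ (i : ℕ)), 1)) ^ (q - 1)) :
    ∃ κ : F, M = κ • M' := by
  have hpow : PP q M ^ (q - 1) - PP q M' ^ (q - 1) = 0 := by
    apply Polynomial.eq_zero_of_natDegree_lt_card_of_eval_eq_zero _ (f := (id : F → F))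
      Function.injective_id
    · intro y
      simp only [id, Polynomial.eval_sub, Polynomial.eval_pow, PP_eval, h, sub_self]
    · rw [hF]
      refine (Polynomial.natDegree_sub_le _ _).trans_lt ?_
      have h1 := PP_natDegree hq M
      have h2 := PP_natDegree hq M'
      rw [max_lt_iff, Polynomial.natDegree_pow, Polynomial.natDegree_pow]
      rw [Nat.mul_comm (q - 1) (PP q M).natDegree, Nat.mul_comm (q - 1) (PP q M').natDegree]
      exact ⟨h1, h2⟩
  obtain ⟨g, hg⟩ := IsCyclic.exists_generator (α := Fˣ)
  have hord : orderOf g = q ^ 6 - 1 := by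
    rw [orderOf_eq_card_of_forall_mem_zpowers hg, Nat.card_units, Nat.card_eq_fintype_card, hF]
  have hdvd : q - 1 ∣ q ^ 6 - 1 := by
    simpa using Nat.sub_dvd_pow_sub_pow q 1 6
  obtain ⟨m, hm⟩ := hdvd
  have hpos : 0 < q ^ 6 - 1 := by
    have := Nat.one_lt_pow (n := 6) (by norm_num) (show 1 < q by omega)
    omega
  have hprim0 : IsPrimitiveRoot g (q ^ 6 - 1) := hord ▸ IsPrimitiveRoot.orderOf g
  have hprim1 : IsPrimitiveRoot (g ^ m) (q - 1) :=
    hprim0.pow hpos (by rw [hm, mul_comm])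
  have hprim2 : IsPrimitiveRoot ((g ^ m : Fˣ) : F) (q - 1) := IsPrimitiveRoot.coe_units_iff.mpr hprim1
  have hprim : IsPrimitiveRoot (Polynomial.C ((g ^ m : Fˣ) : F)) (q - 1) :=
    hprim2.map_of_injective Polynomial.C_injective
  rw [hprim.pow_sub_pow_eq_prod_sub_mul _ _ (by omega), Finset.prod_eq_zero_iff] at hpow
  obtain ⟨ζ, hζ, hz⟩ := hpow
  rw [Polynomial.mem_nthRootsFinset (by omega)] at hζ
  have hζ0 : ζ.natDegree = 0 := by
    have := congrArg Polynomial.natDegree hζ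
    rw [Polynomial.natDegree_pow, Polynomial.natDegree_one] at this
    rcases Nat.mul_eq_zero.mp this with h' | h'
    · omega
    · exact h'
  rw [Polynomial.natDegree_eq_zero] at hζ0
  obtain ⟨κ, rfl⟩ := hζ0
  refine ⟨κ, PP_inj hq _ _ ?_⟩
  rw [sub_eq_zero.mp hz]
  simp [PP, Finset.mul_sum, Polynomial.C_mul_monomial]
theorem mem_linearSet {F : Type} [Field F] (f : F → F) (v : F × F) (hv : v ≠ 0) :
    Projectivization.mk F v hv ∈ linearSet f ↔ ∃ x : F, x ≠ 0 ∧ v.2 * x = v.1 * f x := by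
  unfold linearSet
  simp only [Set.mem_ofPred_eq, Projectivization.mk_eq_mk_iff']
  constructor
  · rintro ⟨x, hx, a, ha⟩
    refine ⟨x, hx, ?_⟩
    rw [← ha]
    simp only [Prod.smul_mk, smul_eq_mul]
    ring
  · rintro ⟨x, hx, hxe⟩
    refine ⟨x, hx, v.1 / x, ?_⟩
    ext
    · simp only [Prod.smul_mk, smul_eq_mul]
      field_simp
    · simp only [Prod.smul_mk, smul_eq_mul]
      field_simp
      rw [← hxe, mul_comm]

/-- Unfolding of `PΓL`-equivalence into coordinates. -/
theorem equiv_coord {F : Type} [Field F] (q : ℕ) (f g : F → F) (ag : Fin 6 → F)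
    (hg : ∀ x, g x = ∑ j : Fin 6, ag j * x ^ (q ^ (j : ℕ)))
    (h : IsPGammaLEquiv (linearSet f) (linearSet g)) :
    ∃ (ρ : F ≃+* F) (A B C E : F), A * E - B * C ≠ 0 ∧
      ∀ y : F, (∃ x : F, x ≠ 0 ∧ y * x = f x) ↔
        ∃ x : F, x ≠ 0 ∧ (C + y * E) * x
          = (A + y * B) * ∑ j : Fin 6, ρ (ag j) * x ^ (q ^ (j : ℕ)) := by
  obtain ⟨ρ, G, hadd, hsm, hmem⟩ := h
  have hG : ∀ u z : F, G (u, z) = ρ u • G (1, 0) + ρ z • G (0, 1) := by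
    intro u z
    rw [← hsm, ← hsm, ← hadd]
    simp
  have hG0 : G 0 = 0 := by
    have := hsm 0 0
    simpa using this
  obtain ⟨⟨A, C⟩, hAC⟩ : ∃ w, w = G (1, 0) := ⟨_, rfl⟩
  obtain ⟨⟨B, E⟩, hBE⟩ : ∃ w, w = G (0, 1) := ⟨_, rfl⟩
  have hne : ∀ v : F × F, v ≠ 0 → G v ≠ 0 := by
    intro v hv h0
    exact hv (G.injective (h0.trans hG0.symm))
  have hdet : A * E - B * C ≠ 0 := by
    intro hd
    have h1 : G (ρ.symm B, ρ.symm (-A)) = 0 := by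
      rw [hG, ← hAC, ← hBE]
      ext <;> simp
      · ring
      · linear_combination -hd
    have h2 : G (ρ.symm E, ρ.symm (-C)) = 0 := by
      rw [hG, ← hAC, ← hBE]
      ext <;> simp
      · linear_combination hd
      · ring
    have h3 := G.injective (h1.trans hG0.symm)
    have h4 := G.injective (h2.trans hG0.symm)
    simp [Prod.ext_iff] at h3 h4
    have : G (1, 0) = 0 := by rw [← hAC, h3.2, h4.2]; rfl
    exact hne (1, 0) (by simp) this
  refine ⟨ρ.symm, ρ.symm A, ρ.symm B, ρ.symm C, ρ.symm E, ?_, ?_⟩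
  · rw [← map_mul, ← map_mul, ← map_sub]
    exact (map_ne_zero ρ.symm).mpr hdet
  · intro y
    have hv : ((1, y) : F × F) ≠ 0 := by simp
    have key := hmem (1, y) hv (hne _ hv)
    rw [mem_linearSet, mem_linearSet, hG, ← hAC, ← hBE] at key
    simp only [one_mul] at key
    rw [key]
    simp only [map_one, one_smul, Prod.smul_mk, smul_eq_mul, Prod.mk_add_mk, hg]
    constructor
    · rintro ⟨x, hx, hxe⟩
      refine ⟨ρ.symm x, by simpa using hx, ?_⟩
      have := congrArg ρ.symm hxe
      simpa using this
    · rintro ⟨x, hx, hxe⟩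
      refine ⟨ρ x, by simpa using hx, ?_⟩
      have := congrArg ρ hxe
      simpa using this

/-- Coordinate change in one slot. -/
def NN {F : Type} [Field F] (A B C E : F) : F × F →ₗ[F] F × F where
  toFun w := (E * w.1 + C * w.2, B * w.1 + A * w.2)
  map_add' u v := by ext <;> simp <;> ring
  map_smul' c v := by ext <;> simp <;> ring

theorem NN_apply {F : Type} [Field F] (A B C E : F) (w : F × F) :
    NN A B C E w = (E * w.1 + C * w.2, B * w.1 + A * w.2) := rfl

/-- The main structural step: the two determinant forms are proportional. -/
theorem main_prop {F : Type} [Field F] [Fintype F] {q : ℕ} (hq : 2 ≤ q)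
    (hF : Fintype.card F = q ^ 6) {φ : F →+* F} (hφ : ∀ (i : ℕ) (x : F), (φ ^ i) x = x ^ (q ^ i))
    (h6 : φ ^ 6 = 1) (af ag : Fin 6 → F) (A B C E : F)
    (h : ∀ y : F, (∃ x : F, x ≠ 0 ∧ y * x = ∑ j : Fin 6, af j * x ^ (q ^ (j : ℕ))) ↔
        ∃ x : F, x ≠ 0 ∧ (C + y * E) * x
          = (A + y * B) * ∑ j : Fin 6, ag j * x ^ (q ^ (j : ℕ))) :
    ∃ κ : F, ∀ w : Fin 6 → F × F, DD (dick φ af) w = κ * DD (dick φ ag) (fun i =>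
      NN ((φ ^ (i : ℕ)) A) ((φ ^ (i : ℕ)) B) ((φ ^ (i : ℕ)) C) ((φ ^ (i : ℕ)) E) (w i)) := by
  classical
  have hfix : ∀ d : F, φ d = d → d ^ (q - 1) = if d = 0 then 0 else 1 := by
    intro d hd
    have h1 : d ^ q = d := by
      have := hφ 1 d
      simp at this
      rw [← this, hd]
    split_ifs with h0
    · rw [h0, zero_pow (by omega)]
    · apply mul_right_cancel₀ h0
      rw [one_mul, ← pow_succ, Nat.sub_add_cancel (by omega), h1]
  have hiff : ∀ (a : Fin 6 → F) (u z : F),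
      DD (dick φ a) (fun i => ((φ ^ (i : ℕ)) u, (φ ^ (i : ℕ)) z)) ^ (q - 1) =
        if (∃ x : F, x ≠ 0 ∧ u * x = z * ∑ j : Fin 6, a j * x ^ (q ^ (j : ℕ))) then 0 else 1 := by
    intro a u z
    rw [DD_dick, hfix _ (dick_frob h6 _)]
    refine if_congr ?_ rfl rfl
    rw [dick_det_zero hq hF hφ h6]
    apply exists_congr
    intro x
    apply and_congr_right
    intro _
    simp only [sub_mul, Finset.sum_sub_distrib, ite_mul, zero_mul]
    simp [sub_eq_zero, Finset.mul_sum, mul_assoc]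
  obtain ⟨κ, hκ⟩ := ML_prop hq hF (DD (dick φ af)) ((DD (dick φ ag)).compLinearMap (fun i =>
      NN ((φ ^ (i : ℕ)) A) ((φ ^ (i : ℕ)) B) ((φ ^ (i : ℕ)) C) ((φ ^ (i : ℕ)) E))) (by
    intro y
    have h1 := hiff af y 1
    have h2 := hiff ag (C + y * E) (A + y * B)
    simp only [one_mul] at h1
    simp only [← h y] at h2
    rw [← h1] at h2
    simp only [hφ, one_pow] at h2
    rw [← h2, MultilinearMap.compLinearMap_apply]
    congr 2
    funext i
    simp only [NN_apply, ← hφ, map_add, map_mul]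
    ext <;> simp <;> ring)
  refine ⟨κ, fun w => ?_⟩
  rw [hκ, _root_.smul_apply, MultilinearMap.compLinearMap_apply, smul_eq_mul]

theorem even_of {F : Type} [Field F] [Fintype F] {q : ℕ} (hq : 2 ≤ q)
    (hF : Fintype.card F = q ^ 6) (A : Matrix (Fin 6) (Fin 6) F) (S : Fin 6 → F)
    (hS : ∀ i, S i ≠ 0) (hA : ∀ i j, A j i * S j = -(S i * A i j)) (w : Fin 6 → F × F) :
    DD A (fun i => ((w i).1, -(w i).2)) = DD A w := by
  have key : (DD A).compLinearMap
      (fun _ => NN (-1) 0 0 1) = DD A := by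
    apply ML_ext hq hF
    intro y
    rw [MultilinearMap.compLinearMap_apply, DD_apply, DD_apply]
    set M1 := (Matrix.of fun (i j : Fin 6) => (y ^ (q ^ (i : ℕ)), (1 : F)).1 *
      (1 : Matrix (Fin 6) (Fin 6) F) i j - (y ^ (q ^ (i : ℕ)), (1 : F)).2 * A i j) with hM1
    set M2 := (Matrix.of fun (i j : Fin 6) =>
      ((NN (-1) 0 0 1) (y ^ (q ^ (i : ℕ)), (1 : F))).1 *
      (1 : Matrix (Fin 6) (Fin 6) F) i j -
      ((NN (-1) 0 0 1) (y ^ (q ^ (i : ℕ)), (1 : F))).2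
        * A i j) with hM2
    have hM : M1.transpose * Matrix.diagonal S = Matrix.diagonal S * M2 := by
      ext i j
      rw [Matrix.mul_diagonal, Matrix.diagonal_mul]
      simp only [hM1, hM2, Matrix.transpose_apply, Matrix.of_apply, NN_apply, one_mul,
        Matrix.one_apply]
      have := hA i j
      by_cases hij : i = j
      · subst hij
        simp
        linear_combination -this
      · simp [hij, Ne.symm hij]
        linear_combination -this
    have hd := congrArg Matrix.det hM
    rw [Matrix.det_mul, Matrix.det_mul, Matrix.det_transpose, Matrix.det_diagonal, mul_comm] at hd
    exact (mul_left_cancel₀ (Finset.prod_ne_zero_iff.mpr fun i _ => hS i) hd).symm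
  have e : (fun i => ((w i).1, -(w i).2)) = fun i => NN (-1 : F) 0 0 1 (w i) := by
    funext i
    rw [NN_apply]
    ext <;> simp
  rw [e, ← MultilinearMap.compLinearMap_apply, key]

/-- Values of a multilinear form on basis vectors. -/
def ew {F : Type} [Field F] (J : Finset (Fin 6)) : Fin 6 → F × F :=
  fun i => if i ∈ J then (0, 1) else (1, 0)

theorem odd_zero {F : Type} [Field F] (h2 : (2 : F) ≠ 0)
    (M : MultilinearMap F (fun _ : Fin 6 => F × F) F)
    (hM : ∀ w : Fin 6 → F × F, M (fun i => ((w i).1, -(w i).2)) = M w)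
    (J : Finset (Fin 6)) (hJ : Odd J.card) : M (ew J) = 0 := by
  have h1 := hM (ew J)
  have h3 : (fun i => (((ew J : Fin 6 → F × F) i).1, -((ew J : Fin 6 → F × F) i).2))
      = fun i => (if i ∈ J then (-1 : F) else 1) • (ew J : Fin 6 → F × F) i := by
    funext i
    by_cases hi : i ∈ J <;> simp [ew, hi]
  rw [h3, MultilinearMap.map_smul_univ] at h1
  have h4 : ∏ i : Fin 6, (if i ∈ J then (-1 : F) else 1) = -1 := by
    rw [Finset.prod_ite_mem, Finset.univ_inter, Finset.prod_const, hJ.neg_one_pow]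
  rw [h4, smul_eq_mul] at h1
  have : (2 : F) * M (ew J) = 0 := by linear_combination -h1
  exact (mul_eq_zero.mp this).resolve_left h2

theorem lie_even {F : Type} [Field F]
    (M : MultilinearMap F (fun _ : Fin 6 => F × F) F)
    (hodd : ∀ J : Finset (Fin 6), Odd J.card → M (ew J) = 0)
    (ε α b γ : Fin 6 → F)
    (hLie : ∀ w : Fin 6 → F × F, ∑ i, ε i * M (Function.update w i
      (α i * (w i).1 + b i * (w i).2, γ i * (w i).1 - α i * (w i).2)) = 0)
    (J : Finset (Fin 6)) (hJ : Even J.card) (hJ0 : M (ew J) ≠ 0) :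
    ∑ i, ε i * (if i ∈ J then - α i else α i) = 0 := by
  have h1 := hLie (ew J)
  have h2 : ∀ i, M (Function.update (ew J) i
      (α i * ((ew J : Fin 6 → F × F) i).1 + b i * ((ew J : Fin 6 → F × F) i).2,
        γ i * ((ew J : Fin 6 → F × F) i).1 - α i * ((ew J : Fin 6 → F × F) i).2))
      = (if i ∈ J then - α i else α i) * M (ew J) := by
    intro i
    by_cases hi : i ∈ J
    · have hv : ((α i * ((ew J : Fin 6 → F × F) i).1 + b i * ((ew J : Fin 6 → F × F) i).2,
        γ i * ((ew J : Fin 6 → F × F) i).1 - α i * ((ew J : Fin 6 → F × F) i).2) : F × F)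
          = (- α i) • ((0, 1) : F × F) + b i • ((1, 0) : F × F) := by
        ext <;> simp [ew, hi]
      have hu1 : Function.update (ew J : Fin 6 → F × F) i (0, 1) = ew J := by
        rw [Function.update_eq_self_iff]; simp [ew, hi]
      have hu2 : Function.update (ew J : Fin 6 → F × F) i (1, 0) = ew (J.erase i) := by
        funext j
        by_cases hj : j = i
        · subst hj; simp [ew]
        · simp [ew, hj]
      rw [hv, MultilinearMap.map_update_add, MultilinearMap.map_update_smul,
        MultilinearMap.map_update_smul, hu1, hu2, hodd (J.erase i), if_pos hi]
      · simp
      · rw [Finset.card_erase_of_mem hi]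
        exact Nat.Even.sub_odd (Finset.card_pos.mpr ⟨i, hi⟩) hJ odd_one
    · have hv : ((α i * ((ew J : Fin 6 → F × F) i).1 + b i * ((ew J : Fin 6 → F × F) i).2,
        γ i * ((ew J : Fin 6 → F × F) i).1 - α i * ((ew J : Fin 6 → F × F) i).2) : F × F)
          = γ i • ((0, 1) : F × F) + α i • ((1, 0) : F × F) := by
        ext <;> simp [ew, hi]
      have hu1 : Function.update (ew J : Fin 6 → F × F) i (1, 0) = ew J := by
        rw [Function.update_eq_self_iff]; simp [ew, hi]
      have hu2 : Function.update (ew J : Fin 6 → F × F) i (0, 1) = ew (insert i J) := by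
        funext j
        by_cases hj : j = i
        · subst hj; simp [ew]
        · simp [ew, hj]
      rw [hv, MultilinearMap.map_update_add, MultilinearMap.map_update_smul,
        MultilinearMap.map_update_smul, hu1, hu2, hodd (insert i J), if_neg hi]
      · simp
      · rw [Finset.card_insert_of_notMem hi]
        exact hJ.add_one
  simp only [h2, ← mul_assoc] at h1
  rw [← Finset.sum_mul] at h1
  exact (mul_eq_zero.mp h1).resolve_right hJ0

theorem sum_updateRow {F : Type} [Field F] (M : Matrix (Fin 6) (Fin 6) F) (k : Fin 6 → F) :
    ∑ i, (M.updateRow i (fun j => M i j * k j)).det = (∑ i, k i) * M.det := by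
  have h1 : ∀ i, (M.updateRow i (fun j => M i j * k j)).det
      = ∑ j, M i j * k j * M.adjugate j i := by
    intro i
    rw [← Matrix.cramer_transpose_apply, Matrix.cramer_eq_adjugate_mulVec, Matrix.mulVec, dotProduct]
    apply Finset.sum_congr rfl
    intro j _
    rw [← Matrix.adjugate_transpose, Matrix.transpose_apply, mul_comm]
  simp only [h1]
  rw [Finset.sum_comm, Finset.sum_mul]
  apply Finset.sum_congr rfl
  intro j _
  have h2 : (M.adjugate * M) j j = M.det := by
    rw [Matrix.adjugate_mul]; simp
  rw [← h2, Matrix.mul_apply, Finset.mul_sum]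
  apply Finset.sum_congr rfl
  intro i _
  ring

theorem lie_g {F : Type} [Field F] (A : Matrix (Fin 6) (Fin 6) F) (ε k l : Fin 6 → F)
    (hk : ∀ i, k i - l i = ε i) (hA : ∀ i j, A i j = 0 ∨ k j - l i = - ε i)
    (hs : ∑ i, k i = ∑ i, l i) (w : Fin 6 → F × F) :
    ∑ i, ε i * DD A (Function.update w i ((w i).1, -(w i).2)) = 0 := by
  set M := (Matrix.of fun i j => (w i).1 * (1 : Matrix (Fin 6) (Fin 6) F) i j
      - (w i).2 * A i j) with hM
  have h1 : ∀ i, ε i * DD A (Function.update w i ((w i).1, -(w i).2))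
      = (M.updateRow i (fun j => M i j * k j)).det - l i * M.det := by
    intro i
    have e1 : DD A (Function.update w i ((w i).1, -(w i).2)) = (M.updateRow i
        (fun j => (w i).1 * (1 : Matrix (Fin 6) (Fin 6) F) i j + (w i).2 * A i j)).det := by
      rw [DD_apply]
      congr 1
      ext a b
      by_cases ha : a = i
      · subst ha; simp
      · simp [ha, hM]
    have e2 : l i * M.det = (M.updateRow i (l i • M i)).det := by
      rw [Matrix.det_updateRow_smul, Matrix.updateRow_eq_self]
    rw [e1, e2, ← Matrix.det_updateRow_smul, eq_sub_iff_add_eq, ← Matrix.det_updateRow_add]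
    congr 2
    funext j
    simp only [Pi.add_apply, Pi.smul_apply, smul_eq_mul, hM, Matrix.of_apply, Matrix.one_apply]
    by_cases hij : i = j
    · subst hij
      rw [if_pos rfl]
      rcases hA i i with h | h
      · rw [h]; linear_combination (-(w i).1) * hk i
      · linear_combination (-(w i).1) * hk i + (w i).2 * A i i * h
    · rw [if_neg hij]
      rcases hA i j with h | h
      · rw [h]; ring
      · linear_combination (w i).2 * A i j * h
  simp only [h1]
  rw [Finset.sum_sub_distrib, sum_updateRow, ← Finset.sum_mul, hs, sub_self]

theorem sign_g {F : Type} [Field F] (A : Matrix (Fin 6) (Fin 6) F) (η k : Fin 6 → F)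
    (hk : ∀ i, k i * k i = 1) (hA : ∀ i j, A i j = 0 ∨ k i * k j = η i) (w : Fin 6 → F × F) :
    DD A (fun i => ((w i).1, η i * (w i).2)) = DD A w := by
  rw [DD_apply, DD_apply]
  set M := (Matrix.of fun i j => (w i).1 * (1 : Matrix (Fin 6) (Fin 6) F) i j
      - (w i).2 * A i j) with hM
  have h1 : (Matrix.of fun i j => ((w i).1, η i * (w i).2).1 * (1 : Matrix (Fin 6) (Fin 6) F) i j
      - ((w i).1, η i * (w i).2).2 * A i j) = Matrix.diagonal k * M * Matrix.diagonal k := by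
    ext i j
    rw [Matrix.mul_diagonal, Matrix.diagonal_mul]
    simp only [hM, Matrix.of_apply, Matrix.one_apply]
    by_cases hij : i = j
    · subst hij
      rw [if_pos rfl]
      rcases hA i i with h | h
      · rw [h]; linear_combination (-(w i).1) * hk i
      · linear_combination (-(w i).1) * hk i + (w i).2 * A i i * h
    · rw [if_neg hij]
      rcases hA i j with h | h
      · rw [h]; ring
      · linear_combination (w i).2 * A i j * h
  rw [h1, Matrix.det_mul, Matrix.det_mul, Matrix.det_diagonal, mul_right_comm,
    ← Finset.prod_mul_distrib]
  simp [hk]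

theorem dick_eq {F : Type} [Field F] (φ : F →+* F) (a : Fin 6 → F) :
    dick φ a = !![a 0, a 1, a 2, a 3, a 4, a 5;
      φ (a 5), φ (a 0), φ (a 1), φ (a 2), φ (a 3), φ (a 4);
      φ (φ (a 4)), φ (φ (a 5)), φ (φ (a 0)), φ (φ (a 1)), φ (φ (a 2)), φ (φ (a 3));
      φ (φ (φ (a 3))), φ (φ (φ (a 4))), φ (φ (φ (a 5))), φ (φ (φ (a 0))), φ (φ (φ (a 1))),
        φ (φ (φ (a 2)));
      φ (φ (φ (φ (a 2)))), φ (φ (φ (φ (a 3)))), φ (φ (φ (φ (a 4)))), φ (φ (φ (φ (a 5)))),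
        φ (φ (φ (φ (a 0)))), φ (φ (φ (φ (a 1))));
      φ (φ (φ (φ (φ (a 1))))), φ (φ (φ (φ (φ (a 2))))), φ (φ (φ (φ (φ (a 3))))),
        φ (φ (φ (φ (φ (a 4))))), φ (φ (φ (φ (φ (a 5))))), φ (φ (φ (φ (φ (a 0)))))] := by
  ext i j
  fin_cases i <;> fin_cases j <;> rfl

/-- The Dickson matrix of `f_h`. -/
def Af {F : Type} [Field F] (x y z : F) : Matrix (Fin 6) (Fin 6) F :=
  !![0, y / x, -z / x, 0, 1, 1;
     1, 0, z / y, 1 / (x * y), 0, 1;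
     1, 1, 0, -1 / (x * z), 1 / (y * z), 0;
     0, 1, 1, 0, x / y, -x / z;
     x * y, 0, 1, 1, 0, y / z;
     - x * z, y * z, 0, 1, 1, 0]

theorem dick_f {F : Type} [Field F] (φ : F →+* F) (h : F) (h0 : h ≠ 0)
    (h3 : φ (φ (φ h)) = - h⁻¹) :
    dick φ ![0, φ h / h, - φ (φ h) / h, 0, 1, 1] = Af h (φ h) (φ (φ h)) := by
  have h1 : φ h ≠ 0 := (map_ne_zero φ).mpr h0
  have h2 : φ (φ h) ≠ 0 := (map_ne_zero φ).mpr h1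
  rw [dick_eq, Af]
  ext i j
  fin_cases i <;> fin_cases j <;> simp [h3] <;> field_simp

theorem Af_even {F : Type} [Field F] (x y z : F) (hx : x ≠ 0) (hy : y ≠ 0) (hz : z ≠ 0) :
    ∃ S : Fin 6 → F, (∀ i, S i ≠ 0) ∧ ∀ i j, Af x y z j i * S j = -(S i * Af x y z i j) := by
  refine ⟨![x, -y, z, 1 / x, -1 / y, 1 / z], ?_, ?_⟩
  · intro i
    fin_cases i <;> simp [hx, hy, hz]
  · intro i j
    fin_cases i <;> fin_cases j <;> simp [Af] <;> field_simp

theorem Af_empty {F : Type} [Field F] (A : Matrix (Fin 6) (Fin 6) F) : DD A (ew ∅) = 1 := by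
  rw [DD_apply, ← Matrix.det_one (n := Fin 6) (R := F)]
  congr 1
  ext i j
  simp [ew]

theorem DD_ew {F : Type} [Field F] (A : Matrix (Fin 6) (Fin 6) F) (J : Finset (Fin 6)) :
    DD A (ew J) = (Matrix.of fun i j => if i ∈ J then - A i j else if i = j then 1 else 0).det := by
  rw [DD_apply]
  congr 1
  ext i j
  by_cases hi : i ∈ J <;> simp [ew, hi, Matrix.one_apply]

theorem Af_01 {F : Type} [Field F] (x y z : F) (hx : x ≠ 0) (hy : y ≠ 0) (hz : z ≠ 0) :
    DD (Af x y z) (ew {0, 1}) = - y / x := by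
  rw [DD_ew]
  simp [Af, Matrix.det_succ_row_zero (n := 5), Fin.sum_univ_succ]
  simp [Matrix.det_succ_row_zero (n := 4), Fin.sum_univ_succ]
  simp [Matrix.det_succ_row_zero (n := 3), Fin.sum_univ_succ]
  simp [Matrix.det_fin_three, Fin.succAbove]
  field_simp
  try ring

theorem Af_02 {F : Type} [Field F] (x y z : F) (hx : x ≠ 0) (hy : y ≠ 0) (hz : z ≠ 0) :
    DD (Af x y z) (ew {0, 2}) = z / x := by
  rw [DD_ew]
  simp [Af, Matrix.det_succ_row_zero (n := 5), Fin.sum_univ_succ]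
  simp [Matrix.det_succ_row_zero (n := 4), Fin.sum_univ_succ]
  simp [Matrix.det_succ_row_zero (n := 3), Fin.sum_univ_succ]
  simp [Matrix.det_fin_three, Fin.succAbove]
  field_simp
  try ring

theorem Af_24 {F : Type} [Field F] (x y z : F) (hx : x ≠ 0) (hy : y ≠ 0) (hz : z ≠ 0) :
    DD (Af x y z) (ew {2, 4}) = - 1 / (y * z) := by
  rw [DD_ew]
  simp [Af, Matrix.det_succ_row_zero (n := 5), Fin.sum_univ_succ]
  simp [Matrix.det_succ_row_zero (n := 4), Fin.sum_univ_succ]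
  simp [Matrix.det_succ_row_zero (n := 3), Fin.sum_univ_succ]
  simp [Matrix.det_fin_three, Fin.succAbove]
  field_simp
  try ring

theorem Af_04 {F : Type} [Field F] (x y z : F) (hx : x ≠ 0) (hy : y ≠ 0) (hz : z ≠ 0) :
    DD (Af x y z) (ew {0, 4}) = - x * y := by
  rw [DD_ew]
  simp [Af, Matrix.det_succ_row_zero (n := 5), Fin.sum_univ_succ]
  simp [Matrix.det_succ_row_zero (n := 4), Fin.sum_univ_succ]
  simp [Matrix.det_succ_row_zero (n := 3), Fin.sum_univ_succ]
  simp [Matrix.det_fin_three, Fin.succAbove]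
  field_simp
  try ring

theorem Af_12 {F : Type} [Field F] (x y z : F) (hx : x ≠ 0) (hy : y ≠ 0) (hz : z ≠ 0) :
    DD (Af x y z) (ew {1, 2}) = - z / y := by
  rw [DD_ew]
  simp [Af, Matrix.det_succ_row_zero (n := 5), Fin.sum_univ_succ]
  simp [Matrix.det_succ_row_zero (n := 4), Fin.sum_univ_succ]
  simp [Matrix.det_succ_row_zero (n := 3), Fin.sum_univ_succ]
  simp [Matrix.det_fin_three, Fin.succAbove]
  field_simp
  try ring

theorem Af_0134 {F : Type} [Field F] (x y z : F) (hx : x ≠ 0) (hy : y ≠ 0) (hz : z ≠ 0) :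
    DD (Af x y z) (ew {0, 1, 3, 4}) = 0 := by
  rw [DD_ew]
  simp [Af, Matrix.det_succ_row_zero (n := 5), Fin.sum_univ_succ]
  simp [Matrix.det_succ_row_zero (n := 4), Fin.sum_univ_succ]
  simp [Matrix.det_succ_row_zero (n := 3), Fin.sum_univ_succ]
  simp [Matrix.det_fin_three, Fin.succAbove]
  field_simp
  try ring

theorem ML_smul {F : Type} [Field F] (M : MultilinearMap F (fun _ : Fin 6 => F × F) F)
    (c : Fin 6 → F) (v : Fin 6 → F × F) :
    M (fun i => c i • v i) = (∏ i, c i) * M v := by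
  rw [MultilinearMap.map_smul_univ, smul_eq_mul]

theorem transfer_lie {F : Type} [Field F]
    (Mf Mg : MultilinearMap F (fun _ : Fin 6 => F × F) F) (a b c e ε : Fin 6 → F) (κ : F)
    (hprop : ∀ w : Fin 6 → F × F, Mf w = κ * Mg (fun i => NN (a i) (b i) (c i) (e i) (w i)))
    (hΔ : ∀ i, a i * e i - b i * c i ≠ 0)
    (hg : ∀ w : Fin 6 → F × F, ∑ i, ε i * Mg (Function.update w i ((w i).1, -(w i).2)) = 0)
    (w : Fin 6 → F × F) :
    ∑ i, ε i * Mf (Function.update w i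
      ((a i * e i + b i * c i) / (a i * e i - b i * c i) * (w i).1
          + 2 * a i * c i / (a i * e i - b i * c i) * (w i).2,
        -2 * b i * e i / (a i * e i - b i * c i) * (w i).1
          - (a i * e i + b i * c i) / (a i * e i - b i * c i) * (w i).2)) = 0 := by
  have h1 := hg (fun i => NN (a i) (b i) (c i) (e i) (w i))
  rw [← mul_zero κ, ← h1, Finset.mul_sum]
  apply Finset.sum_congr rfl
  intro i _
  rw [hprop, mul_left_comm]
  congr 4
  funext k
  by_cases hk : k = i
  · subst hk
    have hD0 := hΔ k
    generalize hD : a k * e k - b k * c k = D at *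
    rw [Function.update_self, Function.update_self, NN_apply, NN_apply]
    ext
    · field_simp
      rw [← hD]; ring
    · field_simp
      rw [← hD]; ring
  · rw [Function.update_of_ne hk, Function.update_of_ne hk]

theorem alpha_rel {F : Type} [Field F] [Fintype F] {q : ℕ} (hq : 2 ≤ q)
    (hF : Fintype.card F = q ^ 6) (h2 : (2 : F) ≠ 0) (x y z : F) (hx : x ≠ 0) (hy : y ≠ 0)
    (hz : z ≠ 0) (Ag : Matrix (Fin 6) (Fin 6) F) (a b c e ε : Fin 6 → F) (κ : F)
    (hprop : ∀ w : Fin 6 → F × F,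
      DD (Af x y z) w = κ * DD Ag (fun i => NN (a i) (b i) (c i) (e i) (w i)))
    (hΔ : ∀ i, a i * e i - b i * c i ≠ 0)
    (hg : ∀ w : Fin 6 → F × F, ∑ i, ε i * DD Ag (Function.update w i ((w i).1, -(w i).2)) = 0)
    (α : Fin 6 → F) (hα : ∀ i, α i = (a i * e i + b i * c i) / (a i * e i - b i * c i)) :
    ε 0 * α 0 + ε 1 * α 1 = 0 ∧ ε 0 * α 0 + ε 2 * α 2 = 0 := by
  obtain ⟨S, hS, hSA⟩ := Af_even x y z hx hy hz
  have hev := even_of hq hF (Af x y z) S hS hSA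
  have hodd := odd_zero h2 (DD (Af x y z)) hev
  have hl := lie_even (DD (Af x y z)) hodd ε α (fun i => 2 * a i * c i / (a i * e i - b i * c i))
    (fun i => -2 * b i * e i / (a i * e i - b i * c i)) (by
      intro w
      simp only [hα]
      exact transfer_lie _ _ a b c e ε κ hprop hΔ hg w)
  have l0 := hl ∅ (by decide) (by rw [Af_empty]; exact one_ne_zero)
  have l1 := hl {0, 1} (by decide) (by
    rw [Af_01 x y z hx hy hz]; exact div_ne_zero (neg_ne_zero.mpr hy) hx)
  have l2 := hl {0, 2} (by decide) (by
    rw [Af_02 x y z hx hy hz]; exact div_ne_zero hz hx)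
  simp [Fin.sum_univ_succ] at l0 l1 l2
  constructor
  · apply (mul_eq_zero.mp (show (2 : F) * _ = 0 from ?_)).resolve_left h2
    linear_combination l0 - l1
  · apply (mul_eq_zero.mp (show (2 : F) * _ = 0 from ?_)).resolve_left h2
    linear_combination l0 - l2

/-- The case of `L^1` and `L^3`. -/
theorem case13 {F : Type} [Field F] [Fintype F] {q : ℕ} (hq : 2 ≤ q)
    (hF : Fintype.card F = q ^ 6) (h2 : (2 : F) ≠ 0) (φ : F →+* F)
    (x y z : F) (hx : x ≠ 0) (hy : y ≠ 0)
    (hz : z ≠ 0) (Ag : Matrix (Fin 6) (Fin 6) F) (A B C E κ : F)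
    (hprop : ∀ w : Fin 6 → F × F, DD (Af x y z) w = κ * DD Ag (fun i =>
      NN ((φ ^ (i : ℕ)) A) ((φ ^ (i : ℕ)) B) ((φ ^ (i : ℕ)) C) ((φ ^ (i : ℕ)) E) (w i)))
    (hΔ : A * E - B * C ≠ 0)
    (hAg : ∀ i j : Fin 6, Ag i j = 0 ∨ j = i + 1 ∨ j = i + 4) : False := by
  have hΔi : ∀ i : Fin 6, (φ ^ (i : ℕ)) A * (φ ^ (i : ℕ)) E - (φ ^ (i : ℕ)) B * (φ ^ (i : ℕ)) C
      ≠ 0 := by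
    intro i
    rw [← map_mul, ← map_mul, ← map_sub]
    exact (map_ne_zero _).mpr hΔ
  have hr := alpha_rel hq hF h2 x y z hx hy hz Ag _ _ _ _ ![1, -1, 0, 1, -1, 0] κ hprop hΔi
    (lie_g Ag _ ![0, -2, 0, 0, -2, 0] ![-1, -1, 0, -1, -1, 0]
      (by intro i; fin_cases i <;> norm_num)
      (by
        intro i j
        rcases hAg i j with h | h | h
        · exact Or.inl h
        · right; subst h; fin_cases i <;> simp <;> norm_num
        · right; subst h; fin_cases i <;> simp <;> norm_num)
      (by simp [Fin.sum_univ_succ]; norm_num))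
    _ (fun i => rfl)
  have h0 := hr.2
  simp [hΔ] at h0
  have hAE : A * E ≠ 0 := by
    intro h
    apply hΔ
    linear_combination 2 * h - h0
  have hA : A ≠ 0 := left_ne_zero_of_mul hAE
  have h0i : ∀ i : Fin 6, (φ ^ (i : ℕ)) A * (φ ^ (i : ℕ)) E + (φ ^ (i : ℕ)) B * (φ ^ (i : ℕ)) C
      = 0 := by
    intro i
    rw [← map_mul, ← map_mul, ← map_add, h0, map_zero]
  have hAi : ∀ i : Fin 6, (φ ^ (i : ℕ)) A ≠ 0 := fun i => (map_ne_zero _).mpr hA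
  have hsg := sign_g Ag ![-1, -1, 1, -1, -1, 1] ![1, -1, 1, 1, -1, 1]
    (by intro i; fin_cases i <;> norm_num)
    (by
      intro i j
      rcases hAg i j with h | h | h
      · exact Or.inl h
      · right; subst h; fin_cases i <;> simp
      · right; subst h; fin_cases i <;> simp)
  have e1 := hprop (ew ∅)
  rw [Af_empty, ← hsg] at e1
  have e2 := hprop (fun i => (if i ∈ ({0, 1, 3, 4} : Finset (Fin 6)) then
    - (φ ^ (i : ℕ)) B / (φ ^ (i : ℕ)) A else 1) • (ew {0, 1, 3, 4} : Fin 6 → F × F) i)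
  have e4 := ML_smul (DD (Af x y z))
    (fun i => if i ∈ ({0, 1, 3, 4} : Finset (Fin 6)) then
    - (φ ^ (i : ℕ)) B / (φ ^ (i : ℕ)) A else 1) (ew {0, 1, 3, 4})
  rw [Af_0134 x y z hx hy hz, mul_zero] at e4
  replace e2 := e4.symm.trans e2
  have e3 : (fun i : Fin 6 =>
      NN ((φ ^ (i : ℕ)) A) ((φ ^ (i : ℕ)) B) ((φ ^ (i : ℕ)) C) ((φ ^ (i : ℕ)) E)
      ((if i ∈ ({0, 1, 3, 4} : Finset (Fin 6)) then
    - (φ ^ (i : ℕ)) B / (φ ^ (i : ℕ)) A else 1) • (ew {0, 1, 3, 4} : Fin 6 → F × F) i))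
    = fun i : Fin 6 => ((NN ((φ ^ (i : ℕ)) A) ((φ ^ (i : ℕ)) B) ((φ ^ (i : ℕ)) C) ((φ ^ (i : ℕ)) E)
        ((ew ∅ : Fin 6 → F × F) i)).1, (![-1, -1, 1, -1, -1, 1] : Fin 6 → F) i *
        (NN ((φ ^ (i : ℕ)) A) ((φ ^ (i : ℕ)) B) ((φ ^ (i : ℕ)) C) ((φ ^ (i : ℕ)) E)
        ((ew ∅ : Fin 6 → F × F) i)).2) := by
    funext i
    have ha := hAi i
    have hb := h0i i
    generalize (φ ^ (i : ℕ)) A = a at *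
    generalize (φ ^ (i : ℕ)) B = b at *
    generalize (φ ^ (i : ℕ)) C = c at *
    generalize (φ ^ (i : ℕ)) E = e at *
    have he : c * (-b / a) = e := by
      field_simp
      linear_combination -hb
    by_cases hi : i ∈ ({0, 1, 3, 4} : Finset (Fin 6))
    · have hη : (![-1, -1, 1, -1, -1, 1] : Fin 6 → F) i = -1 := by
        fin_cases i <;> simp at hi ⊢
      rw [hη]
      simp [NN_apply, ew, hi, he]
      field_simp
    · have hη : (![-1, -1, 1, -1, -1, 1] : Fin 6 → F) i = 1 := by
        fin_cases i <;> simp at hi ⊢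
      rw [hη]
      simp [NN_apply, ew, hi]
  rw [e3] at e2
  exact one_ne_zero (e1.trans e2.symm)

/-- Common part of the cases `L^2` and `L^4`. -/
theorem case24 {F : Type} [Field F] [Fintype F] {q : ℕ} (hq : 2 ≤ q)
    (hF : Fintype.card F = q ^ 6) (h2 : (2 : F) ≠ 0) (φ : F →+* F)
    (x y z : F) (hx : x ≠ 0) (hy : y ≠ 0)
    (hz : z ≠ 0) (Ag : Matrix (Fin 6) (Fin 6) F) (A B C E κ : F)
    (hprop : ∀ w : Fin 6 → F × F, DD (Af x y z) w = κ * DD Ag (fun i =>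
      NN ((φ ^ (i : ℕ)) A) ((φ ^ (i : ℕ)) B) ((φ ^ (i : ℕ)) C) ((φ ^ (i : ℕ)) E) (w i)))
    (hΔ : A * E - B * C ≠ 0)
    (hAg : ∀ i j : Fin 6, Ag i j = 0 ∨ j = i + 1 ∨ j = i + 3 ∨ j = i + 5) :
    ∃ r : F, r ≠ 0 ∧ C = - A * r ∧ E = B * r ∧ A ≠ 0 ∧ B ≠ 0 ∧ ∀ u : Fin 6 → F × F,
      DD Ag (fun i => ((φ ^ (i : ℕ)) r * (u i).2, ((φ ^ (i : ℕ)) r)⁻¹ * (u i).1)) = DD Ag u := by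
  have hΔi : ∀ i : Fin 6, (φ ^ (i : ℕ)) A * (φ ^ (i : ℕ)) E - (φ ^ (i : ℕ)) B * (φ ^ (i : ℕ)) C
      ≠ 0 := by
    intro i
    rw [← map_mul, ← map_mul, ← map_sub]
    exact (map_ne_zero _).mpr hΔ
  have hr := alpha_rel hq hF h2 x y z hx hy hz Ag _ _ _ _ ![1, -1, 1, -1, 1, -1] κ hprop hΔi
    (lie_g Ag _ ![1, -1, 1, -1, 1, -1] ![0, 0, 0, 0, 0, 0]
      (by intro i; fin_cases i <;> norm_num)
      (by
        intro i j
        rcases hAg i j with h | h | h | h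
        · exact Or.inl h
        · right; subst h; fin_cases i <;> simp
        · right; subst h; fin_cases i <;> simp
        · right; subst h; fin_cases i <;> simp)
      (by simp [Fin.sum_univ_succ]))
    (fun i => (φ ^ (i : ℕ)) ((A * E + B * C) / (A * E - B * C)))
    (fun i => by simp only [map_div₀, map_add, map_sub, map_mul])
  have h0 : A * E + B * C = 0 := by
    set α := (A * E + B * C) / (A * E - B * C) with hα
    have r1 : α + -φ α = 0 := by simpa using hr.1
    have r2 : α + (φ ^ 2) α = 0 := by simpa using hr.2
    have r3 : φ α = α := by linear_combination -r1
    have r4 : (φ ^ 2) α = α := by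
      rw [pow_two, RingHom.mul_def, RingHom.comp_apply, r3, r3]
    rw [r4] at r2
    have r5 : α = 0 := by
      apply (mul_eq_zero.mp (show (2 : F) * _ = 0 from ?_)).resolve_left h2
      linear_combination r2
    rw [hα, div_eq_zero_iff] at r5
    exact r5.resolve_right hΔ
  have hAE : A * E ≠ 0 := by
    intro h
    apply hΔ
    linear_combination 2 * h - h0
  have hA : A ≠ 0 := left_ne_zero_of_mul hAE
  have hE : E ≠ 0 := right_ne_zero_of_mul hAE
  have hB : B ≠ 0 := by
    intro h
    apply hAE
    rw [h] at h0
    linear_combination h0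
  have hEr : E = B * (E / B) := by field_simp
  have hCr : C = - A * (E / B) := by
    field_simp
    linear_combination h0
  obtain ⟨r, hr0⟩ : ∃ r, r = E / B := ⟨_, rfl⟩
  rw [← hr0] at hEr hCr
  have hrn : r ≠ 0 := by rw [hr0]; exact div_ne_zero hE hB
  refine ⟨r, hrn, hCr, hEr, hA, hB, ?_⟩
  obtain ⟨S, hS, hSA⟩ := Af_even x y z hx hy hz
  have hev := even_of hq hF (Af x y z) S hS hSA
  have hκ : κ ≠ 0 := by
    intro h
    have := hprop (ew ∅)
    rw [Af_empty, h, zero_mul] at this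
    exact one_ne_zero this
  intro u
  have e1 := hev (fun i => ((2 * (φ ^ (i : ℕ)) B * (φ ^ (i : ℕ)) r)⁻¹ *
      ((u i).1 + (φ ^ (i : ℕ)) r * (u i).2),
    (2 * (φ ^ (i : ℕ)) A * (φ ^ (i : ℕ)) r)⁻¹ * (- (u i).1 + (φ ^ (i : ℕ)) r * (u i).2)))
  rw [hprop, hprop] at e1
  have e2 := mul_left_cancel₀ hκ e1
  have hri : ∀ i : Fin 6, (φ ^ (i : ℕ)) r ≠ 0 := fun i => (map_ne_zero _).mpr hrn
  have hAi : ∀ i : Fin 6, (φ ^ (i : ℕ)) A ≠ 0 := fun i => (map_ne_zero _).mpr hA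
  have hBi : ∀ i : Fin 6, (φ ^ (i : ℕ)) B ≠ 0 := fun i => (map_ne_zero _).mpr hB
  have hCi : ∀ i : Fin 6, (φ ^ (i : ℕ)) C = - (φ ^ (i : ℕ)) A * (φ ^ (i : ℕ)) r := by
    intro i
    rw [hCr, map_mul, map_neg]
  have hEi : ∀ i : Fin 6, (φ ^ (i : ℕ)) E = (φ ^ (i : ℕ)) B * (φ ^ (i : ℕ)) r := by
    intro i
    rw [hEr, map_mul]
  convert e2 using 2
  · funext i
    have a1 := hri i
    have a2 := hAi i
    have a3 := hBi i
    rw [NN_apply, hCi, hEi]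
    ext
    · simp only
      field_simp
      ring
    · simp only
      field_simp
      ring
  · funext i
    have a1 := hri i
    have a2 := hAi i
    have a3 := hBi i
    rw [NN_apply, hCi, hEi]
    ext
    · simp only
      field_simp
      ring
    · simp only
      field_simp
      ring

theorem R_ew {F : Type} [Field F] (M : MultilinearMap F (fun _ : Fin 6 => F × F) F) (r : Fin 6 → F)
    (hM : ∀ u : Fin 6 → F × F, M (fun i => (r i * (u i).2, (r i)⁻¹ * (u i).1)) = M u)
    (J : Finset (Fin 6)) :
    M (ew J) = (∏ i, if i ∈ J then r i else (r i)⁻¹) * M (ew Jᶜ) := by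
  rw [← hM, ← ML_smul]
  congr 1
  funext i
  by_cases hi : i ∈ J <;> simp [ew, hi]

/-- The Dickson matrix for `L^2`. -/
theorem dick_2 {F : Type} [Field F] (φ : F →+* F) (δ : F) :
    dick φ ![0, δ, 0, 0, 0, 1] = !![0, δ, 0, 0, 0, 1;
      1, 0, φ δ, 0, 0, 0;
      0, 1, 0, φ (φ δ), 0, 0;
      0, 0, 1, 0, φ (φ (φ δ)), 0;
      0, 0, 0, 1, 0, φ (φ (φ (φ δ)));
      φ (φ (φ (φ (φ δ)))), 0, 0, 0, 1, 0] := by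
  rw [dick_eq]
  ext i j
  fin_cases i <;> fin_cases j <;> simp

/-- The Dickson matrix for `L^4`. -/
def A4 {F : Type} [Field F] (δ d : F) : Matrix (Fin 6) (Fin 6) F :=
  !![0, 1, 0, 1, 0, δ; d, 0, 1, 0, 1, 0; 0, δ, 0, 1, 0, 1;
    1, 0, d, 0, 1, 0; 0, 1, 0, δ, 0, 1; 1, 0, 1, 0, d, 0]

theorem dick_4 {F : Type} [Field F] (φ : F →+* F) (δ : F) (hδ : φ (φ δ) = δ) :
    dick φ ![0, 1, 0, 1, 0, δ] = A4 δ (φ δ) := by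
  rw [dick_eq, A4]
  ext i j
  fin_cases i <;> fin_cases j <;> simp [hδ]

theorem c2_03 {F : Type} [Field F] (a b c d e f : F) :
    DD (!![0, a, 0, 0, 0, 1; 1, 0, b, 0, 0, 0; 0, 1, 0, c, 0, 0;
      0, 0, 1, 0, d, 0; 0, 0, 0, 1, 0, e; f, 0, 0, 0, 1, 0]) (ew {0, 3}) = 0 := by
  rw [DD_ew]
  simp [Matrix.det_succ_row_zero (n := 5), Fin.sum_univ_succ]
  simp [Matrix.det_succ_row_zero (n := 4), Fin.sum_univ_succ]
  simp [Matrix.det_succ_row_zero (n := 3), Fin.sum_univ_succ]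
  simp [Matrix.det_fin_three, Fin.succAbove]

theorem c2_1245 {F : Type} [Field F] (a b c d e f : F) :
    DD (!![0, a, 0, 0, 0, 1; 1, 0, b, 0, 0, 0; 0, 1, 0, c, 0, 0;
      0, 0, 1, 0, d, 0; 0, 0, 0, 1, 0, e; f, 0, 0, 0, 1, 0]) (ew {1, 2, 4, 5}) = b * e := by
  rw [DD_ew]
  simp [Matrix.det_succ_row_zero (n := 5), Fin.sum_univ_succ]
  simp [Matrix.det_succ_row_zero (n := 4), Fin.sum_univ_succ]
  simp [Matrix.det_succ_row_zero (n := 3), Fin.sum_univ_succ]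
  simp [Matrix.det_fin_three, Fin.succAbove]

theorem c4_01 {F : Type} [Field F] (δ d : F) :
    DD (A4 δ d) (ew {0, 1}) = - d := by
  rw [DD_ew]
  simp [A4, Matrix.det_succ_row_zero (n := 5), Fin.sum_univ_succ]
  simp [Matrix.det_succ_row_zero (n := 4), Fin.sum_univ_succ]
  simp [Matrix.det_succ_row_zero (n := 3), Fin.sum_univ_succ]
  simp [Matrix.det_fin_three, Fin.succAbove]
  try ring

theorem c4_23 {F : Type} [Field F] (δ d : F) :
    DD (A4 δ d) (ew {2, 3}) = - d := by
  rw [DD_ew]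
  simp [A4, Matrix.det_succ_row_zero (n := 5), Fin.sum_univ_succ]
  simp [Matrix.det_succ_row_zero (n := 4), Fin.sum_univ_succ]
  simp [Matrix.det_succ_row_zero (n := 3), Fin.sum_univ_succ]
  simp [Matrix.det_fin_three, Fin.succAbove]
  try ring

theorem c4_45 {F : Type} [Field F] (δ d : F) :
    DD (A4 δ d) (ew {4, 5}) = - d := by
  rw [DD_ew]
  simp [A4, Matrix.det_succ_row_zero (n := 5), Fin.sum_univ_succ]
  simp [Matrix.det_succ_row_zero (n := 4), Fin.sum_univ_succ]
  simp [Matrix.det_succ_row_zero (n := 3), Fin.sum_univ_succ]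
  simp [Matrix.det_fin_three, Fin.succAbove]
  try ring

theorem c4_0123 {F : Type} [Field F] (δ d : F) :
    DD (A4 δ d) (ew {0, 1, 2, 3}) = -(1 - δ) * (1 - d ^ 2) := by
  rw [DD_ew]
  simp [A4, Matrix.det_succ_row_zero (n := 5), Fin.sum_univ_succ]
  simp [Matrix.det_succ_row_zero (n := 4), Fin.sum_univ_succ]
  simp [Matrix.det_succ_row_zero (n := 3), Fin.sum_univ_succ]
  simp [Matrix.det_fin_three, Fin.succAbove]
  try ring

theorem c4_2345 {F : Type} [Field F] (δ d : F) :
    DD (A4 δ d) (ew {2, 3, 4, 5}) = -(1 - δ) * (1 - d ^ 2) := by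
  rw [DD_ew]
  simp [A4, Matrix.det_succ_row_zero (n := 5), Fin.sum_univ_succ]
  simp [Matrix.det_succ_row_zero (n := 4), Fin.sum_univ_succ]
  simp [Matrix.det_succ_row_zero (n := 3), Fin.sum_univ_succ]
  simp [Matrix.det_fin_three, Fin.succAbove]
  try ring

theorem c4_0145 {F : Type} [Field F] (δ d : F) :
    DD (A4 δ d) (ew {0, 1, 4, 5}) = -(1 - δ) * (1 - d ^ 2) := by
  rw [DD_ew]
  simp [A4, Matrix.det_succ_row_zero (n := 5), Fin.sum_univ_succ]
  simp [Matrix.det_succ_row_zero (n := 4), Fin.sum_univ_succ]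
  simp [Matrix.det_succ_row_zero (n := 3), Fin.sum_univ_succ]
  simp [Matrix.det_fin_three, Fin.succAbove]
  try ring

theorem c4_full {F : Type} [Field F] (δ d : F) :
    DD (A4 δ d) (ew {0, 1, 2, 3, 4, 5}) = -((δ - 1) ^ 2 * (δ + 2)) * ((d - 1) ^ 2 * (d + 2)) := by
  rw [DD_ew]
  simp [A4, Matrix.det_succ_row_zero (n := 5), Fin.sum_univ_succ]
  simp [Matrix.det_succ_row_zero (n := 4), Fin.sum_univ_succ]
  simp [Matrix.det_succ_row_zero (n := 3), Fin.sum_univ_succ]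
  simp [Matrix.det_fin_three, Fin.succAbove]
  try ring

theorem P4_01 {F : Type} [Field F] (r : F) (hr : r ≠ 0) :
    DD (A4 2 2) (fun i => (![r, -r⁻¹, r, -r⁻¹, r, -r⁻¹] i,
      if i ∈ ({0, 1} : Finset (Fin 6)) then -1 else 1)) = - 13 := by
  rw [DD_apply]
  simp [A4, Matrix.one_apply, Matrix.det_succ_row_zero (n := 5), Fin.sum_univ_succ]
  simp [Matrix.det_succ_row_zero (n := 4), Fin.sum_univ_succ]
  simp [Matrix.det_succ_row_zero (n := 3), Fin.sum_univ_succ]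
  simp [Matrix.det_fin_three, Fin.succAbove]
  field_simp
  ring

theorem P4_12 {F : Type} [Field F] (r : F) (hr : r ≠ 0) :
    DD (A4 2 2) (fun i => (![r, -r⁻¹, r, -r⁻¹, r, -r⁻¹] i,
      if i ∈ ({1, 2} : Finset (Fin 6)) then -1 else 1)) = - 13 := by
  rw [DD_apply]
  simp [A4, Matrix.one_apply, Matrix.det_succ_row_zero (n := 5), Fin.sum_univ_succ]
  simp [Matrix.det_succ_row_zero (n := 4), Fin.sum_univ_succ]
  simp [Matrix.det_succ_row_zero (n := 3), Fin.sum_univ_succ]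
  simp [Matrix.det_fin_three, Fin.succAbove]
  field_simp
  ring

theorem P4_24 {F : Type} [Field F] (r : F) (hr : r ≠ 0) :
    DD (A4 2 2) (fun i => (![r, -r⁻¹, r, -r⁻¹, r, -r⁻¹] i,
      if i ∈ ({2, 4} : Finset (Fin 6)) then -1 else 1)) = - 17 := by
  rw [DD_apply]
  simp [A4, Matrix.one_apply, Matrix.det_succ_row_zero (n := 5), Fin.sum_univ_succ]
  simp [Matrix.det_succ_row_zero (n := 4), Fin.sum_univ_succ]
  simp [Matrix.det_succ_row_zero (n := 3), Fin.sum_univ_succ]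
  simp [Matrix.det_fin_three, Fin.succAbove]
  field_simp
  ring

theorem P4_04 {F : Type} [Field F] (r : F) (hr : r ≠ 0) :
    DD (A4 2 2) (fun i => (![r, -r⁻¹, r, -r⁻¹, r, -r⁻¹] i,
      if i ∈ ({0, 4} : Finset (Fin 6)) then -1 else 1)) = - 17 := by
  rw [DD_apply]
  simp [A4, Matrix.one_apply, Matrix.det_succ_row_zero (n := 5), Fin.sum_univ_succ]
  simp [Matrix.det_succ_row_zero (n := 4), Fin.sum_univ_succ]
  simp [Matrix.det_succ_row_zero (n := 3), Fin.sum_univ_succ]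
  simp [Matrix.det_fin_three, Fin.succAbove]
  field_simp
  ring

/-- The case of `L^2`. -/
theorem case2 {F : Type} [Field F] [Fintype F] {q : ℕ} (hq : 2 ≤ q)
    (hF : Fintype.card F = q ^ 6) (h2 : (2 : F) ≠ 0) (φ : F →+* F)
    (x y z : F) (hx : x ≠ 0) (hy : y ≠ 0)
    (hz : z ≠ 0) (δ : F) (hδ : δ ≠ 0) (A B C E κ : F)
    (hprop : ∀ w : Fin 6 → F × F, DD (Af x y z) w = κ * DD (dick φ ![0, δ, 0, 0, 0, 1]) (fun i =>
      NN ((φ ^ (i : ℕ)) A) ((φ ^ (i : ℕ)) B) ((φ ^ (i : ℕ)) C) ((φ ^ (i : ℕ)) E) (w i)))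
    (hΔ : A * E - B * C ≠ 0) : False := by
  obtain ⟨r, hr, -, -, -, -, hR⟩ := case24 hq hF h2 φ x y z hx hy hz _ A B C E κ hprop hΔ (by
    rw [dick_2]
    intro i j
    fin_cases i <;> fin_cases j <;> first | (left; rfl) | (right; decide))
  have h1 := R_ew (DD (dick φ ![0, δ, 0, 0, 0, 1])) (fun i => (φ ^ (i : ℕ)) r) hR {0, 3}
  have hc : ({0, 3} : Finset (Fin 6))ᶜ = {1, 2, 4, 5} := by decide
  rw [hc, dick_2, c2_03, c2_1245] at h1
  have hri : ∀ i : Fin 6, (φ ^ (i : ℕ)) r ≠ 0 := fun i => (map_ne_zero _).mpr hr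
  have hne : (∏ i : Fin 6, if i ∈ ({0, 3} : Finset (Fin 6)) then (φ ^ (i : ℕ)) r
      else ((φ ^ (i : ℕ)) r)⁻¹) ≠ 0 := by
    apply Finset.prod_ne_zero_iff.mpr
    intro i _
    split_ifs
    · exact hri i
    · exact inv_ne_zero (hri i)
  have hd : φ δ * φ (φ (φ (φ δ))) ≠ 0 := by
    simp only [ne_eq, mul_eq_zero, map_eq_zero, hδ, or_self, not_false_eq_true]
  exact mul_ne_zero hne hd h1.symm

/-- First part of the case `L^4`. -/
theorem case4a {F : Type} [Field F] (h2 : (2 : F) ≠ 0) (δ d : F) (hδ : δ ^ 2 + δ = 1)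
    (hd : d ^ 2 + d = 1) (r : Fin 6 → F) (hr : ∀ i, r i ≠ 0)
    (hR : ∀ u : Fin 6 → F × F,
      DD (A4 δ d) (fun i => (r i * (u i).2, (r i)⁻¹ * (u i).1)) = DD (A4 δ d) u) :
    (5 : F) = 0 ∧ δ = 2 ∧ d = 2 ∧ r 0 * r 1 * r 2 * r 3 * r 4 * r 5 = -1 ∧
      (r 0 * r 1) ^ 2 = 1 := by
  have k0 := R_ew (DD (A4 δ d)) r hR ∅
  have k1 := R_ew (DD (A4 δ d)) r hR {0, 1}
  have k2 := R_ew (DD (A4 δ d)) r hR {2, 3}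
  have k3 := R_ew (DD (A4 δ d)) r hR {4, 5}
  have hc0 : (∅ : Finset (Fin 6))ᶜ = {0, 1, 2, 3, 4, 5} := by decide
  have hc1 : ({0, 1} : Finset (Fin 6))ᶜ = {2, 3, 4, 5} := by decide
  have hc2 : ({2, 3} : Finset (Fin 6))ᶜ = {0, 1, 4, 5} := by decide
  have hc3 : ({4, 5} : Finset (Fin 6))ᶜ = {0, 1, 2, 3} := by decide
  have hd' : 1 - d ^ 2 = d := by linear_combination -hd
  have f1 : (δ - 1) ^ 2 * (δ + 2) = 1 - δ := by linear_combination (δ - 1) * hδ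
  have f2 : (d - 1) ^ 2 * (d + 2) = 1 - d := by linear_combination (d - 1) * hd
  rw [hc0, Af_empty, c4_full, f1, f2] at k0
  rw [hc1, c4_01, c4_2345, hd'] at k1
  rw [hc2, c4_23, c4_0145, hd'] at k2
  rw [hc3, c4_45, c4_0123, hd'] at k3
  have g0 := hr 0
  have g1 := hr 1
  have g2 := hr 2
  have g3 := hr 3
  have g4 := hr 4
  have g5 := hr 5
  have hd0 : d ≠ 0 := by
    rintro rfl
    simp at hd
  simp only [Fin.prod_univ_six] at k0 k1 k2 k3
  simp at k0 k1 k2 k3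
  generalize r 0 = r0 at *
  generalize r 1 = r1 at *
  generalize r 2 = r2 at *
  generalize r 3 = r3 at *
  generalize r 4 = r4 at *
  generalize r 5 = r5 at *
  field_simp at k0 k1 k2 k3
  have hδ1 : δ - 1 ≠ 0 := by
    intro h
    have h' : δ = 1 := by linear_combination h
    rw [h'] at hδ
    exact one_ne_zero (show (1 : F) = 0 by linear_combination hδ)
  have hp0 : r0 * r1 * r2 * r3 * r4 * r5 ≠ 0 :=
    mul_ne_zero (mul_ne_zero (mul_ne_zero (mul_ne_zero (mul_ne_zero g0 g1) g2) g3) g4) g5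
  have hp1 : r0 * r1 * r2 * r3 * r4 * r5 * (r0 * r1 * r2 * r3 * r4 * r5)
      = r0 * r1 * r2 * r3 * r4 * r5 * (-(δ - 1) ^ 3) := by
    have := congrArg₂ (· * ·) (congrArg₂ (· * ·) k1 k2) k3
    linear_combination -this
  have hp := mul_left_cancel₀ hp0 hp1
  have hdd : 1 - d = -(δ - 1) ^ 2 := by
    apply mul_left_cancel₀ hδ1
    linear_combination hp - k0
  have hd3 : d = 3 - 3 * δ := by linear_combination -hdd + hδ
  have h10 : (2 : F) * 5 * (2 - 3 * δ) = 0 := by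
    rw [hd3] at hd
    linear_combination hd - 9 * hδ
  have h5 : (5 : F) = 0 := by
    rcases mul_eq_zero.mp h10 with h | h
    · exact (mul_eq_zero.mp h).resolve_left h2
    · exfalso
      apply one_ne_zero (α := F)
      linear_combination 9 * hδ + (3 * δ + 5) * h
  have hδ2 : δ = 2 := by
    have : (δ - 2) ^ 2 = 0 := by linear_combination hδ + (1 - δ) * h5
    have := pow_eq_zero_iff (two_ne_zero) |>.mp this
    linear_combination this
  have hd2 : d = 2 := by rw [hd3, hδ2]; linear_combination -h5
  have hpm : r0 * r1 * r2 * r3 * r4 * r5 = -1 := by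
    rw [k0, hδ2, hd2]; ring
  refine ⟨h5, hδ2, hd2, hpm, ?_⟩
  rw [hδ2] at k1
  linear_combination (-(r0 * r1)) * k1 - hpm

/-- Last part of the case `L^4`. -/
theorem case4b {F : Type} [Field F] (x y z : F)
    (hx : x ≠ 0) (hy : y ≠ 0) (hz : z ≠ 0) (a b rr : Fin 6 → F) (r κ : F) (hr : r ≠ 0)
    (hrr : rr = ![r, -r⁻¹, r, -r⁻¹, r, -r⁻¹])
    (hprop : ∀ w : Fin 6 → F × F, DD (Af x y z) w = κ * DD (A4 2 2) (fun i =>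
      NN (a i) (b i) (-a i * rr i) (b i * rr i) (w i))) :
    (x * z) ^ 2 = 1 := by
  have key : ∀ J : Finset (Fin 6), DD (Af x y z) (ew J) =
      κ * ((∏ i, if i ∈ J then - a i else b i) *
        DD (A4 2 2) (fun i => (rr i, if i ∈ J then -1 else 1))) := by
    intro J
    rw [hprop, ← ML_smul]
    congr 3
    funext i
    by_cases hi : i ∈ J <;> simp [ew, hi, NN_apply]
  subst hrr
  have k1 := key {0, 1}
  have k2 := key {2, 4}
  have k3 := key {0, 4}
  have k4 := key {1, 2}
  rw [Af_01 x y z hx hy hz, P4_01 r hr] at k1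
  rw [Af_24 x y z hx hy hz, P4_24 r hr] at k2
  rw [Af_04 x y z hx hy hz, P4_04 r hr] at k3
  rw [Af_12 x y z hx hy hz, P4_12 r hr] at k4
  simp only [Fin.prod_univ_six] at k1 k2 k3 k4
  simp at k1 k2 k3 k4
  have e : (-y / x) * (-1 / (y * z)) = (-(x * y)) * (- z / y) := by
    rw [k1, k2, k3, k4]; ring
  field_simp at e
  linear_combination -e

/-- The case of `L^4`. -/
theorem case4 {F : Type} [Field F] [Fintype F] {q : ℕ} (hq : 2 ≤ q)
    (hF : Fintype.card F = q ^ 6) (h2 : (2 : F) ≠ 0) (φ : F →+* F)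
    (h : F) (h0 : h ≠ 0) (h3 : φ (φ (φ h)) = - h⁻¹)
    (δ : F) (hδ : δ ^ 2 + δ = 1) (A B C E κ : F)
    (hprop : ∀ w : Fin 6 → F × F,
      DD (Af h (φ h) (φ (φ h))) w = κ * DD (dick φ ![0, 1, 0, 1, 0, δ]) (fun i =>
      NN ((φ ^ (i : ℕ)) A) ((φ ^ (i : ℕ)) B) ((φ ^ (i : ℕ)) C) ((φ ^ (i : ℕ)) E) (w i)))
    (hΔ : A * E - B * C ≠ 0) : (5 : F) = 0 ∧ φ h = h := by
  have hy : φ h ≠ 0 := (map_ne_zero φ).mpr h0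
  have hz : φ (φ h) ≠ 0 := (map_ne_zero φ).mpr hy
  have hd : (φ δ) ^ 2 + φ δ = 1 := by
    have := congrArg φ hδ
    simpa using this
  have hδδ : φ (φ δ) = δ := by
    have h1 : (φ δ - δ) * (φ δ + 1 + δ) = 0 := by linear_combination hd - hδ
    rcases mul_eq_zero.mp h1 with h | h
    · have : φ δ = δ := by linear_combination h
      rw [this, this]
    · have : φ δ = -1 - δ := by linear_combination h
      rw [this, map_sub, map_neg, map_one, this]
      ring
  rw [dick_4 φ δ hδδ] at hprop
  obtain ⟨r, hr, hC, hE, -, -, hR⟩ := case24 hq hF h2 φ _ _ _ h0 hy hz _ A B C E κ hprop hΔ (by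
    intro i j
    fin_cases i <;> fin_cases j <;> first | (left; rfl) | (right; decide))
  obtain ⟨h5, hδ2, hd2, hpr, hrr⟩ := case4a h2 δ (φ δ) hδ hd (fun i => (φ ^ (i : ℕ)) r)
    (fun i => (map_ne_zero _).mpr hr) hR
  refine ⟨h5, ?_⟩
  have p0 : (φ ^ ((0 : Fin 6) : ℕ)) r = r := rfl
  have p1 : (φ ^ ((1 : Fin 6) : ℕ)) r = φ r := rfl
  have p2 : (φ ^ ((2 : Fin 6) : ℕ)) r = φ (φ r) := rfl
  have p3 : (φ ^ ((3 : Fin 6) : ℕ)) r = φ (φ (φ r)) := rfl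
  have p4 : (φ ^ ((4 : Fin 6) : ℕ)) r = φ (φ (φ (φ r))) := rfl
  have p5 : (φ ^ ((5 : Fin 6) : ℕ)) r = φ (φ (φ (φ (φ r)))) := rfl
  rw [p0, p1, p2, p3, p4, p5] at hpr
  rw [p0, p1] at hrr
  have hrφ : r * φ r = -1 := by
    rcases mul_self_eq_one_iff.mp ((sq _).symm.trans hrr) with h | h
    · exfalso
      have q1 := congrArg φ (congrArg φ h)
      have q2 := congrArg φ (congrArg φ q1)
      simp only [map_mul, map_one] at q1 q2
      apply h2
      linear_combination hpr - (φ (φ r) * φ (φ (φ r)) * φ (φ (φ (φ r))) * φ (φ (φ (φ (φ r))))) * h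
        - (φ (φ (φ (φ r))) * φ (φ (φ (φ (φ r))))) * q1 - q2
    · exact h
  have hr1 : φ r = - r⁻¹ := by
    field_simp
    linear_combination hrφ
  have hr2 : φ (- r⁻¹) = r := by
    rw [map_neg, map_inv₀, hr1]
    simp
  have hrf : (fun i : Fin 6 => (φ ^ (i : ℕ)) r) = ![r, -r⁻¹, r, -r⁻¹, r, -r⁻¹] := by
    funext i
    fin_cases i
    · rfl
    · exact hr1
    · change φ (φ r) = r
      rw [hr1, hr2]
    · change φ (φ (φ r)) = -r⁻¹
      rw [hr1, hr2, hr1]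
    · change φ (φ (φ (φ r))) = r
      rw [hr1, hr2, hr1, hr2]
    · change φ (φ (φ (φ (φ r)))) = -r⁻¹
      rw [hr1, hr2, hr1, hr2, hr1]
  have hsq := case4b h (φ h) (φ (φ h)) h0 hy hz (fun i => (φ ^ (i : ℕ)) A)
    (fun i => (φ ^ (i : ℕ)) B) (fun i => (φ ^ (i : ℕ)) r) r κ hr hrf (by
      intro w
      rw [hprop w, hδ2, hE, hC, map_ofNat]
      simp only [map_mul, map_neg])
  have hsq2 := congrArg φ hsq
  rw [map_pow, map_mul, map_one, h3] at hsq2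
  have hq1 : (φ h - h) * (φ h + h) = 0 := by
    field_simp at hsq2
    linear_combination hsq2
  rcases mul_eq_zero.mp hq1 with h' | h'
  · linear_combination h'
  · have n1 : φ h = -h := by linear_combination h'
    rw [n1, map_neg, n1, neg_neg, n1] at h3
    have n2 : (h - 1) * (h + 1) = 0 := by
      field_simp at h3
      linear_combination -h3
    rcases mul_eq_zero.mp n2 with n | n
    · have : h = 1 := by linear_combination n
      rw [this, map_one]
    · have : h = -1 := by linear_combination n
      rw [this, map_neg, map_one]

/-- Let `q = p^s` be an odd prime power, `F` a finite field with `q^6`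
elements, and `h ∈ F` with `h^(q^3+1) = −1`, and assume it is not the case that both
`h^q = h` and `p = 5`. Then `𝓛_h` is not PΓL-equivalent to any previously known maximum
scattered linear set of `PG(1,q^6)`: not to `L^1`, nor to `L^2_δ` for any `δ` with
`δ^((q^6−1)/(q−1)) ∉ {0,1}`, nor to `L^3_δ` for any `δ` with `δ^(q^3+1) ∉ {0,1}`,
nor to `L^4_δ` for any `δ` with `δ^2 + δ = 1`. -/
theorem stmt16 (p s q : ℕ) (hp : p.Prime) (hs : 0 < s) (hqps : q = p ^ s) (hodd : Odd q)
    (F : Type) [Field F] [Fintype F] (hF : Fintype.card F = q ^ 6)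
    (h : F) (hh : h ^ (q ^ 3 + 1) = -1)
    (hexc : ¬ (h ^ q = h ∧ p = 5)) :
    (¬ IsPGammaLEquiv (linearSet (fpol q h)) (linearSet (fun x : F => x ^ q))) ∧
    (∀ δ : F, δ ^ ((q ^ 6 - 1) / (q - 1)) ≠ 0 → δ ^ ((q ^ 6 - 1) / (q - 1)) ≠ 1 →
      ¬ IsPGammaLEquiv (linearSet (fpol q h))
          (linearSet (fun x : F => δ * x ^ q + x ^ (q ^ 5)))) ∧
    (∀ δ : F, δ ^ (q ^ 3 + 1) ≠ 0 → δ ^ (q ^ 3 + 1) ≠ 1 →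
      ¬ IsPGammaLEquiv (linearSet (fpol q h))
          (linearSet (fun x : F => x ^ q + δ * x ^ (q ^ 4)))) ∧
    (∀ δ : F, δ ^ 2 + δ = 1 →
      ¬ IsPGammaLEquiv (linearSet (fpol q h))
          (linearSet (fun x : F => x ^ q + x ^ (q ^ 3) + δ * x ^ (q ^ 5)))) := by
  have hq3 : 3 ≤ q := by
    have h1 : 1 < q := by rw [hqps]; exact Nat.one_lt_pow hs.ne' hp.one_lt
    obtain ⟨k, hk⟩ := hodd
    omega
  have hq : 2 ≤ q := by omega
  haveI : Fact p.Prime := ⟨hp⟩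
  have hcard : Fintype.card F = p ^ (s * 6) := by rw [hF, hqps, pow_mul]
  haveI : CharP F p := charP_of_card_eq_prime_pow hcard
  have hp2 : p ≠ 2 := by
    rintro rfl
    rw [hqps, Nat.odd_pow_iff hs.ne'] at hodd
    exact absurd hodd (by decide)
  have h2 : (2 : F) ≠ 0 := by
    intro h0
    have h1 : ((2 : ℕ) : F) = 0 := by exact_mod_cast h0
    rw [CharP.cast_eq_zero_iff F p, Nat.prime_dvd_prime_iff_eq hp Nat.prime_two] at h1
    exact hp2 h1
  obtain ⟨φ, hφ1⟩ : ∃ φ : F →+* F, ∀ x, φ x = x ^ q :=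
    ⟨iterateFrobenius F p s, fun x => by rw [iterateFrobenius_def, hqps]⟩
  have hφ : ∀ (i : ℕ) (x : F), (φ ^ i) x = x ^ (q ^ i) := by
    intro i
    induction i with
    | zero => intro x; simp
    | succ n ih =>
      intro x
      rw [pow_succ, RingHom.mul_def, RingHom.comp_apply, ih, hφ1, ← pow_mul, ← pow_succ']
  have h6 : φ ^ 6 = 1 := by
    ext x
    rw [hφ, ← hF, FiniteField.pow_card]
    rfl
  have h0 : h ≠ 0 := by
    rintro rfl
    rw [zero_pow (by omega)] at hh
    exact one_ne_zero (neg_eq_zero.mp hh.symm)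
  have h3 : φ (φ (φ h)) = - h⁻¹ := by
    have e : φ (φ (φ h)) = h ^ (q ^ 3) := hφ 3 h
    rw [e]
    field_simp
    rw [pow_succ] at hh
    exact hh
  have hy : φ h ≠ 0 := (map_ne_zero φ).mpr h0
  have hz : φ (φ h) ≠ 0 := (map_ne_zero φ).mpr hy
  have hf : ∀ x : F, fpol q h x = ∑ j : Fin 6,
      (![0, φ h / h, - φ (φ h) / h, 0, 1, 1] : Fin 6 → F) j * x ^ (q ^ (j : ℕ)) := by
    intro x
    have e1 : h ^ (q - 1) = φ h / h := by
      rw [hφ1, eq_div_iff h0, ← pow_succ, Nat.sub_add_cancel (by omega)]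
    have e2 : h ^ (q ^ 2 - 1) = φ (φ h) / h := by
      have e : φ (φ h) = h ^ (q ^ 2) := hφ 2 h
      rw [e, eq_div_iff h0, ← pow_succ, Nat.sub_add_cancel (Nat.one_le_pow _ _ (by omega))]
    rw [fpol, e1, e2]
    simp [Fin.sum_univ_succ]
    ring
  have main : ∀ (g : F → F) (ag : Fin 6 → F),
      (∀ x, g x = ∑ j : Fin 6, ag j * x ^ (q ^ (j : ℕ))) →
      IsPGammaLEquiv (linearSet (fpol q h)) (linearSet g) →
      ∃ (ρ : F ≃+* F) (A B C E κ : F), A * E - B * C ≠ 0 ∧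
        ∀ ag' : Fin 6 → F, (∀ j, ag' j = ρ (ag j)) →
        ∀ w : Fin 6 → F × F, DD (Af h (φ h) (φ (φ h))) w = κ * DD (dick φ ag')
          (fun i => NN ((φ ^ (i : ℕ)) A) ((φ ^ (i : ℕ)) B) ((φ ^ (i : ℕ)) C) ((φ ^ (i : ℕ)) E)
            (w i)) := by
    intro g ag hg heq
    obtain ⟨ρ, A, B, C, E, hΔ, hiff⟩ := equiv_coord q (fpol q h) g ag hg heq
    simp only [hf] at hiff
    obtain ⟨κ, hκ⟩ := main_prop hq hF hφ h6 _ (fun j => ρ (ag j)) A B C E hiff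
    rw [dick_f φ h h0 h3] at hκ
    refine ⟨ρ, A, B, C, E, κ, hΔ, fun ag' hag => ?_⟩
    obtain rfl : ag' = fun j => ρ (ag j) := funext hag
    exact hκ
  have h13 : ∀ δ : F, ¬ IsPGammaLEquiv (linearSet (fpol q h))
      (linearSet (fun x : F => x ^ q + δ * x ^ (q ^ 4))) := by
    intro δ heq
    obtain ⟨ρ, A, B, C, E, κ, hΔ, hw⟩ := main _ ![0, 1, 0, 0, δ, 0]
      (by intro x; simp [Fin.sum_univ_succ]) heq
    refine case13 hq hF h2 φ _ _ _ h0 hy hz _ A B C E κ (hw _ fun _ => rfl) hΔ ?_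
    rw [dick_eq]
    intro i j
    fin_cases i <;> fin_cases j <;> first | (right; decide) | (left; simp)
  refine ⟨?_, ?_, ?_, ?_⟩
  · have := h13 0
    simpa only [zero_mul, add_zero] using this
  · intro δ hδ0 _ heq
    have hδ : δ ≠ 0 := by
      rintro rfl
      apply hδ0
      apply zero_pow
      apply Nat.pos_iff_ne_zero.mp
      apply Nat.div_pos
      · have : q ≤ q ^ 6 := Nat.le_self_pow (by norm_num) q
        omega
      · omega
    obtain ⟨ρ, A, B, C, E, κ, hΔ, hw⟩ := main _ ![0, δ, 0, 0, 0, 1]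
      (by intro x; simp [Fin.sum_univ_succ]) heq
    have e : ∀ j, (![0, ρ δ, 0, 0, 0, 1] : Fin 6 → F) j = ρ ((![0, δ, 0, 0, 0, 1] : Fin 6 → F) j) := by
      intro j
      fin_cases j <;> simp
    replace hw := hw _ e
    exact case2 hq hF h2 φ _ _ _ h0 hy hz (ρ δ) ((map_ne_zero ρ).mpr hδ) A B C E κ hw hΔ
  · intro δ _ _
    exact h13 δ
  · intro δ hδ heq
    obtain ⟨ρ, A, B, C, E, κ, hΔ, hw⟩ := main _ ![0, 1, 0, 1, 0, δ]
      (by intro x; simp [Fin.sum_univ_succ]; ring) heq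
    have e : ∀ j, (![0, 1, 0, 1, 0, ρ δ] : Fin 6 → F) j = ρ ((![0, 1, 0, 1, 0, δ] : Fin 6 → F) j) := by
      intro j
      fin_cases j <;> simp
    replace hw := hw _ e
    obtain ⟨h5, hfix⟩ := case4 hq hF h2 φ h h0 h3 (ρ δ)
      (by rw [← map_pow, ← map_add, hδ, map_one]) A B C E κ hw hΔ
    apply hexc
    refine ⟨by rw [← hφ1]; exact hfix, ?_⟩
    have h1 : ((5 : ℕ) : F) = 0 := by exact_mod_cast h5
    rw [CharP.cast_eq_zero_iff F p, Nat.prime_dvd_prime_iff_eq hp Nat.prime_five] at h1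
    exact h1
end

section
/- Let q be an odd prime power, F a finite field with q^6 elements, and h ∈ F with h^(q^3+1) = −1. For every pair (a, b) ∈ F × F with (a, b) ≠ (0, 0), the kernel {x ∈ F : a·f_h(x) + b·x = 0} of the F_q-linear map x ↦ a·f_h(x) + b·x is an F_q-subspace of F of dimension at most 1 over F_q; equivalently, every nonzero member of the rank metric code C_{f_h} = {x ↦ a·f_h(x) + b·x : a, b ∈ F} has rank at least 5 as an F_q-linear endomorphism of the 6-dimensional F_q-vector space F, so C_{f_h} is an MRD code with parameters (6, 6, q; 5). -/
section helpers

variable {F : Type} [Field F]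

/-- `h^(q-1) = -1` is impossible. -/
lemma aux_s_ne (σ : F →+* F) (h2ne : (2 : F) ≠ 0) (h : F) (h0 : h ≠ 0)
    (h3 : σ (σ (σ h)) = -h⁻¹) : h + σ h ≠ 0 := by
  intro hs
  have e1 : σ h = -h := by linear_combination hs
  have e3 : σ (σ (σ h)) = -h := by simp [e1]
  rw [e3] at h3
  have hsq : h * h = 1 := by
    have : h = h⁻¹ := neg_injective h3
    calc h * h = h * h⁻¹ := by rw [← this]
      _ = 1 := mul_inv_cancel₀ h0
  have : h = 1 ∨ h = -1 := mul_self_eq_one_iff.mp hsq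
  apply h2ne
  rcases this with rfl | rfl
  · simp at e1; linear_combination e1
  · simp at e1; linear_combination -e1

lemma aux_norm (σ : F →+* F) (h2ne : (2 : F) ≠ 0) (h : F) (h0 : h ≠ 0)
    (h3 : σ (σ (σ h)) = -h⁻¹) (r t : F)
    (hr : σ (σ (σ r)) = h * σ (σ h) * r) (ht : σ (σ (σ t)) = -(h * σ h) * t)
    (E : (h + σ h) * t * σ (σ r) = h * σ h * (σ (σ h) + σ (σ (σ h))) * r * σ t) :
    r = 0 ∨ t = 0 := by
  by_contra hcon
  push Not at hcon
  obtain ⟨r0, t0⟩ := hcon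
  have s0 := aux_s_ne σ h2ne h h0 h3
  have inj : ∀ x : F, x ≠ 0 → σ x ≠ 0 := fun x hx => (map_ne_zero σ).mpr hx
  have E1 := congrArg σ E
  have E2 := congrArg σ E1
  have s1 := inj _ s0
  have s2 := inj _ s1
  have h10 := inj _ h0
  have h20 := inj _ h10
  have r1 := inj _ r0
  have r2 := inj _ r1
  have t1 := inj _ t0
  have t2 := inj _ t1
  simp only [map_add, map_mul, map_neg, map_inv₀, h3, hr, ht] at E E1 E2 s1 s2
  generalize σ (σ h) = hh2 at *
  generalize σ h = hh1 at *
  generalize σ (σ r) = rr2 at *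
  generalize σ r = rr1 at *
  generalize σ (σ t) = tt2 at *
  generalize σ t = tt1 at *
  have P : ∀ a b c a' b' c' : F, a = a' → b = b' → c = c' → a * b * c = a' * b' * c' := by
    intros; subst_vars; rfl
  have Q := P _ _ _ _ _ _ E E1 E2
  have s2' : h * hh2 + -1 ≠ 0 := by
    intro hh
    apply s2
    field_simp
    linear_combination hh
  have key : 2 * ((h + hh1) * (hh1 + hh2) * (h * hh2 + -1)) = 0 := by
    field_simp at Q
    linear_combination (-1 : F) * (h * hh2 + -1) * Q
  simp [h2ne, s0, s1, s2'] at key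

lemma aux_omega (σ : F →+* F) (h2ne : (2 : F) ≠ 0) (w : F)
    (h3 : σ (σ (σ w)) = -w) (hw : w * σ (σ w) = 1) : False := by
  have hw1 := congrArg σ hw
  simp only [map_mul, h3, map_one] at hw1
  have hw2 := congrArg σ hw1
  simp only [map_mul, map_neg, map_one] at hw2
  have w0 : w ≠ 0 := by rintro rfl; simp at hw
  have w10 : σ w ≠ 0 := (map_ne_zero σ).mpr w0
  have e : σ (σ w) = w := by
    apply mul_left_cancel₀ w10
    linear_combination -hw2 + hw1
  rw [e] at hw
  apply h2ne
  rcases mul_self_eq_one_iff.mp hw with rfl | rfl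
  · simp at hw1; linear_combination -hw1
  · simp at hw1; linear_combination -hw1

lemma aux_two (σ : F →+* F) (h2ne : (2 : F) ≠ 0) (h : F) (h0 : h ≠ 0)
    (h3 : σ (σ (σ h)) = -h⁻¹) (r t : F)
    (hr : σ (σ (σ r)) = h * σ (σ h) * r) (ht : σ (σ (σ t)) = -(h * σ h) * t)
    (E : h * σ h ^ 2 * (σ (σ h) + σ (σ (σ h))) * t * σ t = σ (σ h) * (h + σ h) * r * σ (σ r)) :
    t = 0 := by
  by_contra t0
  have s0 := aux_s_ne σ h2ne h h0 h3
  have inj : ∀ x : F, x ≠ 0 → σ x ≠ 0 := fun x hx => (map_ne_zero σ).mpr hx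
  have s1 := inj _ s0
  have s2 := inj _ s1
  have h10 := inj _ h0
  have h20 := inj _ h10
  have t1 := inj _ t0
  simp only [map_add, h3] at s1 s2 E
  have s2' : h * σ (σ h) - 1 ≠ 0 := by
    intro hh
    apply s2
    field_simp
    linear_combination hh
  have s1' : σ h + σ (σ h) ≠ 0 := s1
  apply aux_omega σ h2ne (r * (σ h + σ (σ h)) / (σ t * σ h * (σ (σ h) - h⁻¹)))
  · have d3 : σ (σ h) - h⁻¹ ≠ 0 := by rwa [sub_eq_add_neg]
    have d4 : -h⁻¹ + (σ h)⁻¹ * (-1) ≠ 0 := by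
      intro hh
      apply s0
      field_simp at hh
      linear_combination -hh
    have d5 : -(σ h)⁻¹ - (σ (σ h))⁻¹ * (1) ≠ 0 := by
      intro hh
      apply s1
      field_simp at hh
      linear_combination -hh
    simp only [map_add, map_sub, map_mul, map_neg, map_inv₀, map_div₀, h3, hr, ht]
    generalize σ (σ h) = hh2 at *
    generalize σ h = hh1 at *
    generalize σ t = tt1 at *
    have d5' : -hh1⁻¹ + -hh2⁻¹ ≠ 0 := by convert d5 using 1; ring
    have e1 : -h⁻¹ + -hh1⁻¹ = -(h+hh1)/(h*hh1) := by field_simp; ring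
    have e2 : -hh1⁻¹ + -hh2⁻¹ = -(hh1+hh2)/(hh1*hh2) := by field_simp; ring
    have e3 : hh2 - h⁻¹ = (h*hh2-1)/h := by field_simp
    have e4 : -hh2⁻¹ - (-h⁻¹)⁻¹ = (h*hh2-1)/hh2 := by field_simp; ring
    rw [e2, e3, e4]
    field_simp
  · simp only [map_add, map_sub, map_mul, map_neg, map_inv₀, map_div₀, h3, hr, ht]
    generalize σ (σ h) = hh2 at *
    generalize σ h = hh1 at *
    generalize σ t = tt1 at *
    generalize σ (σ r) = rr2 at *
    have e2 : -hh1⁻¹ - hh2⁻¹ = -(hh1+hh2)/(hh1*hh2) := by field_simp; ring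
    have e3 : hh2 - h⁻¹ = (h*hh2-1)/h := by field_simp
    have e1 : -h⁻¹ + -hh1⁻¹ = -(h+hh1)/(h*hh1) := by field_simp; ring
    have e5 : hh2 + -h⁻¹ = (h*hh2-1)/h := by field_simp; ring
    rw [e5] at E
    try rw [e1]
    try rw [e2]
    rw [e3]
    field_simp at E ⊢
    linear_combination -E

/-- core, in terms of components -/
lemma aux_core (σ : F →+* F) (h2ne : (2 : F) ≠ 0) (h : F) (h0 : h ≠ 0)
    (h3 : σ (σ (σ h)) = -h⁻¹) (r t ρ τ : F)
    (hr : σ (σ (σ r)) = h * σ (σ h) * r) (ht : σ (σ (σ t)) = -(h * σ h) * t)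
    (hρ : σ (σ (σ ρ)) = h * σ (σ h) * ρ) (hτ : σ (σ (σ τ)) = -(h * σ h) * τ)
    (α β : F) (hα : α = -(σ (σ h) * (h + σ h) / (h * σ h)))
    (hβ : β = -(σ h * (σ (σ h) + σ (σ (σ h)))))
    (Q1 : α * (t * σ (σ ρ) - τ * σ (σ r)) = -(σ (σ h) / σ h) * (β * (r * σ τ - ρ * σ t)))
    (P : α * (r * σ (σ ρ) - ρ * σ (σ r)) + β * (t * σ τ - τ * σ t)
      = (σ (σ h) / σ h - 1) * (β * (r * σ τ - ρ * σ t))) (t0 : t ≠ 0) :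
    ∃ l : F, σ l = l ∧ ρ = l * r ∧ τ = l * t := by
  have inj : ∀ x : F, x ≠ 0 → σ x ≠ 0 := fun x hx => (map_ne_zero σ).mpr hx
  have h10 := inj _ h0
  have h20 := inj _ h10
  have t1 := inj _ t0
  obtain ⟨μ, rfl⟩ : ∃ μ, τ = μ * t := ⟨τ / t, by field_simp⟩
  have hμ : σ (σ (σ μ)) = μ := by
    simp only [map_mul, ht] at hτ
    have : -(h * σ h) * t ≠ 0 := by simp [h0, h10, t0]
    apply mul_right_cancel₀ this
    linear_combination hτ
  have key := aux_norm σ h2ne h h0 h3 (r * σ μ - ρ) t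
    (by simp only [map_mul, map_sub, hr, hρ, hμ]; ring) ht (by
      simp only [map_mul, map_sub, hμ] at Q1 ⊢
      rw [hα, hβ] at Q1
      generalize σ (σ (σ h)) = hh3 at *
      generalize σ (σ h) = hh2 at *
      generalize σ h = hh1 at *
      field_simp at Q1
      linear_combination Q1)
  have hρ' : ρ = r * σ μ := by
    rcases key with k | k
    · linear_combination -k
    · exact absurd k t0
  subst hρ'
  have P' : (σ μ - μ) * (β * t * σ t - α * r * σ (σ r)) = 0 := by
    simp only [map_mul, hμ] at P
    linear_combination P
  rcases mul_eq_zero.mp P' with k | k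
  · have : σ μ = μ := by linear_combination k
    exact ⟨μ, this, by rw [this]; ring, rfl⟩
  · exfalso
    apply t0
    apply aux_two σ h2ne h h0 h3 r t hr ht
    rw [hα, hβ] at k
    generalize σ (σ (σ h)) = hh3 at *
    generalize σ (σ h) = hh2 at *
    generalize σ h = hh1 at *
    field_simp at k
    linear_combination -k

lemma aux_decomp (σ : F →+* F) (h6 : ∀ x, σ (σ (σ (σ (σ (σ x))))) = x)
    (h2ne : (2 : F) ≠ 0) (h : F) (h0 : h ≠ 0)
    (h3 : σ (σ (σ h)) = -h⁻¹) (x : F) : ∃ r t : F, x = r + t ∧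
    σ (σ (σ r)) = h * σ (σ h) * r ∧ σ (σ (σ t)) = -(h * σ h) * t := by
  have s0 := aux_s_ne σ h2ne h h0 h3
  have inj : ∀ x : F, x ≠ 0 → σ x ≠ 0 := fun x hx => (map_ne_zero σ).mpr hx
  have h10 := inj _ h0
  have h20 := inj _ h10
  have s1 := inj _ s0
  rw [map_add] at s1
  refine ⟨(σ (σ (σ x)) + h * σ h * x) / (h * (σ h + σ (σ h))),
    (h * σ (σ h) * x - σ (σ (σ x))) / (h * (σ h + σ (σ h))), ?_, ?_, ?_⟩
  · field_simp; ring
  all_goals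
    simp only [map_div₀, map_add, map_sub, map_mul, h6, h3, map_neg, map_inv₀]
    generalize σ (σ h) = hh2 at *
    generalize σ h = hh1 at *
    generalize σ (σ (σ x)) = x3 at *
    have e2 : -hh1⁻¹ + -hh2⁻¹ = -(hh1+hh2)/(hh1*hh2) := by field_simp; ring
    rw [e2]
    field_simp
    ring

lemma aux_main (σ : F →+* F) (h6 : ∀ x, σ (σ (σ (σ (σ (σ x))))) = x)
    (h2ne : (2 : F) ≠ 0) (h : F) (h0 : h ≠ 0)
    (h3 : σ (σ (σ h)) = -h⁻¹) (f : F → F)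
    (hf : ∀ x, f x = σ h / h * σ x - σ (σ h) / h * σ (σ x) + σ (σ (σ (σ x)))
      + σ (σ (σ (σ (σ x))))) (x y : F) (hx : x ≠ 0) (hxy : x * f y = y * f x) :
    ∃ l : F, σ l = l ∧ y = l * x := by
  have s0 := aux_s_ne σ h2ne h h0 h3
  have inj : ∀ x : F, x ≠ 0 → σ x ≠ 0 := fun x hx => (map_ne_zero σ).mpr hx
  have h10 := inj _ h0
  have h20 := inj _ h10
  have s1 := inj _ s0
  rw [map_add] at s1
  obtain ⟨r, t, rfl, hr, ht⟩ := aux_decomp σ h6 h2ne h h0 h3 x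
  obtain ⟨ρ, τ, rfl, hρ, hτ⟩ := aux_decomp σ h6 h2ne h h0 h3 y
  obtain ⟨α, hα⟩ : ∃ α, α = -(σ (σ h) * (h + σ h) / (h * σ h)) := ⟨_, rfl⟩
  obtain ⟨β, hβ⟩ : ∃ β, β = -(σ h * (σ (σ h) + σ (σ (σ h)))) := ⟨_, rfl⟩
  have hfd : ∀ r t, σ (σ (σ r)) = h * σ (σ h) * r → σ (σ (σ t)) = -(h * σ h) * t →
      f (r + t) = α * σ (σ r) + β * σ t := by
    intro r t hr ht
    rw [hf, hα, hβ]
    simp only [map_add, map_mul, map_neg, map_inv₀, hr, ht, h3]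
    field_simp
    ring
  rw [hfd r t hr ht, hfd ρ τ hρ hτ] at hxy
  have hxy3 := congrArg (fun z => σ (σ (σ z))) hxy
  have a3 : σ (σ (σ α)) = -(σ (σ h) * (h + σ h) / (h * σ h)) * (h * σ h / σ (σ h) ^ 2) := by
    rw [hα]
    simp only [map_add, map_mul, map_neg, map_inv₀, map_div₀, h3]
    generalize σ (σ h) = hh2 at *
    generalize σ h = hh1 at *
    field_simp
    ring
  rw [← hα] at a3
  have b3 : σ (σ (σ β)) = β * (-h / (σ (σ h) * σ h ^ 2)) := by
    rw [hβ]
    simp only [map_add, map_mul, map_neg, map_inv₀, map_div₀, h3]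
    generalize σ (σ h) = hh2 at *
    generalize σ h = hh1 at *
    field_simp
    ring
  simp only [map_add, map_mul, map_neg, map_inv₀, hr, ht, hρ, hτ, h3, a3, b3] at hxy3
  have hQ : α * (t * σ (σ ρ) - τ * σ (σ r))
      = -(σ (σ h) / σ h) * (β * (r * σ τ - ρ * σ t)) := by
    apply mul_left_cancel₀ (mul_ne_zero s1 h0)
    clear a3 b3 hα hβ hfd hr ht hρ hτ hf
    generalize σ (σ h) = hh2 at *
    generalize σ h = hh1 at *
    linear_combination (norm := (field_simp; ring)) (hh2 / h) * hxy3 + (h * hh2) * hxy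
  have hP : α * (r * σ (σ ρ) - ρ * σ (σ r)) + β * (t * σ τ - τ * σ t)
      = (σ (σ h) / σ h - 1) * (β * (r * σ τ - ρ * σ t)) := by
    linear_combination hxy - hQ
  by_cases t0 : t = 0
  · by_cases τ0 : τ = 0
    · subst t0 τ0
      have r0 : r ≠ 0 := by simpa using hx
      obtain ⟨l, rfl⟩ : ∃ l, ρ = l * r := ⟨ρ / r, by field_simp⟩
      have hl : σ (σ (σ l)) = l := by
        simp only [map_mul, hr] at hρ
        have : h * σ (σ h) * r ≠ 0 := by simp [h0, h20, r0]
        apply mul_right_cancel₀ this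
        linear_combination hρ
      have r2 := inj _ (inj _ r0)
      have α0 : α ≠ 0 := by rw [hα]; simp [h0, h10, h20, s0]
      have hl2 : σ (σ l) = l := by
        simp only [map_mul, map_zero] at hP
        have : α * r * σ (σ r) ≠ 0 := by simp [α0, r0, r2]
        apply mul_right_cancel₀ this
        linear_combination hP
      rw [hl2] at hl
      exact ⟨l, hl, by ring⟩
    · obtain ⟨l, hl, e1, e2⟩ := aux_core σ h2ne h h0 h3 ρ τ r t hρ hτ hr ht α β hα hβ
        (by linear_combination -hQ) (by linear_combination -hP) τ0
      have l0 : l ≠ 0 := by rintro rfl; apply hx; rw [e1, e2]; ring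
      exact ⟨l⁻¹, by rw [map_inv₀, hl], by rw [e1, e2]; field_simp⟩
  · obtain ⟨l, hl, e1, e2⟩ := aux_core σ h2ne h h0 h3 r t ρ τ hr ht hρ hτ α β hα hβ
        hQ hP t0
    exact ⟨l, hl, by rw [e1, e2]; ring⟩

end helpers


/-- Let `q` be an odd prime power, `F` a finite field with `q^6` elements,
and `h ∈ F` with `h^(q^3+1) = −1`. For every pair `(a,b) ≠ (0,0)`, the kernel
`{x ∈ F : a·f_h(x) + b·x = 0}` is an `F_q`-subspace of `F` of dimension at most `1`
over `F_q`: it is spanned over `F_q = {λ : λ^q = λ}` by a single element `x₀`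
(equivalently it has at most `q` elements, i.e. every nonzero member of the rank-metric
code `C_{f_h}` has rank at least `5`, so `C_{f_h}` is an MRD code with parameters
`(6,6,q;5)`). -/
theorem stmt17 (q : ℕ) (hq : IsPrimePow q) (hodd : Odd q)
    (F : Type) [Field F] [Fintype F] (hF : Fintype.card F = q ^ 6)
    (h : F) (hh : h ^ (q ^ 3 + 1) = -1)
    (fh : F → F)
    (hfh : ∀ x : F, fh x = h ^ (q - 1) * x ^ q - h ^ (q ^ 2 - 1) * x ^ (q ^ 2)
      + x ^ (q ^ 4) + x ^ (q ^ 5)) :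
    ∀ a b : F, ¬ (a = 0 ∧ b = 0) →
      (∃ x₀ : F, a * fh x₀ + b * x₀ = 0 ∧
        ∀ x : F, a * fh x + b * x = 0 → ∃ l : F, l ^ q = l ∧ x = l * x₀) ∧
      Nat.card {x : F // a * fh x + b * x = 0} ≤ q := by
  obtain ⟨p, k, hp, hk, rfl⟩ := hq
  have hp' : p.Prime := hp.nat_prime
  haveI : Fact p.Prime := ⟨hp'⟩
  haveI : CharP F p := by
    obtain ⟨p', hc⟩ := CharP.exists F
    haveI := hc
    have hpp : p'.Prime := (CharP.char_is_prime_or_zero F p').resolve_right (CharP.char_ne_zero_of_finite F p')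
    obtain ⟨n, _, hn⟩ := FiniteField.card F p'
    rw [hF, ← pow_mul] at hn
    have : p' ∣ p ^ (k * 6) := by rw [hn]; exact dvd_pow_self _ n.ne_zero
    have : p' = p := (Nat.prime_dvd_prime_iff_eq hpp hp').mp (hpp.dvd_of_dvd_pow this)
    rwa [← this]
  have hp2 : p ≠ 2 := by
    rintro rfl
    have : Even (2 ^ k) := (Nat.even_pow.mpr ⟨even_two, hk.ne'⟩)
    exact (Nat.not_even_iff_odd.mpr hodd) this
  have h2ne : (2 : F) ≠ 0 := Ring.two_ne_zero (by rwa [ringChar.eq F p])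
  set q := p ^ k with hqdef
  have hq1 : 1 < q := Nat.one_lt_pow hk.ne' hp'.one_lt
  obtain ⟨σ, hσ⟩ : ∃ σ : F →+* F, ∀ x, σ x = x ^ q := ⟨iterateFrobenius F p k, fun x => by
    rw [iterateFrobenius_def]⟩
  have p2 : ∀ x : F, σ (σ x) = x ^ (q ^ 2) := fun x => by simp only [hσ, ← pow_mul]; ring_nf
  have p3 : ∀ x : F, σ (σ (σ x)) = x ^ (q ^ 3) := fun x => by simp only [hσ, ← pow_mul]; ring_nf
  have p4 : ∀ x : F, σ (σ (σ (σ x))) = x ^ (q ^ 4) := fun x => by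
    simp only [hσ, ← pow_mul]; ring_nf
  have p5 : ∀ x : F, σ (σ (σ (σ (σ x)))) = x ^ (q ^ 5) := fun x => by
    simp only [hσ, ← pow_mul]; ring_nf
  have h6 : ∀ x : F, σ (σ (σ (σ (σ (σ x))))) = x := fun x => by
    rw [p5, hσ, ← pow_mul, ← pow_succ', ← hF, FiniteField.pow_card]
  have h0 : h ≠ 0 := by
    rintro rfl
    simp at hh
  have h3 : σ (σ (σ h)) = -h⁻¹ := by
    rw [p3]
    rw [pow_succ] at hh
    field_simp
    exact hh
  have hf' : ∀ x, fh x = σ h / h * σ x - σ (σ h) / h * σ (σ x) + σ (σ (σ (σ x)))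
      + σ (σ (σ (σ (σ x)))) := by
    intro x
    rw [hfh, p5, p4, p2, p2, hσ, hσ]
    rw [pow_sub₀ h h0 (by omega : 1 ≤ q), pow_sub₀ h h0 (Nat.one_le_pow _ _ (by omega) : 1 ≤ q ^ 2)]
    simp [div_eq_mul_inv]
  have main := aux_main σ h6 h2ne h h0 h3 fh hf'
  have f0 : fh 0 = 0 := by rw [hf']; simp
  intro a b hab
  have first : ∃ x₀ : F, a * fh x₀ + b * x₀ = 0 ∧
        ∀ x : F, a * fh x + b * x = 0 → ∃ l : F, l ^ q = l ∧ x = l * x₀ := by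
    by_cases hk : ∃ x : F, x ≠ 0 ∧ a * fh x + b * x = 0
    · obtain ⟨x, hx, hk⟩ := hk
      refine ⟨x, hk, fun y hy => ?_⟩
      have ha : a ≠ 0 := by
        rintro rfl
        apply hab
        simpa [hx] using hk
      obtain ⟨l, hl, e⟩ := main x y hx (by
        apply mul_left_cancel₀ ha
        linear_combination x * hy - y * hk)
      exact ⟨l, by rw [← hσ, hl], e⟩
    · push Not at hk
      refine ⟨0, by simp [f0], fun y hy => ⟨1, by simp, ?_⟩⟩
      by_contra hne
      exact hk y (by simpa using hne) hy
  refine ⟨first, ?_⟩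
  obtain ⟨x₀, -, hx⟩ := first
  choose! l hl hlx using hx
  classical
  have pne : (Polynomial.X ^ q - Polynomial.X : Polynomial F) ≠ 0 :=
    FiniteField.X_pow_card_sub_X_ne_zero F hq1
  let S : Finset F := (Polynomial.X ^ q - Polynomial.X : Polynomial F).roots.toFinset
  have hS : S.card ≤ q := by
    calc S.card ≤ _ := Multiset.toFinset_card_le _
      _ ≤ _ := Polynomial.card_roots' _
      _ = q := FiniteField.X_pow_card_sub_X_natDegree_eq F hq1
  let φ : {x : F // a * fh x + b * x = 0} → S := fun x => ⟨l x.1, by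
    simp only [S, Multiset.mem_toFinset, Polynomial.mem_roots pne]
    simp [Polynomial.IsRoot, hl x.1 x.2]⟩
  have hφ : Function.Injective φ := by
    intro x y hxy
    have : l x.1 = l y.1 := congrArg Subtype.val hxy
    apply Subtype.ext
    rw [hlx x.1 x.2, hlx y.1 y.2, this]
  calc Nat.card {x : F // a * fh x + b * x = 0} ≤ Nat.card S := Nat.card_le_card_of_injective φ hφ
    _ = S.card := by simp
    _ ≤ q := hS
end

section
/- Let q be an odd prime power, F a finite field with q^6 elements, and h ∈ F with h^(q^3+1) = −1 (so h ≠ 0). In the F-vector space F^6 with coordinates (x_0, x_1, x_2, x_3, x_4, x_5): (a) the solution space of the four linear equations x_0 = 0, x_1 = 0, −h^(q^2−1)·x_2 + x_4 + x_5 = 0, and h^(q^2−q)·x_2 + h^(−q−1)·x_3 + x_5 = 0 has dimension 2 over F; (b) the solution space of the six linear equations x_0 = 0, x_1 = 0, x_2 = 0, x_4 + x_5 = 0, h^(−q−1)·x_3 + x_5 = 0, and −h^(−q^2−1)·x_3 + h^(−q^2−q)·x_4 = 0 is the zero subspace. (These subspaces are Γ ∩ Γ^σ̂ and Γ ∩ Γ^σ̂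 ∩ Γ^(σ̂^2), where Γ is the subspace cut out by x_0 = 0 and h^(q−1)·x_1 − h^(q^2−1)·x_2 + x_4 + x_5 = 0 and σ̂ sends (x_0, …, x_5) to (x_5^q, x_0^q, x_1^q, x_2^q, x_3^q, x_4^q); consequently the intersection number of Γ with respect to σ̂ equals 3.) -/
theorem aux18 {F : Type} [Field F] (A B C : F) :
    Module.finrank F
        ↥(LinearMap.ker (LinearMap.proj (R := F) (φ := fun _ : Fin 6 => F) 0) ⊓
          LinearMap.ker (LinearMap.proj (R := F) (φ := fun _ : Fin 6 => F) 1) ⊓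
          LinearMap.ker ((-C) • LinearMap.proj (R := F) (φ := fun _ : Fin 6 => F) 2 +
            LinearMap.proj 4 + LinearMap.proj 5) ⊓
          LinearMap.ker (A • LinearMap.proj (R := F) (φ := fun _ : Fin 6 => F) 2 +
            B • LinearMap.proj 3 + LinearMap.proj 5)) = 2 := by
  set S := (LinearMap.ker (LinearMap.proj (R := F) (φ := fun _ : Fin 6 => F) 0) ⊓
          LinearMap.ker (LinearMap.proj (R := F) (φ := fun _ : Fin 6 => F) 1) ⊓
          LinearMap.ker ((-C) • LinearMap.proj (R := F) (φ := fun _ : Fin 6 => F) 2 +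
            LinearMap.proj 4 + LinearMap.proj 5) ⊓
          LinearMap.ker (A • LinearMap.proj (R := F) (φ := fun _ : Fin 6 => F) 2 +
            B • LinearMap.proj 3 + LinearMap.proj 5)) with hS
  have hmem : ∀ x : Fin 6 → F, x ∈ S ↔ (((x 0 = 0 ∧ x 1 = 0) ∧ -C * x 2 + x 4 + x 5 = 0) ∧
      A * x 2 + B * x 3 + x 5 = 0) := by
    intro x
    simp only [hS, Submodule.mem_inf, LinearMap.mem_ker, LinearMap.add_apply,
      LinearMap.smul_apply, LinearMap.proj_apply, smul_eq_mul]
  let f : S →ₗ[F] F × F :=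
    { toFun := fun x => (x.1 2, x.1 3)
      map_add' := fun x y => rfl
      map_smul' := fun c x => rfl }
  have hf : Function.Bijective f := by
    constructor
    · rw [← LinearMap.ker_eq_bot, LinearMap.ker_eq_bot']
      rintro ⟨x, hx⟩ h
      obtain ⟨⟨⟨h0, h1⟩, h4⟩, h5⟩ := (hmem x).mp hx
      have h2 : x 2 = 0 := congrArg Prod.fst h
      have h3 : x 3 = 0 := congrArg Prod.snd h
      have h5' : x 5 = 0 := by simpa [h2, h3] using h5
      have h4' : x 4 = 0 := by simpa [h2, h5'] using h4
      apply Subtype.ext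
      funext i
      fin_cases i <;> simpa
    · rintro ⟨s, t⟩
      refine ⟨⟨![0, 0, s, t, C * s + (A * s + B * t), -(A * s + B * t)], ?_⟩, rfl⟩
      rw [hmem]
      refine ⟨⟨⟨rfl, rfl⟩, ?_⟩, ?_⟩
      · change -C * s + (C * s + (A * s + B * t)) + -(A * s + B * t) = 0
        ring
      · change A * s + B * t + -(A * s + B * t) = 0
        ring
  rw [(LinearEquiv.ofBijective f hf).finrank_eq]
  simp

/-- Let `q` be an odd prime power, `F` a finite field with `q^6` elements,
and `h ∈ F` with `h^(q^3+1) = −1` (so `h ≠ 0`). In `F^6` with coordinates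
`(x_0, …, x_5)`: (a) the solution space of `x_0 = 0`, `x_1 = 0`,
`−h^(q^2−1)·x_2 + x_4 + x_5 = 0`, `h^(q^2−q)·x_2 + h^(−q−1)·x_3 + x_5 = 0` has
dimension `2` over `F`; (b) the solution space of `x_0 = 0`, `x_1 = 0`, `x_2 = 0`,
`x_4 + x_5 = 0`, `h^(−q−1)·x_3 + x_5 = 0`, `−h^(−q^2−1)·x_3 + h^(−q^2−q)·x_4 = 0` is
the zero subspace. (These are `Γ ∩ Γ^σ̂` and `Γ ∩ Γ^σ̂ ∩ Γ^(σ̂²)`; consequently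
`intn_σ̂(Γ) = 3`.) Negative powers of `h` are written as powers of `h⁻¹`. -/
theorem stmt18 (q : ℕ) (hq : IsPrimePow q) (hodd : Odd q)
    (F : Type) [Field F] [Fintype F] (hF : Fintype.card F = q ^ 6)
    (h : F) (hh : h ^ (q ^ 3 + 1) = -1) :
    Module.finrank F
        ↥(LinearMap.ker (LinearMap.proj (R := F) (φ := fun _ : Fin 6 => F) 0) ⊓
          LinearMap.ker (LinearMap.proj (R := F) (φ := fun _ : Fin 6 => F) 1) ⊓
          LinearMap.ker ((-(h ^ (q ^ 2 - 1))) • LinearMap.proj (R := F) (φ := fun _ : Fin 6 => F) 2 +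
            LinearMap.proj 4 + LinearMap.proj 5) ⊓
          LinearMap.ker ((h ^ (q ^ 2 - q)) • LinearMap.proj (R := F) (φ := fun _ : Fin 6 => F) 2 +
            (h⁻¹ ^ (q + 1)) • LinearMap.proj 3 + LinearMap.proj 5)) = 2 ∧
    (LinearMap.ker (LinearMap.proj (R := F) (φ := fun _ : Fin 6 => F) 0) ⊓
      LinearMap.ker (LinearMap.proj (R := F) (φ := fun _ : Fin 6 => F) 1) ⊓
      LinearMap.ker (LinearMap.proj (R := F) (φ := fun _ : Fin 6 => F) 2) ⊓
      LinearMap.ker (LinearMap.proj (R := F) (φ := fun _ : Fin 6 => F) 4 +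
        LinearMap.proj 5) ⊓
      LinearMap.ker ((h⁻¹ ^ (q + 1)) • LinearMap.proj (R := F) (φ := fun _ : Fin 6 => F) 3 +
        LinearMap.proj 5) ⊓
      LinearMap.ker ((-(h⁻¹ ^ (q ^ 2 + 1))) • LinearMap.proj (R := F) (φ := fun _ : Fin 6 => F) 3 +
        (h⁻¹ ^ (q ^ 2 + q)) • LinearMap.proj 4) = ⊥) := by
  have hne : h ≠ 0 := by
    rintro rfl
    rw [zero_pow (by omega)] at hh
    exact one_ne_zero (neg_eq_zero.mp hh.symm)
  constructor
  · generalize h ^ (q ^ 2 - 1) = C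
    generalize h ^ (q ^ 2 - q) = A
    generalize h⁻¹ ^ (q + 1) = B
    have e := aux18 A B C
    exact e
  · have hchar : ringChar F ≠ 2 := by
      intro hc
      have h2 := FiniteField.even_card_iff_char_two.mp hc
      rw [hF] at h2
      have := (hodd.pow (n := 6))
      rw [Nat.odd_iff] at this
      omega
    have h2q : h ^ (2 * q) ≠ 1 := by
      intro h1
      have e1 : h ^ (2 * q ^ 3) = 1 := by
        rw [show 2 * q ^ 3 = 2 * q * q ^ 2 by ring, pow_mul, h1, one_pow]
      have e2 : h ^ 2 = 1 := by
        have e3 : (h ^ (q ^ 3 + 1)) ^ 2 = 1 := by rw [hh]; ring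
        rw [← pow_mul, show (q ^ 3 + 1) * 2 = 2 * q ^ 3 + 2 by ring, pow_add, e1, one_mul] at e3
        exact e3
      obtain ⟨k, hk⟩ := (hodd.pow (n := 3)).add_one
      rw [hk, ← two_mul, pow_mul, e2, one_pow] at hh
      exact Ring.neg_one_ne_one_of_char_ne_two hchar hh.symm
    rw [eq_bot_iff]
    intro x hx
    simp only [Submodule.mem_inf, LinearMap.mem_ker, LinearMap.add_apply, LinearMap.smul_apply,
      LinearMap.proj_apply, smul_eq_mul] at hx
    obtain ⟨⟨⟨⟨⟨h0, h1⟩, h2⟩, h45⟩, h35⟩, h34⟩ := hx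
    have x4 : x 4 = h⁻¹ ^ (q + 1) * x 3 := by linear_combination h45 - h35
    have key : h⁻¹ ^ (q ^ 2 + 1) * (h⁻¹ ^ (2 * q) - 1) * x 3 = 0 := by
      rw [x4] at h34
      rw [← h34]; ring
    have x3 : x 3 = 0 := by
      rcases mul_eq_zero.mp key with hk | hk
      · rcases mul_eq_zero.mp hk with hk | hk
        · exact absurd hk (pow_ne_zero _ (inv_ne_zero hne))
        · rw [sub_eq_zero, inv_pow, inv_eq_one] at hk
          exact absurd hk h2q
      · exact hk
    have x4' : x 4 = 0 := by rw [x4, x3, mul_zero]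
    have x5 : x 5 = 0 := by linear_combination h45 - x4'
    rw [Submodule.mem_bot]
    ext i
    fin_cases i <;> simpa
end
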